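/- Let P be a centrally symmetric simplicial d-polytope. Then for every r with 1 ≤ r ≤ ⌊d/2⌋, g_r(P) = h_r(P) − h_{r−1}(P) ≥ C(d, r) − C(d, r−1). -/

import Mathlib

open Set

/-- A polytope: the convex hull of a finite set of points. -/
def IsPolytope {E : Type*} [AddCommGroup E] [Module ℝ E] (P : Set E) : Prop :=
  ∃ V : Finset E, P = convexHull ℝ (V : Set E)

/-- A (nonempty, proper) exposed face of `P`. -/
def IsProperFace {E : Type*} [AddCommGroup E] [Module ℝ E] [TopologicalSpace E]
    (P F : Set E) : Prop :=
  F.Nonempty ∧ F ≠ P ∧ IsExposed ℝ P F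

/-- A polytope is simplicial if the vertices (extreme points) of each proper face are
affinely independent. -/
def IsSimplicial {d : ℕ} (P : Set (Fin d → ℝ)) : Prop :=
  ∀ F : Set (Fin d → ℝ), IsProperFace P F →
    AffineIndependent ℝ (fun x : F.extremePoints ℝ => (x : Fin d → ℝ))

/-- The number of `j`-dimensional proper faces of `P`. -/
noncomputable def faceCount {d : ℕ} (P : Set (Fin d → ℝ)) (j : ℕ) : ℕ :=
  Set.ncard {F : Set (Fin d → ℝ) |
    IsProperFace P F ∧ Module.finrank ℝ (affineSpan ℝ F).direction = j}

/-- `f_{j-1}(P)` with the convention `f_{-1} = 1`. -/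
noncomputable def fm {d : ℕ} (P : Set (Fin d → ℝ)) (j : ℕ) : ℤ :=
  if j = 0 then 1 else (faceCount P (j - 1) : ℤ)

/-- The `h`-numbers of a simplicial `d`-polytope:
`h_i = ∑_{j=0}^{i} (-1)^{i-j} C(d-j, i-j) f_{j-1}`. -/
noncomputable def hP {d : ℕ} (P : Set (Fin d → ℝ)) (i : ℕ) : ℤ :=
  ∑ j ∈ Finset.range (i + 1),
    (-1 : ℤ) ^ (i - j) * ((d - j).choose (i - j)) * fm P j

set_option linter.unusedSectionVars false

namespace CSPoly

section Inertia

variable {M : Type*} [AddCommGroup M] [Module ℝ M]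

/-- The form `B` is positive definite on the subspace `W`. -/
def PosOn (B : LinearMap.BilinForm ℝ M) (W : Submodule ℝ M) : Prop :=
  ∀ u ∈ W, u ≠ 0 → 0 < B u u

/-- The largest dimension of a subspace on which `B` is positive definite. -/
noncomputable def posIdx (B : LinearMap.BilinForm ℝ M) : ℕ :=
  sSup {k | ∃ W : Submodule ℝ M, PosOn B W ∧ Module.finrank ℝ W = k}

variable [FiniteDimensional ℝ M]

lemma posIdx_bddAbove (B : LinearMap.BilinForm ℝ M) :
    BddAbove {k | ∃ W : Submodule ℝ M, PosOn B W ∧ Module.finrank ℝ W = k} := by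
  refine ⟨Module.finrank ℝ M, ?_⟩
  rintro k ⟨W, -, rfl⟩
  exact Submodule.finrank_le W

lemma PosOn.finrank_le {B : LinearMap.BilinForm ℝ M} {W : Submodule ℝ M} (h : PosOn B W) :
    Module.finrank ℝ W ≤ posIdx B :=
  le_csSup (posIdx_bddAbove B) ⟨W, h, rfl⟩

lemma exists_posOn (B : LinearMap.BilinForm ℝ M) :
    ∃ W : Submodule ℝ M, PosOn B W ∧ Module.finrank ℝ W = posIdx B := by
  have h := Nat.sSup_mem (s := {k | ∃ W : Submodule ℝ M, PosOn B W ∧ Module.finrank ℝ W = k})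
    ⟨0, ⊥, by intro u hu h0; exact absurd ((Submodule.mem_bot ℝ).1 hu) h0, by simp⟩
    (posIdx_bddAbove B)
  exact h

lemma posIdx_zero : posIdx (0 : LinearMap.BilinForm ℝ M) = 0 := by
  obtain ⟨W, hW, h⟩ := exists_posOn (0 : LinearMap.BilinForm ℝ M)
  rw [← h, Submodule.finrank_eq_zero, Submodule.eq_bot_iff]
  intro x hx
  by_contra h0
  simpa using hW x hx h0

/-- Orthogonal projection to a subspace on which the form is definite. -/
lemma PosOn.exists_proj {B : LinearMap.BilinForm ℝ M} {W : Submodule ℝ M} (h : PosOn B W)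
    (x : M) : ∃ p ∈ W, ∀ w ∈ W, B (x - p) w = 0 := by
  let f : W →ₗ[ℝ] Module.Dual ℝ W := (LinearMap.lcomp ℝ ℝ W.subtype) ∘ₗ B ∘ₗ W.subtype
  have hinj : Function.Injective f := by
    rw [← LinearMap.ker_eq_bot, LinearMap.ker_eq_bot']
    intro w hw
    by_contra h0
    have h1 := h w w.2 (by simpa using h0)
    have h2 : f w w = 0 := by rw [hw]; rfl
    have h3 : f w w = B w w := rfl
    linarith [h3 ▸ h2]
  have hsurj : Function.Surjective f :=
    (LinearMap.injective_iff_surjective_of_finrank_eq_finrank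
      (Subspace.dual_finrank_eq).symm).1 hinj
  obtain ⟨p, hp⟩ := hsurj ((B x).comp W.subtype)
  refine ⟨p, p.2, fun w hw => ?_⟩
  have := congrArg (fun g => g ⟨w, hw⟩) hp
  have h3 : f p ⟨w, hw⟩ = B p w := rfl
  simp only [h3, LinearMap.comp_apply, Submodule.subtype_apply] at this
  simp [this]

/-- A vector orthogonal to a maximal positive subspace is nonpositive, and lies in the radical
if it is isotropic. -/
lemma PosOn.nonpos_of_orthogonal {B : LinearMap.BilinForm ℝ M} (hs : ∀ u v, B u v = B v u)
    {W : Submodule ℝ M} (h : PosOn B W) (hmax : Module.finrank ℝ W = posIdx B)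
    {u : M} (hu : ∀ w ∈ W, B u w = 0) : B u u ≤ 0 := by
  by_contra hlt
  push Not at hlt
  have hpos : PosOn B (W ⊔ ℝ ∙ u) := by
    intro x hx hx0
    obtain ⟨w, hw, y, hy, rfl⟩ := Submodule.mem_sup.1 hx
    obtain ⟨t, rfl⟩ := Submodule.mem_span_singleton.1 hy
    have e : B (w + t • u) (w + t • u) = B w w + t ^ 2 * B u u := by
      simp only [map_add, map_smul, LinearMap.add_apply, LinearMap.smul_apply, smul_eq_mul,
        hs w u, hu w hw]
      ring
    rw [e]
    by_cases hw0 : w = 0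
    · have ht : t ≠ 0 := by rintro rfl; simp [hw0] at hx0
      subst hw0
      have : 0 < t ^ 2 := by positivity
      simpa using mul_pos this hlt
    · have := h w hw hw0
      have : 0 ≤ t ^ 2 * B u u := by positivity
      linarith
  have h1 := hpos.finrank_le
  have hlt2 : W < W ⊔ ℝ ∙ u := by
    refine lt_of_le_of_ne le_sup_left fun heq => ?_
    have hmem : u ∈ W := by
      rw [heq]; exact Submodule.mem_sup_right (Submodule.mem_span_singleton_self u)
    have := hu u hmem
    linarith
  have := Submodule.finrank_lt_finrank_of_lt hlt2
  omega

lemma PosOn.radical_of_orthogonal {B : LinearMap.BilinForm ℝ M} (hs : ∀ u v, B u v = B v u)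
    {W : Submodule ℝ M} (h : PosOn B W) (hmax : Module.finrank ℝ W = posIdx B)
    {u : M} (hu : ∀ w ∈ W, B u w = 0) (h0 : B u u = 0) : B u = 0 := by
  by_contra hne
  obtain ⟨x, hx⟩ : ∃ x, B u x ≠ 0 := by
    by_contra hcon
    push Not at hcon
    exact hne (LinearMap.ext hcon)
  obtain ⟨p, hp, hpo⟩ := h.exists_proj x
  set y := x - p with hy
  have huy : B u y ≠ 0 := by simpa [hy, hu p hp] using hx
  have key : ∀ t : ℝ, 2 * t * B u y + t ^ 2 * B y y ≤ 0 := by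
    intro t
    have := h.nonpos_of_orthogonal hs hmax (u := u + t • y) (by
      intro w hw
      simp [hu w hw, hpo w hw])
    have e : B (u + t • y) (u + t • y) = 2 * t * B u y + t ^ 2 * B y y := by
      simp only [map_add, map_smul, LinearMap.add_apply, LinearMap.smul_apply, smul_eq_mul,
        hs y u, h0]
      ring
    linarith [e ▸ this]
  have hyy : B y y ≤ 0 := h.nonpos_of_orthogonal hs hmax hpo
  rcases hyy.lt_or_eq with hlt | heq
  · have k := key (-(B u y) / B y y)
    have e : 2 * (-(B u y) / B y y) * B u y + (-(B u y) / B y y) ^ 2 * B y y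
        = -((B u y) ^ 2 / B y y) := by
      field_simp; ring
    rw [e] at k
    have : (B u y) ^ 2 / B y y < 0 := div_neg_of_pos_of_neg (by positivity) hlt
    linarith
  · have k := key (B u y)
    rw [heq] at k
    have : 0 < (B u y) ^ 2 := by positivity
    nlinarith

/-- Sylvester's law of inertia, in the form needed here. -/
lemma posIdx_add_posIdx_neg {B : LinearMap.BilinForm ℝ M} (hs : ∀ u v, B u v = B v u) :
    posIdx B + posIdx (-B) + Module.finrank ℝ (LinearMap.ker B) = Module.finrank ℝ M := by
  obtain ⟨W, hW, hWr⟩ := exists_posOn B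
  obtain ⟨N, hN, hNr⟩ := exists_posOn (-B)
  apply le_antisymm
  · have h1 : Disjoint N (LinearMap.ker B) := by
      rw [Submodule.disjoint_def]
      intro x hx hk
      by_contra h0
      have := hN x hx h0
      rw [LinearMap.mem_ker] at hk
      simp [hk] at this
    have h2 : Disjoint W (N ⊔ LinearMap.ker B) := by
      rw [Submodule.disjoint_def]
      intro x hx hk
      by_contra h0
      have hp := hW x hx h0
      obtain ⟨n, hn, k, hk', rfl⟩ := Submodule.mem_sup.1 hk
      rw [LinearMap.mem_ker] at hk'
      have hnn : B n n ≤ 0 := by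
        by_cases hn0 : n = 0
        · simp [hn0]
        · have := hN n hn hn0
          simp at this; exact this.le
      have : B (n + k) (n + k) = B n n := by
        simp [hk', hs n k]
      linarith
    have e1 := Submodule.finrank_sup_add_finrank_inf_eq N (LinearMap.ker B)
    have e2 := Submodule.finrank_sup_add_finrank_inf_eq W (N ⊔ LinearMap.ker B)
    rw [h1.eq_bot, finrank_bot] at e1
    rw [h2.eq_bot, finrank_bot] at e2
    have := Submodule.finrank_le (W ⊔ (N ⊔ LinearMap.ker B))
    omega
  · let L : Submodule ℝ M :=
      { carrier := {u | ∀ w ∈ W, B u w = 0}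
        add_mem' := by intro a b ha hb w hw; simp [ha w hw, hb w hw]
        zero_mem' := by intro w hw; simp
        smul_mem' := by intro c a ha w hw; simp [ha w hw] }
    have hsup : W ⊔ L = ⊤ := by
      rw [eq_top_iff]
      intro x _
      obtain ⟨p, hp, hpo⟩ := hW.exists_proj x
      exact Submodule.mem_sup.2 ⟨p, hp, x - p, hpo, by abel⟩
    have hker : LinearMap.ker B ≤ L := by
      intro x hx w _
      rw [LinearMap.mem_ker] at hx
      simp [hx]
    obtain ⟨C, hC⟩ := Submodule.exists_isCompl ((LinearMap.ker B).comap L.subtype)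
    have hCneg : PosOn (-B) (C.map L.subtype) := by
      rintro x ⟨y, hy, rfl⟩ hx0
      have h1 : B y y ≤ 0 := hW.nonpos_of_orthogonal hs hWr y.2
      have h2 : B y y ≠ 0 := by
        intro h0
        have := hW.radical_of_orthogonal hs hWr y.2 h0
        have hm : y ∈ (LinearMap.ker B).comap L.subtype := by
          simpa using this
        have := (Submodule.disjoint_def.1 hC.disjoint) y hm hy
        exact hx0 (by simp [this])
      have := lt_of_le_of_ne h1 h2
      simpa using this
    have h3 := hCneg.finrank_le
    rw [Submodule.finrank_map_subtype_eq] at h3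
    have h4 := Submodule.finrank_add_eq_of_isCompl hC
    have h5 : Module.finrank ℝ ((LinearMap.ker B).comap L.subtype)
        = Module.finrank ℝ (LinearMap.ker B) := by
      rw [← Submodule.finrank_map_subtype_eq L]
      rw [Submodule.map_comap_subtype, inf_eq_right.2 hker]
    have h6 := Submodule.finrank_add_le_finrank_add_finrank W L
    rw [hsup, finrank_top] at h6
    omega

/-- Pulling back along a linear map that preserves the quadratic forms does not increase the
positive index. -/
lemma posIdx_le_of_map {M' : Type*} [AddCommGroup M'] [Module ℝ M'] [FiniteDimensional ℝ M']
    {B : LinearMap.BilinForm ℝ M} {B' : LinearMap.BilinForm ℝ M'} (f : M →ₗ[ℝ] M')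
    {W : Submodule ℝ M} (hW : PosOn B W)
    (h : ∀ u ∈ W, B u u = B' (f u) (f u)) : Module.finrank ℝ W ≤ posIdx B' := by
  have hinj : Function.Injective (f.comp W.subtype) := by
    rw [← LinearMap.ker_eq_bot, LinearMap.ker_eq_bot']
    intro w hw
    by_contra h0
    have h1 := hW w w.2 (by simpa using h0)
    rw [h w w.2] at h1
    have : f w = 0 := hw
    simp [this] at h1
  have hP : PosOn B' (LinearMap.range (f.comp W.subtype)) := by
    rintro x ⟨w, rfl⟩ hx
    have hw0 : (w : M) ≠ 0 := by
      intro h0; apply hx; simp [h0]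
    have := hW w w.2 hw0
    rw [h w w.2] at this
    exact this
  have := hP.finrank_le
  rwa [LinearMap.finrank_range_of_inj hinj] at this

/-- Effect on the inertia of adding a square that does not vanish on the radical. -/
lemma inertia_add_sq {B B' : LinearMap.BilinForm ℝ M} (hs : ∀ u v, B u v = B v u)
    (φ : M →ₗ[ℝ] ℝ) {κ : ℝ} (hκ : 0 < κ) (hB : ∀ u v, B' u v = B u v + κ * φ u * φ v)
    {e : M} (he : B e = 0) (hφ : φ e ≠ 0) :
    posIdx B' = posIdx B + 1 ∧ posIdx (-B') = posIdx (-B) ∧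
      LinearMap.ker B' = LinearMap.ker B ⊓ LinearMap.ker φ := by
  have hs' : ∀ u v, B' u v = B' v u := by
    intro u v; rw [hB, hB, hs u v]; ring
  have heu : ∀ u, B u e = 0 := by intro u; rw [hs, he]; rfl
  have hker : LinearMap.ker B' = LinearMap.ker B ⊓ LinearMap.ker φ := by
    ext u
    simp only [Submodule.mem_inf, LinearMap.mem_ker]
    constructor
    · intro hu
      have h1 : B' u e = 0 := by rw [hu]; rfl
      rw [hB, heu] at h1
      have h2 : φ u = 0 := by
        have : κ * φ e * φ u = 0 := by linarith
        rcases mul_eq_zero.1 this with h | h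
        · rcases mul_eq_zero.1 h with h | h
          · exact absurd h hκ.ne'
          · exact absurd h hφ
        · exact h
      refine ⟨LinearMap.ext fun v => ?_, h2⟩
      have h3 : B' u v = 0 := by rw [hu]; rfl
      rw [hB, h2] at h3
      simpa using h3
    · rintro ⟨h1, h2⟩
      refine LinearMap.ext fun v => ?_
      rw [hB, h1, h2]; simp
  have hle1 : posIdx B + 1 ≤ posIdx B' := by
    obtain ⟨W, hW, hWr⟩ := exists_posOn B
    have hP : PosOn B' (W ⊔ ℝ ∙ e) := by
      intro x hx hx0
      obtain ⟨w, hw, y, hy, rfl⟩ := Submodule.mem_sup.1 hx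
      obtain ⟨t, rfl⟩ := Submodule.mem_span_singleton.1 hy
      have e1 : B' (w + t • e) (w + t • e) = B w w + κ * (φ w + t * φ e) ^ 2 := by
        rw [hB]
        simp only [map_add, map_smul, LinearMap.add_apply, LinearMap.smul_apply, smul_eq_mul,
          heu, he, LinearMap.zero_apply]
        ring
      rw [e1]
      by_cases hw0 : w = 0
      · subst hw0
        have ht : t ≠ 0 := by rintro rfl; simp at hx0
        have : 0 < (t * φ e) ^ 2 := by positivity
        simpa using mul_pos hκ this
      · have := hW w hw hw0
        have : 0 ≤ κ * (φ w + t * φ e) ^ 2 := by positivity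
        linarith
    have hlt : W < W ⊔ ℝ ∙ e := by
      refine lt_of_le_of_ne le_sup_left fun heq => ?_
      have hmem : e ∈ W := by
        rw [heq]; exact Submodule.mem_sup_right (Submodule.mem_span_singleton_self e)
      have h0 : e ≠ 0 := by rintro rfl; simp at hφ
      have := hW e hmem h0
      rw [he] at this
      simp at this
    have := Submodule.finrank_lt_finrank_of_lt hlt
    have := hP.finrank_le
    omega
  have hle2 : posIdx (-B) ≤ posIdx (-B') := by
    obtain ⟨W, hW, hWr⟩ := exists_posOn (-B)
    rw [← hWr]
    refine posIdx_le_of_map (LinearMap.id - (φ.smulRight ((φ e)⁻¹ • e))) hW ?_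
    intro u _
    have h0 : φ (u - φ u • (φ e)⁻¹ • e) = 0 := by
      simp [hφ]
    simp only [LinearMap.neg_apply, LinearMap.sub_apply, LinearMap.id_apply,
      LinearMap.smulRight_apply]
    rw [hB, h0]
    simp [he, heu]
  have s1 := posIdx_add_posIdx_neg hs
  have s2 := posIdx_add_posIdx_neg hs'
  have hr : Module.finrank ℝ (LinearMap.ker B') + 1 ≥ Module.finrank ℝ (LinearMap.ker B) := by
    rw [hker]
    have h1 := Submodule.finrank_add_le_finrank_add_finrank (LinearMap.ker B) (LinearMap.ker φ)
    have h2 := Submodule.finrank_sup_add_finrank_inf_eq (LinearMap.ker B) (LinearMap.ker φ)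
    have h3 := LinearMap.finrank_range_add_finrank_ker φ
    have h4 : Module.finrank ℝ (LinearMap.range φ) ≤ 1 := by
      simpa using Submodule.finrank_le (LinearMap.range φ)
    have h5 := Submodule.finrank_le (LinearMap.ker B ⊔ LinearMap.ker φ)
    omega
  refine ⟨by omega, by omega, hker⟩

/-- The positive index is lower semicontinuous. -/
lemma eventually_posIdx_le {α : Type*} {l : Filter α} {B : α → LinearMap.BilinForm ℝ M}
    {B₀ : LinearMap.BilinForm ℝ M} (hs : ∀ t u v, B t u v = B t v u)
    (hs₀ : ∀ u v, B₀ u v = B₀ v u)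
    (h : ∀ u v, Filter.Tendsto (fun t => B t u v) l (nhds (B₀ u v))) {W : Submodule ℝ M}
    (hW : PosOn B₀ W) : ∀ᶠ t in l, PosOn (B t) W := by
  classical
  let b := Module.finBasis ℝ W
  set k := Module.finrank ℝ W
  let q : LinearMap.BilinForm ℝ M → (Fin k → ℝ) → ℝ := fun C x =>
    C (∑ i, x i • (b i : M)) (∑ i, x i • (b i : M))
  have hq : ∀ C : LinearMap.BilinForm ℝ M, (∀ u v, C u v = C v u) → ∀ x, q C x = ∑ i, ∑ j, x i * x j * C (b i) (b j) := by
    intro C hC x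
    simp only [q, map_sum, LinearMap.sum_apply, map_smul, LinearMap.smul_apply, smul_eq_mul]
    refine Finset.sum_congr rfl fun i _ => ?_
    rw [Finset.mul_sum]
    refine Finset.sum_congr rfl fun j _ => ?_
    rw [hC (b i) (b j)]; ring
  have hcont : Continuous (q B₀) := by
    have : q B₀ = fun x => ∑ i, ∑ j, x i * x j * B₀ (b i) (b j) := funext (hq B₀ hs₀)
    rw [this]
    fun_prop
  have hne : ∀ x : Fin k → ℝ, x ≠ 0 → (∑ i, x i • (b i : M)) ∈ W ∧ (∑ i, x i • (b i : M)) ≠ 0 := by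
    intro x hx
    have e : (∑ i, x i • (b i : M)) = ((∑ i, x i • b i : W) : M) := by simp
    rw [e]
    refine ⟨Subtype.coe_prop _, fun h0 => hx ?_⟩
    have h1 : (∑ i, x i • b i : W) = 0 := by exact_mod_cast h0
    exact funext (Fintype.linearIndependent_iff.1 b.linearIndependent x h1)
  have hδ : ∃ δ > 0, ∀ x : Fin k → ℝ, ‖x‖ = 1 → δ ≤ q B₀ x := by
    by_cases hemp : (Metric.sphere (0 : Fin k → ℝ) 1).Nonempty
    · obtain ⟨x0, hx0, hmin⟩ := (isCompact_sphere (0 : Fin k → ℝ) 1).exists_isMinOn hemp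
        hcont.continuousOn
      have hx0' : x0 ≠ 0 := by
        rintro rfl; simp at hx0
      obtain ⟨h1, h2⟩ := hne x0 hx0'
      refine ⟨q B₀ x0, hW _ h1 h2, fun x hx => hmin (by simpa using hx)⟩
    · refine ⟨1, one_pos, fun x hx => absurd ⟨x, by simpa using hx⟩ hemp⟩
  obtain ⟨δ, hδ0, hδ⟩ := hδ
  have hsmall : ∀ᶠ t in l, ∑ i, ∑ j, |B t (b i) (b j) - B₀ (b i) (b j)| < δ := by
    have : Filter.Tendsto (fun t => ∑ i, ∑ j, |B t (b i) (b j) - B₀ (b i) (b j)|) l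
        (nhds (∑ i : Fin k, ∑ j : Fin k, |B₀ (b i) (b j) - B₀ (b i) (b j)|)) := by
      refine tendsto_finsetSum _ fun i _ => tendsto_finsetSum _ fun j _ => ?_
      exact ((h _ _).sub_const _).abs
    simp only [sub_self, abs_zero, Finset.sum_const_zero] at this
    exact this.eventually (gt_mem_nhds hδ0)
  filter_upwards [hsmall] with t ht
  have hpos1 : ∀ x : Fin k → ℝ, ‖x‖ = 1 → 0 < q (B t) x := by
    intro x hx
    have h1 : |q (B t) x - q B₀ x| ≤ ∑ i, ∑ j, |B t (b i) (b j) - B₀ (b i) (b j)| := by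
      rw [hq _ (hs t), hq _ hs₀, ← Finset.sum_sub_distrib]
      refine (Finset.abs_sum_le_sum_abs _ _).trans (Finset.sum_le_sum fun i _ => ?_)
      rw [← Finset.sum_sub_distrib]
      refine (Finset.abs_sum_le_sum_abs _ _).trans (Finset.sum_le_sum fun j _ => ?_)
      rw [← mul_sub, abs_mul, abs_mul]
      have hi : |x i| ≤ 1 := by rw [← hx]; exact norm_le_pi_norm x i
      have hj : |x j| ≤ 1 := by rw [← hx]; exact norm_le_pi_norm x j
      have : |x i| * |x j| ≤ 1 := mul_le_one₀ hi (abs_nonneg _) hj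
      exact mul_le_of_le_one_left (abs_nonneg _) this
    have h2 := hδ x hx
    have h3 := (abs_le.1 h1).1
    linarith
  intro u hu hu0
  let x : Fin k → ℝ := fun i => b.repr ⟨u, hu⟩ i
  have hux : u = ∑ i, x i • (b i : M) := by
    have h1 := congrArg (W.subtype) (b.sum_repr ⟨u, hu⟩)
    rw [map_sum] at h1
    exact h1.symm
  have hx0 : x ≠ 0 := by
    intro hx; apply hu0; rw [hux, hx]; simp
  have hnx : 0 < ‖x‖ := norm_pos_iff.2 hx0
  have h1 := hpos1 (‖x‖⁻¹ • x) (by rw [norm_smul, norm_inv, norm_norm]; field_simp)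
  have h2 : q (B t) (‖x‖⁻¹ • x) = (‖x‖⁻¹) ^ 2 * q (B t) x := by
    rw [hq _ (hs t), hq _ (hs t), Finset.mul_sum]
    refine Finset.sum_congr rfl fun i _ => ?_
    rw [Finset.mul_sum]
    refine Finset.sum_congr rfl fun j _ => ?_
    simp only [Pi.smul_apply, smul_eq_mul]; ring
  rw [h2] at h1
  have h3 : 0 < q (B t) x := by
    by_contra hcon
    push Not at hcon
    have : (‖x‖⁻¹) ^ 2 * q (B t) x ≤ 0 := mul_nonpos_of_nonneg_of_nonpos (by positivity) hcon
    linarith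
  have : q (B t) x = B t u u := by simp only [q]; rw [← hux]
  linarith

/-- Along a convergent family with radicals of constant dimension, the inertia is constant. -/
lemma eventually_posIdx_eq {α : Type*} {l : Filter α} {B : α → LinearMap.BilinForm ℝ M}
    {B₀ : LinearMap.BilinForm ℝ M} (hs : ∀ t u v, B t u v = B t v u)
    (hs₀ : ∀ u v, B₀ u v = B₀ v u)
    (h : ∀ u v, Filter.Tendsto (fun t => B t u v) l (nhds (B₀ u v)))
    (hk : ∀ᶠ t in l, Module.finrank ℝ (LinearMap.ker (B t)) = Module.finrank ℝ (LinearMap.ker B₀)) :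
    ∀ᶠ t in l, posIdx (B t) = posIdx B₀ ∧ posIdx (-(B t)) = posIdx (-B₀) := by
  obtain ⟨W, hW, hWr⟩ := exists_posOn B₀
  obtain ⟨N, hN, hNr⟩ := exists_posOn (-B₀)
  have h1 := eventually_posIdx_le hs hs₀ h hW
  have h2 := eventually_posIdx_le (B := fun t => -(B t)) (B₀ := -B₀) (l := l)
    (fun t u v => by simp [hs t u v]) (fun u v => by simp [hs₀ u v])
    (fun u v => by simpa using (h u v).neg) hN
  filter_upwards [h1, h2, hk] with t h1 h2 hk
  have a1 := h1.finrank_le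
  have a2 := h2.finrank_le
  have s1 := posIdx_add_posIdx_neg (hs t)
  have s2 := posIdx_add_posIdx_neg hs₀
  omega

end Inertia

/-- Linear inequalities `a v ≤ 1` describing a bounded simple polyhedron with the origin in its
interior. -/
structure Sys (ι V : Type*) [AddCommGroup V] [Module ℝ V] where
  /-- the constraint functionals -/
  a : ι → Module.Dual ℝ V
  pos : ∀ y, y ≠ 0 → ∃ v, 0 < a v y
  simple : ∀ y, (∀ v, a v y ≤ 1) → LinearIndependent ℝ (fun v : {v // a v y = 1} => a v)

lemma exists_eval_eq {V κ : Type*} [AddCommGroup V] [Module ℝ V] [Fintype κ]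
    {f : κ → Module.Dual ℝ V} (hf : LinearIndependent ℝ f) (c : κ → ℝ) :
    ∃ z, ∀ k, f k z = c k := by
  classical
  have h : Function.Surjective (LinearMap.pi f) := by
    rw [← LinearMap.dualMap_injective_iff, ← LinearMap.ker_eq_bot, LinearMap.ker_eq_bot']
    intro φ hφ
    have h1 : ∑ k, φ (fun j => if k = j then 1 else 0) • f k = 0 := by
      refine LinearMap.ext fun x => ?_
      have h2 := LinearMap.congr_fun hφ x
      rw [LinearMap.dualMap_apply, LinearMap.pi_apply_eq_sum_univ φ] at h2
      simpa [mul_comm] using h2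
    have h2 := Fintype.linearIndependent_iff.1 hf _ h1
    refine LinearMap.ext fun x => ?_
    rw [LinearMap.pi_apply_eq_sum_univ φ]
    simp [h2]
  obtain ⟨z, hz⟩ := h c
  exact ⟨z, fun k => congrFun hz k⟩

namespace Sys

variable {ι V : Type*} [Fintype ι] [DecidableEq ι] [AddCommGroup V] [Module ℝ V]
  [FiniteDimensional ℝ V] (A : Sys ι V)

/-- Feasible points. -/
def In (y : V) : Prop := ∀ v, A.a v y ≤ 1

open Classical in
/-- The set of constraints that hold with equality at `y`. -/
noncomputable def tight (y : V) : Finset ι := Finset.univ.filter fun v => A.a v y = 1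

lemma mem_tight {y : V} {v : ι} : v ∈ A.tight y ↔ A.a v y = 1 := by simp [tight]

open Classical in
/-- The tight sets of the vertices. -/
noncomputable def verts : Finset (Finset ι) :=
  Finset.univ.filter fun H => H.card = Module.finrank ℝ V ∧ ∃ y, A.In y ∧ A.tight y = H

/-- The tight sets of feasible points. -/
def IsFace (G : Finset ι) : Prop := ∃ y, A.In y ∧ A.tight y = G

open Classical in
/-- The vertex with a given tight set. -/
noncomputable def pt (H : Finset ι) : V := if h : ∃ y, A.In y ∧ A.tight y = H then h.choose else 0

open Classical in
/-- The basis dual to the functionals tight at a vertex. -/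
noncomputable def dv (H : Finset ι) (w : ι) : V :=
  if h : ∃ z, ∀ w' ∈ H, A.a w' z = if w' = w then 1 else 0 then h.choose else 0

/-- The coordinates of `τ` in the basis given by `H`, extended by zero. -/
noncomputable def lam (H : Finset ι) (τ : Module.Dual ℝ V) (w : ι) : ℝ :=
  if w ∈ H then τ (A.dv H w) else 0

variable {A}

lemma card_of_mem {H : Finset ι} (h : H ∈ A.verts) : H.card = Module.finrank ℝ V := by
  simp only [verts, Finset.mem_filter] at h; exact h.2.1

lemma isFace_of_mem {H : Finset ι} (h : H ∈ A.verts) : A.IsFace H := by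
  simp only [verts, Finset.mem_filter] at h; exact h.2.2

lemma IsFace.mem_verts {H : Finset ι} (h : A.IsFace H) (hc : H.card = Module.finrank ℝ V) :
    H ∈ A.verts := by
  simp only [verts, Finset.mem_filter, Finset.mem_univ, true_and]; exact ⟨hc, h⟩

lemma IsFace.pt_spec {H : Finset ι} (h : A.IsFace H) : A.In (A.pt H) ∧ A.tight (A.pt H) = H := by
  have h' : ∃ y, A.In y ∧ A.tight y = H := h
  rw [pt, dif_pos h']; exact h'.choose_spec

lemma IsFace.pt_in {H : Finset ι} (h : A.IsFace H) : A.In (A.pt H) := h.pt_spec.1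

lemma IsFace.pt_eq_one {H : Finset ι} (h : A.IsFace H) {v : ι} : A.a v (A.pt H) = 1 ↔ v ∈ H := by
  rw [← mem_tight, h.pt_spec.2]

lemma IsFace.pt_lt_one {H : Finset ι} (h : A.IsFace H) {v : ι} (hv : v ∉ H) :
    A.a v (A.pt H) < 1 :=
  lt_of_le_of_ne (h.pt_in v) fun h1 => hv (h.pt_eq_one.1 h1)

lemma IsFace.linearIndependent {G : Finset ι} (h : A.IsFace G) :
    LinearIndependent ℝ (fun v : {v // v ∈ G} => A.a v) := by
  obtain ⟨y, hy, rfl⟩ := h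
  have h1 := A.simple y hy
  have h2 := h1.comp (fun v : {v // v ∈ A.tight y} => (⟨v.1, A.mem_tight.1 v.2⟩ : {v // A.a v y = 1}))
    (fun u v huv => by
      have := congrArg (fun x => x.1) huv
      exact Subtype.ext this)
  exact h2

lemma IsFace.card_le {G : Finset ι} (h : A.IsFace G) : G.card ≤ Module.finrank ℝ V := by
  have := h.linearIndependent.fintype_card_le_finrank
  rwa [Subspace.dual_finrank_eq, Fintype.card_coe] at this

lemma IsFace.exists_eval {G : Finset ι} (h : A.IsFace G) (c : ι → ℝ) :
    ∃ z, ∀ v ∈ G, A.a v z = c v := by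
  obtain ⟨z, hz⟩ := exists_eval_eq h.linearIndependent (fun v => c v)
  exact ⟨z, fun v hv => hz ⟨v, hv⟩⟩

lemma IsFace.dv_spec {H : Finset ι} (h : A.IsFace H) {w w' : ι} (hw' : w' ∈ H) :
    A.a w' (A.dv H w) = if w' = w then 1 else 0 := by
  have h' := h.exists_eval (fun w' => if w' = w then 1 else 0)
  rw [dv, dif_pos h']
  exact h'.choose_spec w' hw'

lemma eq_zero_of_mem {H : Finset ι} (h : H ∈ A.verts) {z : V} (hz : ∀ w ∈ H, A.a w z = 0) :
    z = 0 := by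
  have h1 := (isFace_of_mem h).linearIndependent
  have h2 := h1.span_eq_top_of_card_eq_finrank'
    (by rw [Subspace.dual_finrank_eq, Fintype.card_coe, card_of_mem h])
  rw [← Module.forall_dual_apply_eq_zero_iff ℝ]
  intro φ
  have hφ : φ ∈ Submodule.span ℝ (Set.range fun v : {v // v ∈ H} => A.a v) := by rw [h2]; trivial
  induction hφ using Submodule.span_induction with
  | mem x hx => obtain ⟨w, rfl⟩ := hx; exact hz w w.2
  | zero => rfl
  | add x y _ _ hx hy => simp [hx, hy]
  | smul c x _ hx => simp [hx]

lemma eq_of_mem {H : Finset ι} (h : H ∈ A.verts) {x y : V} (hz : ∀ w ∈ H, A.a w x = A.a w y) :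
    x = y :=
  sub_eq_zero.1 (eq_zero_of_mem h fun w hw => by simp [hz w hw])

lemma eq_sum_dv {H : Finset ι} (h : H ∈ A.verts) (x : V) : x = ∑ w ∈ H, A.a w x • A.dv H w := by
  refine eq_of_mem h fun w hw => ?_
  simp only [map_sum, map_smul, (isFace_of_mem h).dv_spec hw, smul_eq_mul]
  simp [hw]

lemma apply_eq_sum_lam {H : Finset ι} (h : H ∈ A.verts) (τ : Module.Dual ℝ V) (x : V) :
    τ x = ∑ w ∈ H, A.a w x * A.lam H τ w := by
  conv_lhs => rw [eq_sum_dv h x]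
  simp only [map_sum, map_smul, smul_eq_mul]
  exact Finset.sum_congr rfl fun w hw => by simp [lam, hw]

lemma lam_of_notMem {H : Finset ι} {τ : Module.Dual ℝ V} {w : ι} (hw : w ∉ H) :
    A.lam H τ w = 0 := by simp [lam, hw]

lemma lam_neg (H : Finset ι) (τ : Module.Dual ℝ V) (w : ι) : A.lam H (-τ) w = -A.lam H τ w := by
  by_cases hw : w ∈ H <;> simp [lam, hw]

lemma apply_pt_eq_sum_lam {H : Finset ι} (h : H ∈ A.verts) (τ : Module.Dual ℝ V) :
    τ (A.pt H) = ∑ w ∈ H, A.lam H τ w := by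
  rw [apply_eq_sum_lam h]
  exact Finset.sum_congr rfl fun w hw => by rw [(isFace_of_mem h).pt_eq_one.2 hw, one_mul]

lemma apply_pt_sub {H : Finset ι} (h : H ∈ A.verts) (τ : Module.Dual ℝ V) (y : V) :
    τ (A.pt H) - τ y = ∑ w ∈ H, (1 - A.a w y) * A.lam H τ w := by
  rw [apply_pt_eq_sum_lam h, apply_eq_sum_lam h, ← Finset.sum_sub_distrib]
  exact Finset.sum_congr rfl fun w hw => by ring

lemma pt_eq {H : Finset ι} (h : H ∈ A.verts) {y : V} (hy : ∀ w ∈ H, A.a w y = 1) : y = A.pt H :=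
  eq_of_mem h fun w hw => by rw [hy w hw, (isFace_of_mem h).pt_eq_one.2 hw]

lemma eq_of_subset {H K : Finset ι} (h : H ∈ A.verts) (k : K ∈ A.verts) (hs : H ⊆ K) : H = K :=
  Finset.eq_of_subset_of_card_le hs (by rw [card_of_mem h, card_of_mem k])

/-- A local optimality criterion. -/
lemma apply_le_of_lam_pos {H : Finset ι} (h : H ∈ A.verts) {τ : Module.Dual ℝ V} {y : V}
    (hy : A.In y) (hp : ∀ w ∈ H, w ∉ A.tight y → 0 < A.lam H τ w) :
    τ y ≤ τ (A.pt H) ∧ (τ y = τ (A.pt H) → y = A.pt H) := by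
  have e := apply_pt_sub h τ y
  have hnn : ∀ w ∈ H, 0 ≤ (1 - A.a w y) * A.lam H τ w := by
    intro w hw
    by_cases ht : w ∈ A.tight y
    · rw [A.mem_tight.1 ht]; simp
    · exact mul_nonneg (by linarith [hy w]) (hp w hw ht).le
  refine ⟨by linarith [Finset.sum_nonneg hnn], fun heq => pt_eq h fun w hw => ?_⟩
  have h0 : ∑ w ∈ H, (1 - A.a w y) * A.lam H τ w = 0 := by linarith
  have := (Finset.sum_eq_zero_iff_of_nonneg hnn).1 h0 w hw
  by_contra hne
  have hp' := hp w hw (by rwa [mem_tight])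
  rcases mul_eq_zero.1 this with h | h
  · exact hne (by linarith)
  · exact hp'.ne' h

lemma vert_le_of_lam_pos {H K : Finset ι} (h : H ∈ A.verts) (k : K ∈ A.verts)
    {τ : Module.Dual ℝ V} (hp : ∀ w ∈ H, w ∉ K → 0 < A.lam H τ w) :
    τ (A.pt K) ≤ τ (A.pt H) ∧ (τ (A.pt K) = τ (A.pt H) → K = H) := by
  have hk := (isFace_of_mem k).pt_spec
  obtain ⟨h1, h2⟩ := apply_le_of_lam_pos h (τ := τ) hk.1 (by rw [hk.2]; exact hp)
  refine ⟨h1, fun he => ?_⟩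
  rw [← hk.2, h2 he, (isFace_of_mem h).pt_spec.2]

lemma le_vert_of_lam_neg {H K : Finset ι} (h : H ∈ A.verts) (k : K ∈ A.verts)
    {τ : Module.Dual ℝ V} (hp : ∀ w ∈ H, w ∉ K → A.lam H τ w < 0) :
    τ (A.pt H) ≤ τ (A.pt K) ∧ (τ (A.pt K) = τ (A.pt H) → K = H) := by
  obtain ⟨h1, h2⟩ := vert_le_of_lam_pos h k (τ := -τ)
    (fun w hw hk => by rw [lam_neg]; linarith [hp w hw hk])
  simp only [LinearMap.neg_apply] at h1 h2
  exact ⟨by linarith, fun he => h2 (by rw [he])⟩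

/-- Moving a little in a direction that respects the tight constraints. -/
lemma perturb {y z : V} (hy : A.In y) (hz : ∀ v ∈ A.tight y, A.a v z ≤ 0) :
    ∃ ε : ℝ, 0 < ε ∧ A.In (y + ε • z) ∧ ∀ v, v ∈ A.tight (y + ε • z) ↔ v ∈ A.tight y ∧ A.a v z = 0 := by
  have h1 : ∀ v, ∀ᶠ ε in nhdsWithin (0 : ℝ) (Set.Ioi 0),
      A.a v (y + ε • z) ≤ 1 ∧ (A.a v (y + ε • z) = 1 ↔ A.a v y = 1 ∧ A.a v z = 0) := by
    intro v
    by_cases ht : v ∈ A.tight y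
    · filter_upwards [self_mem_nhdsWithin] with ε (hε : 0 < ε)
      have h2 := hz v ht
      rw [mem_tight] at ht
      simp only [map_add, map_smul, smul_eq_mul, ht, true_and]
      refine ⟨by nlinarith, ⟨fun h => ?_, fun h => by simp [h]⟩⟩
      have : ε * A.a v z = 0 := by linarith
      exact (mul_eq_zero.1 this).resolve_left hε.ne'
    · rw [mem_tight] at ht
      have hlt : A.a v y < 1 := lt_of_le_of_ne (hy v) ht
      have hc : Filter.Tendsto (fun ε : ℝ => A.a v y + ε * A.a v z) (nhdsWithin (0 : ℝ) (Set.Ioi 0))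
          (nhds (A.a v y + 0 * A.a v z)) :=
        (tendsto_const_nhds.add (Filter.tendsto_id.mul_const _)).mono_left nhdsWithin_le_nhds
      rw [zero_mul, add_zero] at hc
      filter_upwards [hc.eventually (gt_mem_nhds hlt)] with ε hε
      simp only [map_add, map_smul, smul_eq_mul]
      exact ⟨hε.le, fun h => absurd h hε.ne, fun h => absurd h.1 ht⟩
  have h2 := (Filter.eventually_all.2 h1).and self_mem_nhdsWithin
  obtain ⟨ε, h3, hε⟩ := h2.exists
  refine ⟨ε, hε, fun v => (h3 v).1, fun v => ?_⟩
  rw [mem_tight, mem_tight, (h3 v).2]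

lemma IsFace.subset {G H : Finset ι} (h : A.IsFace H) (hs : G ⊆ H) : A.IsFace G := by
  obtain ⟨z, hz⟩ := h.exists_eval (fun w => if w ∈ G then 0 else -1)
  obtain ⟨ε, -, h1, h2⟩ := perturb (A := A) (y := A.pt H) (z := z) h.pt_in (by
    intro v hv
    rw [h.pt_spec.2] at hv
    rw [hz v hv]; split_ifs <;> norm_num)
  refine ⟨_, h1, ?_⟩
  ext v
  rw [h2, h.pt_spec.2]
  constructor
  · rintro ⟨h3, h4⟩
    rw [hz v h3] at h4
    by_contra hv
    simp [hv] at h4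
  · intro hv
    exact ⟨hs hv, by rw [hz v (hs hv)]; simp [hv]⟩

lemma exists_extend {y : V} (hy : A.In y) (hc : (A.tight y).card < Module.finrank ℝ V)
    (τ : Module.Dual ℝ V) :
    ∃ y', A.In y' ∧ A.tight y ⊂ A.tight y' ∧ τ y ≤ τ y' := by
  obtain ⟨z, hz0, hz⟩ : ∃ z : V, z ≠ 0 ∧ ∀ v ∈ A.tight y, A.a v z = 0 := by
    have h1 : (LinearMap.ker (LinearMap.pi fun v : {v // v ∈ A.tight y} => A.a v)) ≠ ⊥ := by
      apply LinearMap.ker_ne_bot_of_finrank_lt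
      simpa using hc
    obtain ⟨z, hz, hz0⟩ := Submodule.exists_mem_ne_zero_of_ne_bot h1
    refine ⟨z, hz0, fun v hv => ?_⟩
    exact congrFun (LinearMap.mem_ker.1 hz) ⟨v, hv⟩
  obtain ⟨z, hz0, hz, hτ⟩ : ∃ z : V, z ≠ 0 ∧ (∀ v ∈ A.tight y, A.a v z = 0) ∧ 0 ≤ τ z := by
    rcases le_total 0 (τ z) with h | h
    · exact ⟨z, hz0, hz, h⟩
    · exact ⟨-z, by simpa using hz0, fun v hv => by simp [hz v hv], by simpa using h⟩
  have hne : (Finset.univ.filter fun v => 0 < A.a v z).Nonempty := by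
    obtain ⟨v, hv⟩ := A.pos z hz0
    exact ⟨v, by simpa using hv⟩
  obtain ⟨v, hv, hmin⟩ := Finset.exists_min_image _ (fun v => (1 - A.a v y) / A.a v z) hne
  simp only [Finset.mem_filter, Finset.mem_univ, true_and] at hv hmin
  set t := (1 - A.a v y) / A.a v z with ht
  have ht0 : 0 ≤ t := div_nonneg (by linarith [hy v]) hv.le
  refine ⟨y + t • z, fun u => ?_, ?_, ?_⟩
  · simp only [map_add, map_smul, smul_eq_mul]
    rcases lt_or_ge 0 (A.a u z) with hu | hu
    · have := hmin u hu
      rw [le_div_iff₀ hu] at this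
      linarith
    · have := mul_nonpos_of_nonneg_of_nonpos ht0 hu
      linarith [hy u]
  · rw [Finset.ssubset_iff_of_subset]
    · refine ⟨v, ?_, fun h => ?_⟩
      · rw [mem_tight]
        simp only [map_add, map_smul, smul_eq_mul, ht]
        field_simp
        ring
      · rw [hz v h] at hv; exact lt_irrefl _ hv
    · intro u hu
      have h1 := hz u hu
      rw [mem_tight] at hu ⊢
      simp [hu, h1]
  · simp only [map_add, map_smul, smul_eq_mul]
    nlinarith

lemma exists_vert {y : V} (hy : A.In y) (τ : Module.Dual ℝ V) :
    ∃ H ∈ A.verts, A.tight y ⊆ H ∧ τ y ≤ τ (A.pt H) := by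
  induction hn : Module.finrank ℝ V - (A.tight y).card using Nat.strong_induction_on
    generalizing y with
  | _ n ih =>
    have hf : A.IsFace (A.tight y) := ⟨y, hy, rfl⟩
    rcases hf.card_le.lt_or_eq with h | h
    · obtain ⟨y', h1, h2, h3⟩ := exists_extend hy h τ
      have h4 := Finset.card_lt_card h2
      obtain ⟨H, hH, h5, h6⟩ := ih _ (by omega) h1 rfl
      exact ⟨H, hH, h2.1.trans h5, h3.trans h6⟩
    · have hv := hf.mem_verts h
      refine ⟨_, hv, subset_rfl, ?_⟩
      rw [← pt_eq hv (y := y) fun w hw => by rwa [mem_tight] at hw]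

lemma IsFace.exists_vert {G : Finset ι} (h : A.IsFace G) : ∃ H ∈ A.verts, G ⊆ H := by
  obtain ⟨H, hH, hs, -⟩ := Sys.exists_vert h.pt_in 0
  exact ⟨H, hH, by rwa [h.pt_spec.2] at hs⟩

/-- At a vertex maximizing `τ` over a face, the coordinates of `τ` off the face are nonnegative. -/
lemma lam_nonneg_of_max {G H : Finset ι} (h : H ∈ A.verts) (hG : G ⊆ H) {τ : Module.Dual ℝ V}
    (hmax : ∀ K ∈ A.verts, G ⊆ K → τ (A.pt K) ≤ τ (A.pt H)) {w : ι} (hw : w ∈ H) (hwG : w ∉ G) :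
    0 ≤ A.lam H τ w := by
  by_contra hneg
  push Not at hneg
  have hf := isFace_of_mem h
  obtain ⟨ε, hε, h1, h2⟩ := perturb (A := A) (y := A.pt H) (z := -A.dv H w) hf.pt_in (by
    intro v hv
    rw [hf.pt_spec.2] at hv
    rw [map_neg, hf.dv_spec hv]; split_ifs <;> norm_num)
  obtain ⟨K, hK, hs, hle⟩ := exists_vert h1 τ
  have h3 := hmax K hK (fun v hv => hs ((h2 v).2 ⟨by rw [hf.pt_spec.2]; exact hG hv, by
    rw [map_neg, hf.dv_spec (hG hv), if_neg (by rintro rfl; exact hwG hv), neg_zero]⟩))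
  have h4 : τ (A.pt H + ε • -A.dv H w) = τ (A.pt H) - ε * A.lam H τ w := by
    simp [lam, hw, sub_eq_add_neg]
  have := mul_neg_of_pos_of_neg hε hneg
  linarith

end Sys

namespace Sys

variable {ι V : Type*} [Fintype ι] [DecidableEq ι] [AddCommGroup V] [Module ℝ V]
  [FiniteDimensional ℝ V] (A : Sys ι V)

/-- A functional in general position with respect to the vertices. -/
def Gen (τ : Module.Dual ℝ V) : Prop :=
  (∀ H ∈ A.verts, ∀ w ∈ H, A.lam H τ w ≠ 0) ∧
    ∀ H ∈ A.verts, ∀ K ∈ A.verts, τ (A.pt H) = τ (A.pt K) → H = K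

open Classical in
/-- The vertices on a face. -/
noncomputable def above (G : Finset ι) : Finset (Finset ι) := A.verts.filter fun H => G ⊆ H

/-- The constraints at `H` off `G` in whose direction `τ` increases. -/
noncomputable def neg (G H : Finset ι) (τ : Module.Dual ℝ V) : Finset ι :=
  (H \ G).filter fun w => A.lam H τ w < 0

/-- Normalized volume of the parallelepiped spanned by the constraints tight at `H`. -/
noncomputable def vol (H : Finset ι) : ℝ :=
  if h : H.card = Module.finrank ℝ V then
    |(Matrix.of fun i j => A.a (H.equivFinOfCardEq h |>.symm i) (Module.finBasis ℝ V j)).det|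
  else 0

/-- The weight of a vertex relative to a face. -/
noncomputable def gam (G H : Finset ι) (τ : Module.Dual ℝ V) : ℝ :=
  (A.vol H)⁻¹ / ∏ w ∈ H \ G, A.lam H τ w

variable {A}

lemma mem_above {G H : Finset ι} : H ∈ A.above G ↔ H ∈ A.verts ∧ G ⊆ H := by simp [above]

lemma above_insert {G : Finset ι} {v : ι} :
    A.above (insert v G) = (A.above G).filter fun H => v ∈ H := by
  ext H; simp only [mem_above, Finset.mem_filter, Finset.insert_subset_iff]; tauto

lemma mem_neg {G H : Finset ι} {τ : Module.Dual ℝ V} {w : ι} :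
    w ∈ A.neg G H τ ↔ w ∈ H ∧ w ∉ G ∧ A.lam H τ w < 0 := by
  simp [neg, and_assoc]

lemma Gen.neg {τ : Module.Dual ℝ V} (h : A.Gen τ) : A.Gen (-τ) := by
  refine ⟨fun H hH w hw => by rw [lam_neg]; exact neg_ne_zero.2 (h.1 H hH w hw),
    fun H hH K hK he => h.2 H hH K hK ?_⟩
  simpa using he

lemma Gen.lam_ne {τ : Module.Dual ℝ V} (h : A.Gen τ) {H : Finset ι} (hH : H ∈ A.verts) {w : ι}
    (hw : w ∈ H) : A.lam H τ w ≠ 0 := h.1 H hH w hw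

lemma pt_injective {H K : Finset ι} (h : H ∈ A.verts) (k : K ∈ A.verts) (he : A.pt H = A.pt K) :
    H = K := by
  rw [← (isFace_of_mem h).pt_spec.2, he, (isFace_of_mem k).pt_spec.2]

lemma dv_ne_zero {H : Finset ι} (h : H ∈ A.verts) {w : ι} (hw : w ∈ H) : A.dv H w ≠ 0 := by
  intro h0
  have := (isFace_of_mem h).dv_spec (w := w) hw
  rw [h0] at this
  simp at this

lemma exists_gen : ∃ τ, A.Gen τ := by
  classical
  let κ := {p : Finset ι × ι // p.1 ∈ A.verts ∧ p.2 ∈ p.1} ⊕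
    {p : Finset ι × Finset ι // p.1 ∈ A.verts ∧ p.2 ∈ A.verts ∧ p.1 ≠ p.2}
  let v : κ → V := Sum.elim (fun p => A.dv p.1.1 p.1.2) (fun p => A.pt p.1.1 - A.pt p.1.2)
  obtain ⟨τ, hτ⟩ := Module.exists_dual_forall_apply_ne_zero (K := ℝ) v (by
    rintro (⟨p, h1, h2⟩ | ⟨p, h1, h2, h3⟩)
    · exact dv_ne_zero h1 h2
    · exact fun h0 => h3 (pt_injective h1 h2 (sub_eq_zero.1 h0)))
  refine ⟨τ, fun H hH w hw => ?_, fun H hH K hK he => ?_⟩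
  · have := hτ (Sum.inl ⟨(H, w), hH, hw⟩)
    simpa [lam, hw, v] using this
  · by_contra hne
    have := hτ (Sum.inr ⟨(H, K), hH, hK, hne⟩)
    simp [v, he] at this

lemma exists_max {τ : Module.Dual ℝ V} (h : A.Gen τ) {G : Finset ι} (hG : A.IsFace G) :
    ∃ H ∈ A.verts, G ⊆ H ∧ ∀ w ∈ H, w ∉ G → 0 < A.lam H τ w := by
  obtain ⟨K, hK, hs⟩ := hG.exists_vert
  obtain ⟨H, hH, hmax⟩ := Finset.exists_max_image (A.above G) (fun H => τ (A.pt H))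
    ⟨K, mem_above.2 ⟨hK, hs⟩⟩
  rw [mem_above] at hH
  refine ⟨H, hH.1, hH.2, fun w hw hwG => lt_of_le_of_ne ?_ (h.lam_ne hH.1 hw).symm⟩
  exact lam_nonneg_of_max hH.1 hH.2 (fun K hK hs => hmax K (mem_above.2 ⟨hK, hs⟩)) hw hwG

lemma exists_min {τ : Module.Dual ℝ V} (h : A.Gen τ) {G : Finset ι} (hG : A.IsFace G) :
    ∃ H ∈ A.verts, G ⊆ H ∧ ∀ w ∈ H, w ∉ G → A.lam H τ w < 0 := by
  obtain ⟨H, h1, h2, h3⟩ := exists_max h.neg hG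
  exact ⟨H, h1, h2, fun w hw hG => by have := h3 w hw hG; rw [lam_neg] at this; linarith⟩

lemma neg_of_pos {τ : Module.Dual ℝ V} {G H : Finset ι}
    (h : ∀ w ∈ H, w ∉ G → 0 < A.lam H τ w) : A.neg G H τ = ∅ := by
  ext w; simp only [mem_neg, Finset.notMem_empty, iff_false]
  rintro ⟨h1, h2, h3⟩; linarith [h w h1 h2]

lemma neg_of_neg {τ : Module.Dual ℝ V} {G H : Finset ι}
    (h : ∀ w ∈ H, w ∉ G → A.lam H τ w < 0) : A.neg G H τ = H \ G := by
  ext w; simp only [mem_neg, Finset.mem_sdiff]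
  exact ⟨fun h1 => ⟨h1.1, h1.2.1⟩, fun h1 => ⟨h1.1, h1.2, h w h1.1 h1.2⟩⟩

lemma IsFace.exists_between {G H K : Finset ι} (hG : A.IsFace G) (hH : H ∈ A.verts)
    (hK : K ∈ A.verts) (hGH : G ⊆ H) (hGK : G ⊆ K) {τ : Module.Dual ℝ V} {c : ℝ}
    (h1 : c < τ (A.pt H)) (h2 : τ (A.pt K) < c) : ∃ y, A.In y ∧ A.tight y = G ∧ τ y = c := by
  have seg : ∀ (L : Finset ι), L ∈ A.verts → G ⊆ L → ∀ t : ℝ, 0 ≤ t → t < 1 →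
      A.In (A.pt G + t • (A.pt L - A.pt G)) ∧ A.tight (A.pt G + t • (A.pt L - A.pt G)) = G := by
    intro L hL hGL t ht0 ht1
    have e : ∀ v, A.a v (A.pt G + t • (A.pt L - A.pt G))
        = (1 - t) * A.a v (A.pt G) + t * A.a v (A.pt L) := by
      intro v; simp only [map_add, map_smul, map_sub, smul_eq_mul]; ring
    refine ⟨fun v => ?_, ?_⟩
    · rw [e]; nlinarith [hG.pt_in v, (isFace_of_mem hL).pt_in v]
    · ext v
      rw [mem_tight, e]
      constructor
      · intro h
        rw [← hG.pt_eq_one]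
        have a1 := hG.pt_in v
        have a2 := (isFace_of_mem hL).pt_in v
        by_contra hne
        have := lt_of_le_of_ne a1 hne
        nlinarith
      · intro hv
        rw [hG.pt_eq_one.2 hv, (isFace_of_mem hL).pt_eq_one.2 (hGL hv)]; ring
  have main : ∀ (L : Finset ι), L ∈ A.verts → G ⊆ L →
      ∀ s : ℝ, 0 ≤ s * (τ (A.pt G) - c) → 0 < s * (c - τ (A.pt L)) →
      ∃ y, A.In y ∧ A.tight y = G ∧ τ y = c := by
    intro L hL hGL s h1 h2
    set p := s * (τ (A.pt G) - c) with hp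
    set q := s * (c - τ (A.pt L)) with hq
    have hs : s ≠ 0 := by rintro rfl; simp [hq] at h2
    obtain ⟨h3, h4⟩ := seg L hL hGL (p / (p + q)) (by positivity)
      (by rw [div_lt_one (by positivity)]; linarith)
    refine ⟨_, h3, h4, ?_⟩
    have hpq : p + q = s * (τ (A.pt G) - τ (A.pt L)) := by rw [hp, hq]; ring
    have hne : τ (A.pt G) - τ (A.pt L) ≠ 0 := by
      intro h0; rw [h0, mul_zero] at hpq; linarith
    have ht : p / (p + q) * (τ (A.pt G) - τ (A.pt L)) = τ (A.pt G) - c := by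
      rw [div_mul_eq_mul_div, div_eq_iff (by positivity), hpq, hp]; ring
    simp only [map_add, map_smul, map_sub, smul_eq_mul]
    linarith
  rcases le_total c (τ (A.pt G)) with h | h
  · exact main K hK hGK 1 (by linarith) (by linarith)
  · exact main H hH hGH (-1) (by linarith) (by linarith)

lemma vol_pos {H : Finset ι} (h : H ∈ A.verts) : 0 < A.vol H := by
  rw [vol, dif_pos (card_of_mem h)]
  apply abs_pos.2
  intro h0
  obtain ⟨x, hx0, hx⟩ := Matrix.exists_mulVec_eq_zero_iff.2 h0
  have h1 : ∑ j, x j • Module.finBasis ℝ V j = 0 := by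
    refine eq_zero_of_mem h fun w hw => ?_
    have h2 := congrFun hx (H.equivFinOfCardEq (card_of_mem h) ⟨w, hw⟩)
    simp only [Matrix.mulVec, dotProduct, Matrix.of_apply, Equiv.symm_apply_apply,
      Pi.zero_apply] at h2
    simp only [map_sum, map_smul, smul_eq_mul]
    rw [← h2]
    exact Finset.sum_congr rfl fun j _ => mul_comm _ _
  exact hx0 (funext (Fintype.linearIndependent_iff.1 (Module.finBasis ℝ V).linearIndependent x h1))

lemma vol_eq_of_equiv {H : Finset ι} (h : H.card = Module.finrank ℝ V)
    (e : Fin (Module.finrank ℝ V) ≃ H) :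
    A.vol H = |(Matrix.of fun i j => A.a (e i) (Module.finBasis ℝ V j)).det| := by
  rw [vol, dif_pos h]
  have := Matrix.det_permute (e.trans (H.equivFinOfCardEq h))
    (Matrix.of fun i j => A.a (H.equivFinOfCardEq h |>.symm i) (Module.finBasis ℝ V j))
  have h2 : (Matrix.of fun i j => A.a (e i) (Module.finBasis ℝ V j)) =
    (Matrix.of fun i j => A.a (H.equivFinOfCardEq h |>.symm i)
      (Module.finBasis ℝ V j)).submatrix (e.trans (H.equivFinOfCardEq h)) id := by
    ext i j; simp
  rw [h2, this, abs_mul]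
  have h3 : |((Equiv.Perm.sign (e.trans (H.equivFinOfCardEq h)) : ℤ) : ℝ)| = 1 := by
    rcases Int.units_eq_one_or (Equiv.Perm.sign (e.trans (H.equivFinOfCardEq h))) with h | h <;>
      rw [h] <;> simp
  rw [h3, one_mul]

/-- Volumes at two vertices joined by an edge in direction `z`. -/
lemma vol_mul_eq {R : Finset ι} {h k : ι} (hh : h ∉ R) (hk : k ∉ R) (hH : insert h R ∈ A.verts)
    (hK : insert k R ∈ A.verts) {z : V} (hz : ∀ w ∈ R, A.a w z = 0) :
    A.vol (insert h R) * |A.a k z| = A.vol (insert k R) * |A.a h z| := by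
  classical
  by_cases hhk : h = k
  · rw [hhk]
  set H := insert h R with hHdef
  have hcH := card_of_mem hH
  set e := (H.equivFinOfCardEq hcH).symm with he
  have hhH : h ∈ H := Finset.mem_insert_self _ _
  set i0 := e.symm ⟨h, hhH⟩ with hi0
  set M : Matrix (Fin (Module.finrank ℝ V)) (Fin (Module.finrank ℝ V)) ℝ :=
    Matrix.of fun i j => A.a (e i) (Module.finBasis ℝ V j) with hM
  let c : Fin (Module.finrank ℝ V) → ℝ := fun i => A.lam H (A.a k) (e i)
  have hrow : M.updateRow i0 (∑ i, c i • M i) =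
      Matrix.of fun i j => A.a (if i = i0 then k else e i) (Module.finBasis ℝ V j) := by
    ext i j
    by_cases hi : i = i0
    · subst hi
      simp only [Matrix.updateRow_self, Finset.sum_apply, Pi.smul_apply, smul_eq_mul,
        Matrix.of_apply, if_true]
      rw [apply_eq_sum_lam hH (A.a k)]
      refine Eq.trans ?_ (Finset.sum_coe_sort H
        (fun w => A.a w (Module.finBasis ℝ V j) * A.lam H (A.a k) w))
      refine Eq.trans ?_ (Equiv.sum_comp e (fun w : H =>
        A.a w (Module.finBasis ℝ V j) * A.lam H (A.a k) w))
      exact Finset.sum_congr rfl fun i _ => mul_comm _ _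
    · simp [hi, hM]
  have hdet := Matrix.det_updateRow_sum M i0 c
  rw [hrow] at hdet
  have hci : c i0 * A.a h z = A.a k z := by
    rw [apply_eq_sum_lam hH (A.a k) z, Finset.sum_insert hh,
      Finset.sum_eq_zero (fun w hw => by rw [hz w hw, zero_mul])]
    simp only [c, hi0, Equiv.apply_symm_apply]; ring
  have hmem : ∀ i, (if i = i0 then k else (e i : ι)) ∈ insert k R := by
    intro i
    by_cases hi : i = i0
    · simp [hi]
    · have h1 := (e i).2
      rw [if_neg hi]
      rcases Finset.mem_insert.1 h1 with h2 | h2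
      · exfalso; apply hi; rw [hi0, Equiv.eq_symm_apply]; exact Subtype.ext h2
      · exact Finset.mem_insert_of_mem h2
  have hbij : Function.Bijective
      (fun i => (⟨if i = i0 then k else e i, hmem i⟩ : {x // x ∈ insert k R})) := by
    rw [Fintype.bijective_iff_injective_and_card]
    refine ⟨fun i j hij => ?_, by rw [Fintype.card_fin, Fintype.card_coe, card_of_mem hK]⟩
    have h1 : (if i = i0 then k else (e i : ι)) = if j = i0 then k else (e j : ι) :=
      congrArg Subtype.val hij
    have hkH : k ∉ H := by simp [hHdef, hk, Ne.symm hhk]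
    by_cases hi : i = i0 <;> by_cases hj : j = i0
    · rw [hi, hj]
    · rw [if_pos hi, if_neg hj] at h1; exact absurd (h1 ▸ (e j).2) hkH
    · rw [if_neg hi, if_pos hj] at h1; exact absurd (h1 ▸ (e i).2) hkH
    · rw [if_neg hi, if_neg hj] at h1; exact e.injective (Subtype.ext h1)
  have hvK := vol_eq_of_equiv (A := A) (card_of_mem hK) (Equiv.ofBijective _ hbij)
  have hvH := vol_eq_of_equiv (A := A) hcH e
  simp only [Equiv.ofBijective_apply] at hvK
  rw [hvK, hdet, hvH, smul_eq_mul, abs_mul, ← hci, abs_mul]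
  ring

/-- The weights of the two endpoints of an edge cancel. -/
lemma sum_gam_edge {τ : Module.Dual ℝ V} (hτ : A.Gen τ) {R : Finset ι} (hR : A.IsFace R)
    (hc : R.card + 1 = Module.finrank ℝ V) : ∑ H ∈ A.above R, A.gam R H τ = 0 := by
  obtain ⟨H, hH, hRH, hpos⟩ := exists_max hτ hR
  obtain ⟨K, hK, hRK, hneg⟩ := exists_min hτ hR
  have form : ∀ L ∈ A.verts, R ⊆ L → ∃ l, l ∉ R ∧ L = insert l R := by
    intro L hL hs
    have h1 : (L \ R).card = 1 := by
      rw [Finset.card_sdiff_of_subset hs, card_of_mem hL]; omega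
    obtain ⟨l, hl⟩ := Finset.card_eq_one.1 h1
    have hl' : l ∈ L \ R := by rw [hl]; simp
    refine ⟨l, (Finset.mem_sdiff.1 hl').2, ?_⟩
    rw [← Finset.sdiff_union_of_subset hs, hl]; rfl
  obtain ⟨h, hh, rfl⟩ := form H hH hRH
  obtain ⟨k, hk, rfl⟩ := form K hK hRK
  have lh := hpos h (by simp) hh
  have lk := hneg k (by simp) hk
  have hne : insert h R ≠ insert k R := by
    intro he
    have h1 : h ∈ insert k R := he ▸ Finset.mem_insert_self _ _
    rcases Finset.mem_insert.1 h1 with rfl | h1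
    · linarith
    · exact hh h1
  have hab : A.above R = {insert h R, insert k R} := by
    ext L
    simp only [mem_above, Finset.mem_insert, Finset.mem_singleton]
    constructor
    · rintro ⟨hL, hs⟩
      obtain ⟨l, hl, rfl⟩ := form L hL hs
      have hin : ∀ m w, w ∈ insert m R → w ∉ R → w = m := by
        intro m w hw hwR; simpa [hwR] using hw
      rcases lt_or_gt_of_ne (hτ.lam_ne hL (Finset.mem_insert_self l R)) with hl0 | hl0
      · right
        have a1 := le_vert_of_lam_neg hL hK (τ := τ) (fun w hw hwK => by
          rw [hin l w hw (fun h => hwK (hRK h))]; exact hl0)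
        have a2 := le_vert_of_lam_neg hK hL (τ := τ) (fun w hw hwK => by
          rw [hin k w hw (fun h => hwK (Finset.mem_insert_of_mem h))]; exact lk)
        exact a2.2 (le_antisymm a1.1 a2.1)
      · left
        have a1 := vert_le_of_lam_pos hL hH (τ := τ) (fun w hw hwK => by
          rw [hin l w hw (fun h => hwK (hRH h))]; exact hl0)
        have a2 := vert_le_of_lam_pos hH hL (τ := τ) (fun w hw hwK => by
          rw [hin h w hw (fun h => hwK (Finset.mem_insert_of_mem h))]; exact lh)
        exact a2.2 (le_antisymm a2.1 a1.1)
    · rintro (rfl | rfl)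
      · exact ⟨hH, hRH⟩
      · exact ⟨hK, hRK⟩
  rw [hab, Finset.sum_pair hne]
  set z := A.dv (insert h R) h with hz
  have hzR : ∀ w ∈ R, A.a w z = 0 := by
    intro w hw
    rw [hz, (isFace_of_mem hH).dv_spec (Finset.mem_insert_of_mem hw),
      if_neg (by rintro rfl; exact hh hw)]
  have hzh : A.a h z = 1 := by
    rw [hz, (isFace_of_mem hH).dv_spec (Finset.mem_insert_self _ _), if_pos rfl]
  have hτz : τ z = A.lam (insert h R) τ h := by simp [lam, hz]
  have hτk : τ z = A.a k z * A.lam (insert k R) τ k := by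
    rw [apply_eq_sum_lam hK τ z, Finset.sum_insert hk,
      Finset.sum_eq_zero (fun w hw => by rw [hzR w hw, zero_mul]), add_zero]
  have hkz : A.a k z < 0 := by
    by_contra hcon
    push Not at hcon
    have := mul_nonpos_of_nonneg_of_nonpos hcon lk.le
    linarith
  have hv := vol_mul_eq hh hk hH hK hzR
  rw [hzh, abs_one, mul_one, abs_of_neg hkz] at hv
  have vh := vol_pos hH
  have vk := vol_pos hK
  have sd : ∀ l, l ∉ R → insert l R \ R = {l} := by
    intro l hl; ext w; simp only [Finset.mem_sdiff, Finset.mem_insert, Finset.mem_singleton]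
    constructor
    · rintro ⟨h1 | h1, h2⟩
      · exact h1
      · exact absurd h1 h2
    · rintro rfl; exact ⟨Or.inl rfl, hl⟩
  simp only [gam, sd h hh, sd k hk, Finset.prod_singleton]
  rw [← hτz, hτk, ← hv]
  have := lk.ne
  have := hkz.ne
  field_simp
  ring

end Sys

open MvPolynomial

lemma IsHomogeneous.exists_eq_sum_X_mul {ι : Type*} [Fintype ι] {k : ℕ} {f : MvPolynomial ι ℝ}
    (hf : f.IsHomogeneous (k + 1)) :
    ∃ g : ι → MvPolynomial ι ℝ, (∀ v, (g v).IsHomogeneous k) ∧ f = ∑ v, X v * g v := by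
  classical
  have h1 : ∀ s ∈ f.support, ∃ v, s v ≠ 0 := by
    intro s hs
    have := hf (mem_support_iff.1 hs)
    by_contra hcon
    push Not at hcon
    have h0 : s = 0 := Finsupp.ext hcon
    subst h0
    simp at this
  rcases isEmpty_or_nonempty ι with hι | hι
  · have h0 : f = 0 := by
      rw [← support_eq_empty, Finset.eq_empty_iff_forall_notMem]
      intro s hs
      obtain ⟨v, -⟩ := h1 s hs
      exact hι.elim v
    exact ⟨0, fun v => hι.elim v, by simp [h0]⟩
  choose! w hw using h1
  refine ⟨fun v => ∑ s ∈ f.support.filter (fun s => w s = v),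
    monomial (s - Finsupp.single v 1) (coeff s f), fun v => ?_, ?_⟩
  · refine IsHomogeneous.sum _ _ _ fun s hs => ?_
    obtain ⟨hs', rfl⟩ := Finset.mem_filter.1 hs
    refine isHomogeneous_monomial _ ?_
    have h2 := hf (mem_support_iff.1 hs')
    have h3 : s - Finsupp.single (w s) 1 + Finsupp.single (w s) 1 = s :=
      tsub_add_cancel_of_le (Finsupp.single_le_iff.2 (Nat.one_le_iff_ne_zero.2 (hw s hs')))
    have h4 : (s - Finsupp.single (w s) 1).degree + 1 = k + 1 := by
      have h5 : s.degree = k + 1 := by rw [Finsupp.degree_eq_weight_one]; exact h2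
      rw [← h5]
      conv_rhs => rw [← h3, map_add, Finsupp.degree_single]
    omega
  · conv_lhs => rw [f.as_sum]
    rw [← Finset.sum_fiberwise_of_maps_to (g := w) (t := Finset.univ) (fun s _ => Finset.mem_univ _)]
    refine Finset.sum_congr rfl fun v _ => ?_
    rw [Finset.mul_sum]
    refine Finset.sum_congr rfl fun s hs => ?_
    obtain ⟨hs', rfl⟩ := Finset.mem_filter.1 hs
    have h3 : Finsupp.single (w s) 1 + (s - Finsupp.single (w s) 1) = s :=
      add_tsub_cancel_of_le (Finsupp.single_le_iff.2 (Nat.one_le_iff_ne_zero.2 (hw s hs')))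
    rw [X, monomial_mul, h3, one_mul]

/-- A linear functional vanishes in degree `k + 1` if it kills the multiples of the variables. -/
lemma eq_zero_of_X_mul {ι : Type*} [Fintype ι] {k : ℕ} (L : MvPolynomial ι ℝ →ₗ[ℝ] ℝ)
    (h : ∀ v g, g.IsHomogeneous k → L (X v * g) = 0) {f : MvPolynomial ι ℝ}
    (hf : f.IsHomogeneous (k + 1)) : L f = 0 := by
  obtain ⟨g, hg, rfl⟩ := IsHomogeneous.exists_eq_sum_X_mul hf
  rw [map_sum]
  exact Finset.sum_eq_zero fun v _ => h v _ (hg v)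

namespace Sys

variable {ι V : Type*} [Fintype ι] [DecidableEq ι] [AddCommGroup V] [Module ℝ V]
  [FiniteDimensional ℝ V] (A : Sys ι V)

/-- Weighted sum of the values of a polynomial at a set of vertices. -/
noncomputable def wsum (τ : Module.Dual ℝ V) (G : Finset ι) (P : Finset (Finset ι)) :
    MvPolynomial ι ℝ →ₗ[ℝ] ℝ :=
  ∑ H ∈ P, A.gam G H τ • (aeval (A.lam H τ)).toLinearMap

/-- The linear form attached to a point. -/
noncomputable def theta (y : V) : MvPolynomial ι ℝ := ∑ v, C (A.a v y) * X v

/-- The linear form of the slacks at a point. -/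
noncomputable def slack (y : V) : MvPolynomial ι ℝ := ∑ v, C (1 - A.a v y) * X v

variable {A} {τ : Module.Dual ℝ V} {G : Finset ι} {P : Finset (Finset ι)}

lemma wsum_apply (f : MvPolynomial ι ℝ) :
    A.wsum τ G P f = ∑ H ∈ P, A.gam G H τ * eval (A.lam H τ) f := by
  simp [wsum, LinearMap.sum_apply, aeval_eq_eval]

lemma theta_homogeneous (y : V) : (A.theta y).IsHomogeneous 1 :=
  IsHomogeneous.sum _ _ _ fun v _ => by
    simpa using (isHomogeneous_C ι (A.a v y)).mul (isHomogeneous_X ℝ v)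

lemma slack_homogeneous (y : V) : (A.slack y).IsHomogeneous 1 :=
  IsHomogeneous.sum _ _ _ fun v _ => by
    simpa using (isHomogeneous_C ι (1 - A.a v y)).mul (isHomogeneous_X ℝ v)

lemma sum_lam {H : Finset ι} (c : ι → ℝ) :
    ∑ v, c v * A.lam H τ v = ∑ v ∈ H, c v * A.lam H τ v :=
  (Finset.sum_subset (Finset.subset_univ H) fun v _ hv => by rw [lam_of_notMem hv, mul_zero]).symm

lemma eval_theta {H : Finset ι} (hH : H ∈ A.verts) (y : V) :
    eval (A.lam H τ) (A.theta y) = τ y := by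
  simp only [theta, map_sum, map_mul, eval_C, eval_X]
  rw [sum_lam, apply_eq_sum_lam hH]

lemma eval_slack {H : Finset ι} (hH : H ∈ A.verts) (y : V) :
    eval (A.lam H τ) (A.slack y) = τ (A.pt H) - τ y := by
  simp only [slack, map_sum, map_mul, eval_C, eval_X]
  rw [sum_lam, apply_pt_sub hH]

lemma wsum_theta_mul (hP : P ⊆ A.verts) (y : V) (f : MvPolynomial ι ℝ) :
    A.wsum τ G P (A.theta y * f) = τ y * A.wsum τ G P f := by
  rw [wsum_apply, wsum_apply, Finset.mul_sum]
  exact Finset.sum_congr rfl fun H hH => by rw [map_mul, eval_theta (hP hH)]; ring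

lemma wsum_slack_pow_mul (hP : P ⊆ A.verts) (y : V) (m : ℕ) (f : MvPolynomial ι ℝ) :
    A.wsum τ G P (A.slack y ^ m * f) =
      ∑ H ∈ P, A.gam G H τ * ((τ (A.pt H) - τ y) ^ m * eval (A.lam H τ) f) := by
  rw [wsum_apply]
  exact Finset.sum_congr rfl fun H hH => by rw [map_mul, map_pow, eval_slack (hP hH)]

lemma above_subset : A.above G ⊆ A.verts := fun _ h => (mem_above.1 h).1

lemma gam_mul_lam (hτ : A.Gen τ) {H : Finset ι} (hH : H ∈ A.verts) {v : ι} (hv : v ∉ G)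
    (hvH : v ∈ H) : A.gam G H τ * A.lam H τ v = A.gam (insert v G) H τ := by
  have e : H \ G = insert v (H \ insert v G) := by
    ext w
    simp only [Finset.mem_sdiff, Finset.mem_insert]
    constructor
    · rintro ⟨h1, h2⟩
      by_cases hw : w = v
      · exact Or.inl hw
      · exact Or.inr ⟨h1, by simp [hw, h2]⟩
    · rintro (rfl | ⟨h1, h2⟩)
      · exact ⟨hvH, hv⟩
      · exact ⟨h1, fun h => h2 (Or.inr h)⟩
  have hne := hτ.lam_ne hH hvH
  rw [gam, gam, e, Finset.prod_insert (by simp)]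
  by_cases hp : ∏ w ∈ H \ insert v G, A.lam H τ w = 0
  · simp [hp]
  · field_simp

lemma wsum_X_mul (hτ : A.Gen τ) (hP : P ⊆ A.verts) {v : ι} (hv : v ∉ G) (f : MvPolynomial ι ℝ) :
    A.wsum τ G P (X v * f) = A.wsum τ (insert v G) (P.filter fun H => v ∈ H) f := by
  rw [wsum_apply, wsum_apply, Finset.sum_filter]
  refine Finset.sum_congr rfl fun H hH => ?_
  rw [map_mul, eval_X]
  split_ifs with h
  · rw [← gam_mul_lam hτ (hP hH) hv h]; ring
  · rw [lam_of_notMem h]; ring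

/-- Trading a variable on the face for variables off the face. -/
lemma wsum_X_mul_of_mem (hP : P ⊆ A.verts) {v : ι} (hv : v ∈ G) {y : V} (hy : A.a v y = 1)
    (hy0 : ∀ w ∈ G, w ≠ v → A.a w y = 0) (f : MvPolynomial ι ℝ) :
    A.wsum τ G P (X v * f) =
      τ y * A.wsum τ G P f - ∑ w ∈ Finset.univ \ G, A.a w y * A.wsum τ G P (X w * f) := by
  rw [← wsum_theta_mul hP, theta, Finset.sum_mul, map_sum,
    ← Finset.sum_sdiff (Finset.subset_univ G), ← Finset.add_sum_erase G _ hv]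
  have h1 : ∀ w, A.wsum τ G P (C (A.a w y) * X w * f) = A.a w y * A.wsum τ G P (X w * f) := by
    intro w; rw [mul_assoc, ← smul_eq_C_mul, map_smul, smul_eq_mul]
  have h2 : ∑ w ∈ G.erase v, A.wsum τ G P (C (A.a w y) * X w * f) = 0 := by
    refine Finset.sum_eq_zero fun w hw => ?_
    rw [h1, hy0 w (Finset.mem_of_mem_erase hw) (Finset.ne_of_mem_erase hw), zero_mul]
  rw [h2, h1, hy]
  simp only [h1]
  ring

lemma wsum_slack_mul {y : V} (hy : ∀ v ∈ G, A.a v y = 1)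
    (f : MvPolynomial ι ℝ) :
    A.wsum τ G P (A.slack y * f) =
      ∑ v ∈ Finset.univ \ G, (1 - A.a v y) * A.wsum τ G P (X v * f) := by
  rw [slack, Finset.sum_mul, map_sum, ← Finset.sum_sdiff (Finset.subset_univ G)]
  have h1 : ∀ w, A.wsum τ G P (C (1 - A.a w y) * X w * f)
      = (1 - A.a w y) * A.wsum τ G P (X w * f) := by
    intro w; rw [mul_assoc, ← smul_eq_C_mul, map_smul, smul_eq_mul]
  simp only [h1]
  rw [Finset.sum_eq_zero (s := G) fun w hw => by rw [hy w hw]; ring, add_zero]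

lemma above_eq_empty (h : ¬A.IsFace G) : A.above G = ∅ := by
  ext H; simp only [mem_above, Finset.notMem_empty, iff_false]
  rintro ⟨h1, h2⟩; exact h ((isFace_of_mem h1).subset h2)

/-- Summing over all vertices of a face kills low degrees. -/
lemma wsum_above_eq_zero (hτ : A.Gen τ) {k : ℕ} (hk : k + G.card < Module.finrank ℝ V)
    {f : MvPolynomial ι ℝ} (hf : f.IsHomogeneous k) : A.wsum τ G (A.above G) f = 0 := by
  classical
  induction hn : Module.finrank ℝ V - G.card using Nat.strong_induction_on generalizing G k f with
  | _ n ih =>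
  by_cases hG : A.IsFace G
  swap
  · rw [above_eq_empty hG, wsum_apply]; simp
  have hX : ∀ (k : ℕ) (w : ι) (f : MvPolynomial ι ℝ), w ∉ G → f.IsHomogeneous k →
      k + 1 + G.card < Module.finrank ℝ V → A.wsum τ G (A.above G) (X w * f) = 0 := by
    intro k w f hw hf hk
    have hc : (insert w G).card = G.card + 1 := Finset.card_insert_of_notMem hw
    rw [wsum_X_mul hτ above_subset hw, ← above_insert]
    exact ih (Module.finrank ℝ V - (insert w G).card) (by omega) (by omega) hf rfl
  induction k generalizing f with
  | zero =>
    obtain ⟨r, rfl⟩ : ∃ r, f = C r := ⟨_, (totalDegree_eq_zero_iff_eq_C (p := f)).1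
      (by simpa using hf.totalDegree_le)⟩
    have e : A.wsum τ G (A.above G) (C r) = r * A.wsum τ G (A.above G) 1 := by
      rw [← smul_eq_mul, ← map_smul, smul_eq_C_mul, mul_one]
    rw [e]
    by_cases h1 : G.card + 1 = Module.finrank ℝ V
    · have := sum_gam_edge hτ hG h1
      rw [wsum_apply]; simp [this]
    · obtain ⟨H, hH, hs⟩ := hG.exists_vert
      obtain ⟨w, hw, hwG⟩ : ∃ w ∈ H, w ∉ G := by
        by_contra hcon
        push Not at hcon
        have := Finset.card_le_card hcon
        rw [card_of_mem hH] at this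
        omega
      have h2 := wsum_theta_mul (τ := τ) (G := G) (P := A.above G) above_subset (A.dv H w) 1
      have h3 : A.wsum τ G (A.above G) (A.theta (A.dv H w) * 1) = 0 := by
        rw [theta, Finset.sum_mul, map_sum]
        refine Finset.sum_eq_zero fun v _ => ?_
        rw [mul_assoc, ← smul_eq_C_mul, map_smul, smul_eq_mul]
        by_cases hv : v ∈ G
        · rw [(isFace_of_mem hH).dv_spec (hs hv), if_neg (by rintro rfl; exact hwG hv), zero_mul]
        · rw [hX 0 v 1 hv (isHomogeneous_one _ _) (by omega), mul_zero]
      have h4 : τ (A.dv H w) ≠ 0 := by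
        have := hτ.lam_ne hH hw
        simpa [lam, hw] using this
      rw [h3] at h2
      rw [(mul_eq_zero.1 h2.symm).resolve_left h4, mul_zero]
  | succ k ihk =>
    refine eq_zero_of_X_mul _ (fun v g hg => ?_) hf
    by_cases hv : v ∈ G
    · obtain ⟨y, hy⟩ := hG.exists_eval (fun w => if w = v then 1 else 0)
      rw [wsum_X_mul_of_mem above_subset hv (y := y) (by rw [hy v hv, if_pos rfl])
        (fun w hw hwv => by rw [hy w hw, if_neg hwv]), ihk (by omega) hg, mul_zero, zero_sub,
        Finset.sum_eq_zero, neg_zero]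
      intro w hw
      rw [hX k w g (Finset.mem_sdiff.1 hw).2 hg hk, mul_zero]
    · exact hX k v g hv hg hk

/-- Squarefree monomials. -/
noncomputable def xm (I : Finset ι) : MvPolynomial ι ℝ := ∏ v ∈ I, X v

lemma xm_homogeneous (I : Finset ι) : (xm I).IsHomogeneous I.card := by
  have := IsHomogeneous.prod I (fun v => (X v : MvPolynomial ι ℝ)) (fun _ => 1)
    (fun v _ => isHomogeneous_X ℝ v)
  simpa [xm] using this

lemma eval_xm_ne_zero (hτ : A.Gen τ) {H I : Finset ι} (hH : H ∈ A.verts) (h : I ⊆ H) :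
    eval (A.lam H τ) (xm I) ≠ 0 := by
  simp only [xm, map_prod, eval_X]
  exact Finset.prod_ne_zero_iff.2 fun v hv => hτ.lam_ne hH (h hv)

lemma eval_xm_eq_zero {H I : Finset ι} (h : ¬I ⊆ H) : eval (A.lam H τ) (xm I) = 0 := by
  obtain ⟨v, hv, hvH⟩ := Finset.not_subset.1 h
  simp only [xm, map_prod, eval_X]
  exact Finset.prod_eq_zero hv (lam_of_notMem hvH)

lemma wsum_xm_mul (hτ : A.Gen τ) (hP : P ⊆ A.verts) {I : Finset ι} (hI : Disjoint I G)
    (f : MvPolynomial ι ℝ) :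
    A.wsum τ G P (xm I * f) = A.wsum τ (I ∪ G) (P.filter fun H => I ⊆ H) f := by
  classical
  induction I using Finset.induction_on generalizing f with
  | empty => simp [xm]
  | insert v I hv ih =>
    rw [Finset.disjoint_insert_left] at hI
    have e : xm (insert v I) * f = xm I * (X v * f) := by
      simp only [xm, Finset.prod_insert hv]; ring
    rw [e, ih hI.2, wsum_X_mul hτ ((Finset.filter_subset _ _).trans hP) (by
      simp [hv, hI.1]), Finset.filter_filter, Finset.insert_union]
    congr 1
    · congr 1
      ext H
      simp only [Finset.mem_filter, Finset.insert_subset_iff]; tauto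

open Classical in
/-- Vertices of a face above a level. -/
noncomputable def gt (A : Sys ι V) (τ : Module.Dual ℝ V) (G : Finset ι) (c : ℝ) :
    Finset (Finset ι) := (A.above G).filter fun H => c < τ (A.pt H)

open Classical in
/-- Vertices of a face at or above a level. -/
noncomputable def ge (A : Sys ι V) (τ : Module.Dual ℝ V) (G : Finset ι) (c : ℝ) :
    Finset (Finset ι) := (A.above G).filter fun H => c ≤ τ (A.pt H)

lemma mem_gt {c : ℝ} {H : Finset ι} : H ∈ A.gt τ G c ↔ H ∈ A.above G ∧ c < τ (A.pt H) := by
  simp [gt]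

lemma mem_ge {c : ℝ} {H : Finset ι} : H ∈ A.ge τ G c ↔ H ∈ A.above G ∧ c ≤ τ (A.pt H) := by
  simp [ge]

lemma gt_subset {c : ℝ} : A.gt τ G c ⊆ A.above G := Finset.filter_subset _ _

lemma ge_subset {c : ℝ} : A.ge τ G c ⊆ A.above G := Finset.filter_subset _ _

lemma ge_eq_insert (hτ : A.Gen τ) {F : Finset ι} (hF : F ∈ A.above G) :
    A.ge τ G (τ (A.pt F)) = insert F (A.gt τ G (τ (A.pt F))) := by
  ext H
  rw [mem_ge, Finset.mem_insert, mem_gt]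
  constructor
  · rintro ⟨h1, h2⟩
    rcases h2.lt_or_eq with h3 | h3
    · exact Or.inr ⟨h1, h3⟩
    · exact Or.inl (hτ.2 _ (mem_above.1 h1).1 _ (mem_above.1 hF).1 h3.symm)
  · rintro (rfl | h)
    · exact ⟨hF, le_rfl⟩
    · exact ⟨h.1, h.2.le⟩

lemma notMem_gt {F : Finset ι} : F ∉ A.gt τ G (τ (A.pt F)) := by
  simp [mem_gt]

lemma wsum_insert {F : Finset ι} (hF : F ∉ P) (f : MvPolynomial ι ℝ) :
    A.wsum τ G (insert F P) f = A.gam G F τ * eval (A.lam F τ) f + A.wsum τ G P f := by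
  classical
  rw [wsum_apply, wsum_apply, Finset.sum_insert hF]

lemma gam_ne_zero (hτ : A.Gen τ) {F : Finset ι} (hF : F ∈ A.verts) : A.gam G F τ ≠ 0 := by
  rw [gam]
  refine div_ne_zero (inv_ne_zero (vol_pos hF).ne') (Finset.prod_ne_zero_iff.2 fun w hw => ?_)
  exact hτ.lam_ne hF (Finset.mem_sdiff.1 hw).1

/-- The monomial of the negative constraints at `F` vanishes strictly above `F`. -/
lemma wsum_gt_xm_neg (hτ : A.Gen τ) {F : Finset ι} (hF : F ∈ A.above G) (f : MvPolynomial ι ℝ) :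
    A.wsum τ G (A.gt τ G (τ (A.pt F))) (xm (A.neg G F τ) * f) = 0 := by
  rw [wsum_apply]
  refine Finset.sum_eq_zero fun K hK => ?_
  rw [mem_gt, mem_above] at hK
  rw [mem_above] at hF
  rw [map_mul, eval_xm_eq_zero, zero_mul, mul_zero]
  intro hs
  have := (vert_le_of_lam_pos hF.1 hK.1.1 (τ := τ) fun w hw hwK => by
    refine lt_of_le_of_ne ?_ (hτ.lam_ne hF.1 hw).symm
    by_contra hneg
    push Not at hneg
    exact hwK (hs (mem_neg.2 ⟨hw, fun h => hwK (hK.1.2 h), hneg⟩))).1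
  linarith [hK.2]

/-- The monomial of the positive constraints at `F` is supported on vertices above `F`. -/
lemma wsum_ge_xm_pos (hτ : A.Gen τ) {F : Finset ι} (hF : F ∈ A.above G) {k : ℕ}
    {f : MvPolynomial ι ℝ} (hf : f.IsHomogeneous k) (hk : k < (A.neg G F τ).card) :
    A.wsum τ G (A.ge τ G (τ (A.pt F))) (xm ((F \ G) \ A.neg G F τ) * f) = 0 := by
  classical
  have hFv := (mem_above.1 hF).1
  have hGF := (mem_above.1 hF).2
  set J := (F \ G) \ A.neg G F τ with hJ
  have hd : Disjoint J G := by
    rw [Finset.disjoint_left]; intro v hv; simp only [hJ, Finset.mem_sdiff] at hv; exact hv.1.2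
  have hns : A.neg G F τ ⊆ F \ G := Finset.filter_subset _ _
  rw [wsum_xm_mul hτ (ge_subset.trans above_subset) hd]
  have e : (A.ge τ G (τ (A.pt F))).filter (fun H => J ⊆ H) = A.above (J ∪ G) := by
    ext K
    simp only [Finset.mem_filter, mem_ge, mem_above, Finset.union_subset_iff]
    constructor
    · rintro ⟨⟨⟨h1, h2⟩, -⟩, h3⟩; exact ⟨h1, h3, h2⟩
    · rintro ⟨h1, h2, h3⟩
      refine ⟨⟨⟨h1, h3⟩, ?_⟩, h2⟩
      refine (le_vert_of_lam_neg hFv h1 (τ := τ) fun w hw hwK => ?_).1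
      by_contra hcon
      refine hwK (h2 ?_)
      simp only [hJ, Finset.mem_sdiff, mem_neg]
      exact ⟨⟨hw, fun h => hwK (h3 h)⟩, fun h => hcon h.2.2⟩
  rw [e]
  refine wsum_above_eq_zero hτ ?_ hf
  rw [Finset.card_union_of_disjoint hd, hJ, Finset.card_sdiff_of_subset hns,
    Finset.card_sdiff_of_subset hGF, card_of_mem hFv]
  have h1 := Finset.card_le_card hns
  rw [Finset.card_sdiff_of_subset hGF, card_of_mem hFv] at h1
  have h2 := Finset.card_le_card hGF
  rw [card_of_mem hFv] at h2
  omega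

lemma exists_homogeneous_eval_ne (hτ : A.Gen τ) {F : Finset ι} (hF : F ∈ A.verts) (hne : F.Nonempty)
    (k : ℕ) : ∃ f : MvPolynomial ι ℝ, f.IsHomogeneous k ∧ eval (A.lam F τ) f ≠ 0 := by
  obtain ⟨w, hw⟩ := hne
  refine ⟨X w ^ k, isHomogeneous_X_pow w k, ?_⟩
  rw [map_pow, eval_X]
  exact pow_ne_zero _ (hτ.lam_ne hF hw)

/-- A polynomial in the radical at or above `F` vanishes at `F`. -/
lemma eval_eq_zero_of_ge (hτ : A.Gen τ) {F : Finset ι} (hF : F ∈ A.above G) (hne : F.Nonempty)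
    {u : MvPolynomial ι ℝ} {k : ℕ} (hk : (A.neg G F τ).card ≤ k)
    (h : ∀ z : MvPolynomial ι ℝ, z.IsHomogeneous k →
      A.wsum τ G (A.ge τ G (τ (A.pt F))) (u * z) = 0) : eval (A.lam F τ) u = 0 := by
  have hFv := (mem_above.1 hF).1
  obtain ⟨f, hf, hf0⟩ := exists_homogeneous_eval_ne hτ hFv hne (k - (A.neg G F τ).card)
  have h1 := h (xm (A.neg G F τ) * f) (by
    have := (xm_homogeneous (A.neg G F τ)).mul hf
    rwa [Nat.add_sub_cancel' hk] at this)
  rw [mul_left_comm, ge_eq_insert hτ hF, wsum_insert notMem_gt, wsum_gt_xm_neg hτ hF, add_zero,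
    map_mul, map_mul] at h1
  have h2 := gam_ne_zero (G := G) hτ hFv
  have h3 := eval_xm_ne_zero hτ hFv (I := A.neg G F τ)
    ((Finset.filter_subset _ _).trans Finset.sdiff_subset)
  simpa [h2, h3, hf0] using h1

/-- A polynomial in the radical strictly above `F` vanishes at `F`. -/
lemma eval_eq_zero_of_gt (hτ : A.Gen τ) {F : Finset ι} (hF : F ∈ A.above G) (hne : F.Nonempty)
    {u : MvPolynomial ι ℝ} {j k : ℕ} (hu : u.IsHomogeneous j)
    (hjk : j + k + G.card < Module.finrank ℝ V)
    (hk : Module.finrank ℝ V ≤ k + G.card + (A.neg G F τ).card)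
    (h : ∀ z : MvPolynomial ι ℝ, z.IsHomogeneous k →
      A.wsum τ G (A.gt τ G (τ (A.pt F))) (u * z) = 0) : eval (A.lam F τ) u = 0 := by
  have hFv := (mem_above.1 hF).1
  have hGF := (mem_above.1 hF).2
  have hns : A.neg G F τ ⊆ F \ G := Finset.filter_subset _ _
  set J := (F \ G) \ A.neg G F τ with hJ
  have hJc : J.card + (A.neg G F τ).card + G.card = Module.finrank ℝ V := by
    have h1 := Finset.card_le_card hns
    rw [hJ, Finset.card_sdiff_of_subset hns]
    rw [Finset.card_sdiff_of_subset hGF, card_of_mem hFv] at *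
    have h2 := Finset.card_le_card hGF
    rw [card_of_mem hFv] at h2
    omega
  obtain ⟨f, hf, hf0⟩ := exists_homogeneous_eval_ne hτ hFv hne (k - J.card)
  have h1 := h (xm J * f) (by
    have := (xm_homogeneous J).mul hf
    rwa [Nat.add_sub_cancel' (by omega)] at this)
  have h2 := wsum_ge_xm_pos hτ hF (hu.mul hf) (by omega)
  rw [ge_eq_insert hτ hF, wsum_insert notMem_gt, ← hJ, mul_left_comm (xm J), h1, add_zero,
    map_mul, map_mul] at h2
  have h3 := gam_ne_zero (G := G) hτ hFv
  have h4 := eval_xm_ne_zero hτ hFv (I := J) (Finset.sdiff_subset.trans Finset.sdiff_subset)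
  simpa [h3, h4, hf0] using h2

end Sys

lemma PosOn.map {M M' : Type*} [AddCommGroup M] [Module ℝ M] [FiniteDimensional ℝ M]
    [AddCommGroup M'] [Module ℝ M'] [FiniteDimensional ℝ M']
    {B : LinearMap.BilinForm ℝ M} {B' : LinearMap.BilinForm ℝ M'} (f : M →ₗ[ℝ] M')
    {W : Submodule ℝ M} (hW : PosOn B W) (h : ∀ u ∈ W, B u u = B' (f u) (f u)) :
    PosOn B' (W.map f) ∧ Module.finrank ℝ W ≤ Module.finrank ℝ (W.map f) := by
  have hinj : Function.Injective (f.comp W.subtype) := by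
    rw [← LinearMap.ker_eq_bot, LinearMap.ker_eq_bot']
    intro w hw
    by_contra h0
    have h1 := hW w w.2 (by simpa using h0)
    rw [h w w.2] at h1
    have : f w = 0 := hw
    simp [this] at h1
  constructor
  · rintro _ ⟨x, hx, rfl⟩ hx0
    rw [← h x hx]
    exact hW x hx (by rintro rfl; exact hx0 (map_zero _))
  · have := LinearMap.finrank_range_of_inj hinj
    rw [LinearMap.range_comp, Submodule.range_subtype] at this
    exact this.ge

section Forms

variable {ι : Type*} [Fintype ι]

instance instFiniteHomogeneous (j : ℕ) : Module.Finite ℝ (homogeneousSubmodule ι ℝ j) :=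
  Module.Finite.iff_fg.2 (homogeneousSubmodule_fg ι ℝ j)

/-- The form `(u, y) ↦ L (ω ^ m * u * y)` in degree `j`. -/
noncomputable def Qf (L : MvPolynomial ι ℝ →ₗ[ℝ] ℝ) (ω : MvPolynomial ι ℝ) (j m : ℕ) :
    LinearMap.BilinForm ℝ (homogeneousSubmodule ι ℝ j) :=
  LinearMap.mk₂ ℝ (fun u y => L (ω ^ m * (u : MvPolynomial ι ℝ) * y))
    (fun u v y => by simp [mul_add, add_mul])
    (fun c u y => by simp)
    (fun u v y => by simp [mul_add])
    (fun c u y => by simp)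

lemma Qf_apply {L : MvPolynomial ι ℝ →ₗ[ℝ] ℝ} {ω : MvPolynomial ι ℝ} {j m : ℕ}
    (u y : homogeneousSubmodule ι ℝ j) :
    Qf L ω j m u y = L (ω ^ m * (u : MvPolynomial ι ℝ) * y) := rfl

lemma Qf_symm {L : MvPolynomial ι ℝ →ₗ[ℝ] ℝ} {ω : MvPolynomial ι ℝ} {j m : ℕ}
    (u y : homogeneousSubmodule ι ℝ j) : Qf L ω j m u y = Qf L ω j m y u := by
  rw [Qf_apply, Qf_apply, mul_right_comm]

/-- The radical of the pairing of degrees `j` and `k` given by `L`. -/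
noncomputable def Nul (L : MvPolynomial ι ℝ →ₗ[ℝ] ℝ) (j k : ℕ) :
    Submodule ℝ (homogeneousSubmodule ι ℝ j) where
  carrier := {u | ∀ z : MvPolynomial ι ℝ, z.IsHomogeneous k → L (u * z) = 0}
  add_mem' := fun {u v} hu hv z hz => by simp [add_mul, hu z hz, hv z hz]
  zero_mem' := fun z _ => by simp
  smul_mem' := fun c u hu z hz => by simp [hu z hz]

lemma mem_Nul {L : MvPolynomial ι ℝ →ₗ[ℝ] ℝ} {j k : ℕ} {u : homogeneousSubmodule ι ℝ j} :
    u ∈ Nul L j k ↔ ∀ z : MvPolynomial ι ℝ, z.IsHomogeneous k → L (u * z) = 0 := Iff.rfl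

/-- The hard Lefschetz property of `L` in degree `j`. -/
def HL (L : MvPolynomial ι ℝ →ₗ[ℝ] ℝ) (ω : MvPolynomial ι ℝ) (j m : ℕ) : Prop :=
  ∀ u : MvPolynomial ι ℝ, u.IsHomogeneous j →
    (∀ y : MvPolynomial ι ℝ, y.IsHomogeneous j → L (ω ^ m * u * y) = 0) →
    ∀ z : MvPolynomial ι ℝ, z.IsHomogeneous (j + m) → L (u * z) = 0

/-- The Hodge-Riemann property of `L` in degree `j`, allowing a radical. -/
def HR (L : MvPolynomial ι ℝ →ₗ[ℝ] ℝ) (ω : MvPolynomial ι ℝ) (j m : ℕ) : Prop :=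
  ∀ u : MvPolynomial ι ℝ, u.IsHomogeneous j →
    (∀ j', j = j' + 1 → ∀ y : MvPolynomial ι ℝ, y.IsHomogeneous j' →
      L (ω ^ (m + 1) * u * y) = 0) →
    0 ≤ (-1) ^ j * L (ω ^ m * u * u) ∧
    ((-1) ^ j * L (ω ^ m * u * u) = 0 →
      ∀ z : MvPolynomial ι ℝ, z.IsHomogeneous (j + m) → L (u * z) = 0)

variable {L : MvPolynomial ι ℝ →ₗ[ℝ] ℝ} {ω : MvPolynomial ι ℝ} {j m : ℕ}

lemma Nul_le_ker (hω : ω.IsHomogeneous 1) :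
    Nul L j (j + m) ≤ LinearMap.ker (Qf L ω j m) := by
  intro u hu
  rw [LinearMap.mem_ker]
  ext y
  rw [Qf_apply, LinearMap.zero_apply]
  have := hu (y * ω ^ m) (by simpa using y.2.mul (hω.pow m))
  rw [← this]; congr 1; ring

lemma HL.ker_eq (h : HL L ω j m) (hω : ω.IsHomogeneous 1) :
    LinearMap.ker (Qf L ω j m) = Nul L j (j + m) := by
  refine le_antisymm (fun u hu => ?_) (Nul_le_ker hω)
  rw [LinearMap.mem_ker] at hu
  exact h u u.2 fun y hy => by
    have := LinearMap.congr_fun hu (⟨y, hy⟩ : homogeneousSubmodule ι ℝ j)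
    simpa [Qf_apply] using this

/-- Multiplication by a linear form. -/
noncomputable def mulH (hω : ω.IsHomogeneous 1) (j : ℕ) :
    homogeneousSubmodule ι ℝ j →ₗ[ℝ] homogeneousSubmodule ι ℝ (j + 1) :=
  ((LinearMap.mulLeft ℝ ω).comp (Submodule.subtype _)).codRestrict _ fun u => by
    have := hω.mul u.2
    rw [add_comm] at this
    exact this

lemma mulH_apply (hω : ω.IsHomogeneous 1) (u : homogeneousSubmodule ι ℝ j) :
    ((mulH hω j u : homogeneousSubmodule ι ℝ (j + 1)) : MvPolynomial ι ℝ) = ω * u := rfl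

lemma HR_of_posIdx_le (hω : ω.IsHomogeneous 1) (h : HL L ω j m)
    (h0 : j = 0 → posIdx (-((-1 : ℝ) ^ j • Qf L ω j m)) = 0)
    (h1 : ∀ j', j = j' + 1 → posIdx (-((-1 : ℝ) ^ j • Qf L ω j m)) ≤
      posIdx (-((-1 : ℝ) ^ j • Qf L ω j' (m + 2)))) : HR L ω j m := by
  intro u hu hprim
  set B := -((-1 : ℝ) ^ j • Qf L ω j m) with hB
  have hs : ∀ u v, B u v = B v u := fun u v => by simp [hB, Qf_symm u v]
  have key : ∃ W : Submodule ℝ (homogeneousSubmodule ι ℝ j), PosOn B W ∧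
      Module.finrank ℝ W = posIdx B ∧ ∀ w ∈ W, B ⟨u, hu⟩ w = 0 := by
    rcases j with _ | j
    · refine ⟨⊥, fun u hu h0 => absurd ((Submodule.mem_bot ℝ).1 hu) h0, ?_, ?_⟩
      · rw [finrank_bot, h0 rfl]
      · intro w hw; rw [(Submodule.mem_bot ℝ).1 hw, map_zero]
    · obtain ⟨U, hU, hUr⟩ := exists_posOn (-((-1 : ℝ) ^ (j + 1) • Qf L ω j (m + 2)))
      have hBU : ∀ x y, B (mulH hω j x) (mulH hω j y)
          = (-((-1 : ℝ) ^ (j + 1) • Qf L ω j (m + 2))) x y := by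
        intro x y
        simp only [hB, LinearMap.neg_apply, LinearMap.smul_apply, Qf_apply, mulH_apply]
        congr 3; ring
      obtain ⟨hpos, hle⟩ := hU.map (mulH hω j) fun u _ => (hBU u u).symm
      refine ⟨U.map (mulH hω j), hpos, le_antisymm hpos.finrank_le ?_, ?_⟩
      · exact (h1 j rfl).trans (hUr ▸ hle)
      · rintro _ ⟨x, hx, rfl⟩
        simp only [hB, LinearMap.neg_apply, LinearMap.smul_apply, Qf_apply, mulH_apply]
        have := hprim j rfl x x.2
        rw [neg_eq_zero, smul_eq_zero]
        right
        rw [← this]; congr 1; ring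
  obtain ⟨W, hW, hWr, ho⟩ := key
  have e : B ⟨u, hu⟩ ⟨u, hu⟩ = -((-1) ^ j * L (ω ^ m * u * u)) := by
    simp [hB, Qf_apply]
  constructor
  · have := hW.nonpos_of_orthogonal hs hWr ho
    rw [e] at this
    linarith
  · intro hz
    have h2 := hW.radical_of_orthogonal hs hWr ho (by rw [e, hz, neg_zero])
    refine h u hu fun y hy => ?_
    have h3 := LinearMap.congr_fun h2 (⟨y, hy⟩ : homogeneousSubmodule ι ℝ j)
    simpa [hB, Qf_apply] using h3

end Forms

lemma prod_sign {κ : Type*} (s : Finset κ) (f : κ → ℝ) (hf : ∀ w ∈ s, f w ≠ 0) :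
    0 < (-1) ^ (s.filter fun w => f w < 0).card * ∏ w ∈ s, f w := by
  classical
  induction s using Finset.induction_on with
  | empty => simp
  | insert a s ha ih =>
    have h1 := ih fun w hw => hf w (Finset.mem_insert_of_mem hw)
    have h2 := hf a (Finset.mem_insert_self a s)
    rw [Finset.filter_insert, Finset.prod_insert ha]
    split_ifs with h
    · rw [Finset.card_insert_of_notMem (by simp [ha]), pow_succ]
      have := mul_pos (neg_pos.2 h) h1
      linarith
    · have := mul_pos (lt_of_le_of_ne (not_lt.1 h) h2.symm) h1
      linarith

namespace Sys

variable {ι V : Type*} [Fintype ι] [DecidableEq ι] [AddCommGroup V] [Module ℝ V]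
  [FiniteDimensional ℝ V] {A : Sys ι V} {τ : Module.Dual ℝ V} {G : Finset ι}

lemma gam_sign (hτ : A.Gen τ) {H : Finset ι} (hH : H ∈ A.verts) :
    0 < (-1) ^ (A.neg G H τ).card * A.gam G H τ := by
  have h1 := prod_sign (H \ G) (A.lam H τ) fun w hw => hτ.lam_ne hH (Finset.mem_sdiff.1 hw).1
  have h2 : A.neg G H τ = (H \ G).filter fun w => A.lam H τ w < 0 := by
    ext w; simp [mem_neg, and_assoc]
  rw [gam, h2]
  have h3 := inv_pos.2 (vol_pos hH)
  have h4 := mul_pos h3 (inv_pos.2 h1)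
  have h5 : ((-1 : ℝ) ^ ((H \ G).filter fun w => A.lam H τ w < 0).card)⁻¹
      = (-1) ^ ((H \ G).filter fun w => A.lam H τ w < 0).card := by
    rw [← inv_pow]; norm_num
  rw [mul_inv, h5] at h4
  rw [div_eq_mul_inv]
  linarith

lemma wsum_slack_pow_congr {P : Finset (Finset ι)} (hP : P ⊆ A.verts) {y y' : V}
    (h : τ y = τ y') (m : ℕ) (f : MvPolynomial ι ℝ) :
    A.wsum τ G P (A.slack y ^ m * f) = A.wsum τ G P (A.slack y' ^ m * f) := by
  rw [wsum_slack_pow_mul hP, wsum_slack_pow_mul hP, h]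

open Classical in
/-- The vertices of a face passed at level `c`; a vertex on the level is passed if it has more
negative than positive constraints. -/
noncomputable def pass (A : Sys ι V) (τ : Module.Dual ℝ V) (G : Finset ι) (c : ℝ) :
    Finset (Finset ι) :=
  (A.above G).filter fun H => c < τ (A.pt H) ∨
    (c = τ (A.pt H) ∧ Module.finrank ℝ V < G.card + 2 * (A.neg G H τ).card)

lemma mem_pass {c : ℝ} {H : Finset ι} : H ∈ A.pass τ G c ↔ H ∈ A.above G ∧
    (c < τ (A.pt H) ∨
      (c = τ (A.pt H) ∧ Module.finrank ℝ V < G.card + 2 * (A.neg G H τ).card)) := by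
  simp [pass]

lemma pass_subset {c : ℝ} : A.pass τ G c ⊆ A.above G := Finset.filter_subset _ _

lemma pass_subset_verts {c : ℝ} : A.pass τ G c ⊆ A.verts := pass_subset.trans above_subset

lemma pass_eq_ge {c : ℝ} (h : ∀ F ∈ A.above G, c = τ (A.pt F) →
    Module.finrank ℝ V < G.card + 2 * (A.neg G F τ).card) : A.pass τ G c = A.ge τ G c := by
  ext H
  rw [mem_pass, mem_ge]
  refine and_congr_right fun hH => ⟨?_, fun h1 => ?_⟩
  · rintro (h1 | ⟨h1, -⟩)
    · exact h1.le
    · exact h1.le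
  · rcases h1.lt_or_eq with h2 | h2
    · exact Or.inl h2
    · exact Or.inr ⟨h2, h H hH h2⟩

lemma pass_eq_gt {c : ℝ} (h : ∀ F ∈ A.above G, c = τ (A.pt F) →
    G.card + 2 * (A.neg G F τ).card ≤ Module.finrank ℝ V) : A.pass τ G c = A.gt τ G c := by
  ext H
  rw [mem_pass, mem_gt]
  refine and_congr_right fun hH => ⟨?_, fun h1 => Or.inl h1⟩
  rintro (h1 | ⟨h1, h2⟩)
  · exact h1
  · have := h H hH h1; omega

lemma eq_of_level (hτ : A.Gen τ) {F F' : Finset ι} (hF : F ∈ A.above G) (hF' : F' ∈ A.above G)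
    (h : τ (A.pt F) = τ (A.pt F')) : F = F' :=
  hτ.2 _ (mem_above.1 hF).1 _ (mem_above.1 hF').1 h

lemma card_neg_insert {v : ι} {F : Finset ι} :
    (A.neg G F τ).card ≤ (A.neg (insert v G) F τ).card + 1 ∧
      (A.neg (insert v G) F τ).card ≤ (A.neg G F τ).card := by
  constructor
  · have : A.neg G F τ ⊆ insert v (A.neg (insert v G) F τ) := by
      intro w hw
      rw [mem_neg] at hw
      rw [Finset.mem_insert, mem_neg, Finset.mem_insert]
      tauto
    exact (Finset.card_le_card this).trans (Finset.card_insert_le _ _)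
  · refine Finset.card_le_card fun w hw => ?_
    rw [mem_neg, Finset.mem_insert] at hw
    rw [mem_neg]; tauto

/-- Splitting off a vertex of weight zero. -/
lemma wsum_slack_insert {F : Finset ι} {P : Finset (Finset ι)} (hF : F ∉ P) (hFv : F ∈ A.verts)
    {y : V} (hy : τ y = τ (A.pt F)) {m : ℕ} (hm : m ≠ 0) (f : MvPolynomial ι ℝ) :
    A.wsum τ G (insert F P) (A.slack y ^ m * f) = A.wsum τ G P (A.slack y ^ m * f) := by
  rw [wsum_insert hF, map_mul, map_pow, eval_slack hFv, hy, sub_self, zero_pow hm]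
  ring

/-- The facet comparison in the inductive step for the hard Lefschetz property. -/
lemma link_step (hτ : A.Gen τ) {v : ι} (hv : v ∉ G) {y : V} {j m : ℕ}
    (hd : G.card + 2 * j + m + 2 = Module.finrank ℝ V)
    (hR : HR (A.wsum τ (insert v G) (A.pass τ (insert v G) (τ y))) (A.slack y) j m)
    {u : MvPolynomial ι ℝ} (hu : u.IsHomogeneous j)
    (h : ∀ j', j = j' + 1 → ∀ z : MvPolynomial ι ℝ, z.IsHomogeneous j' →
      A.wsum τ (insert v G) ((A.pass τ G (τ y)).filter fun H => v ∈ H)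
        (A.slack y ^ (m + 1) * u * z) = 0) :
    0 ≤ (-1) ^ j * A.wsum τ (insert v G) ((A.pass τ G (τ y)).filter fun H => v ∈ H)
        (A.slack y ^ m * u * u) ∧
      ((-1) ^ j * A.wsum τ (insert v G) ((A.pass τ G (τ y)).filter fun H => v ∈ H)
        (A.slack y ^ m * u * u) = 0 → ∀ z : MvPolynomial ι ℝ, z.IsHomogeneous (j + m) →
        A.wsum τ (insert v G) ((A.pass τ G (τ y)).filter fun H => v ∈ H) (u * z) = 0) := by
  set P := (A.pass τ G (τ y)).filter fun H => v ∈ H with hP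
  set P' := A.pass τ (insert v G) (τ y) with hP'
  have hc : (insert v G).card = G.card + 1 := Finset.card_insert_of_notMem hv
  have hmem : ∀ H, H ∈ P ↔ H ∈ A.above (insert v G) ∧ (τ y < τ (A.pt H) ∨
      (τ y = τ (A.pt H) ∧ Module.finrank ℝ V < G.card + 2 * (A.neg G H τ).card)) := by
    intro H
    rw [hP, Finset.mem_filter, mem_pass, above_insert, Finset.mem_filter]
    tauto
  have hPgt : ∀ F ∈ A.above (insert v G), τ y = τ (A.pt F) →
      ¬(Module.finrank ℝ V < G.card + 2 * (A.neg G F τ).card) →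
      P = A.gt τ (insert v G) (τ (A.pt F)) := by
    intro F hF h1 h2
    ext H
    rw [hmem, mem_gt, h1]
    refine and_congr_right fun hH => ⟨?_, Or.inl⟩
    rintro (h3 | ⟨h3, h4⟩)
    · exact h3
    · exact absurd h4 (by rwa [← eq_of_level hτ hF hH h3])
  have hPge : ∀ F ∈ A.above (insert v G), τ y = τ (A.pt F) →
      (Module.finrank ℝ V < G.card + 2 * (A.neg G F τ).card) →
      P = A.ge τ (insert v G) (τ (A.pt F)) := by
    intro F hF h1 h2
    ext H
    rw [hmem, mem_ge, h1]
    refine and_congr_right fun hH => ⟨?_, fun h3 => ?_⟩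
    · rintro (h3 | ⟨h3, h4⟩)
      · exact h3.le
      · exact h3.le
    · rcases h3.lt_or_eq with h4 | h4
      · exact Or.inl h4
      · exact Or.inr ⟨h4, by rwa [← eq_of_level hτ hF hH h4]⟩
  have hP'gt : ∀ F ∈ A.above (insert v G), τ y = τ (A.pt F) →
      ((insert v G).card + 2 * (A.neg (insert v G) F τ).card ≤ Module.finrank ℝ V) →
      P' = A.gt τ (insert v G) (τ (A.pt F)) := by
    intro F hF h1 h2
    rw [hP', h1]
    refine pass_eq_gt fun F' hF' h3 => ?_
    rwa [← eq_of_level hτ hF hF' h3]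
  have hP'ge : ∀ F ∈ A.above (insert v G), τ y = τ (A.pt F) →
      (Module.finrank ℝ V < (insert v G).card + 2 * (A.neg (insert v G) F τ).card) →
      P' = A.ge τ (insert v G) (τ (A.pt F)) := by
    intro F hF h1 h2
    rw [hP', h1]
    refine pass_eq_ge fun F' hF' h3 => ?_
    rwa [← eq_of_level hτ hF hF' h3]
  by_cases heq : P = P'
  · rw [heq]
    exact hR u hu (by rwa [heq] at h)
  obtain ⟨F, hF, hyF, hne⟩ : ∃ F ∈ A.above (insert v G), τ y = τ (A.pt F) ∧
      ¬(Module.finrank ℝ V < G.card + 2 * (A.neg G F τ).card ↔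
        Module.finrank ℝ V < (insert v G).card + 2 * (A.neg (insert v G) F τ).card) := by
    by_contra hcon
    push Not at hcon
    refine heq ?_
    ext H
    rw [hmem, mem_pass]
    refine and_congr_right fun hH => or_congr_right (and_congr_right fun h1 => ?_)
    exact hcon H hH h1
  have hFv := above_subset hF
  have hFne : F.Nonempty := ⟨v, (mem_above.1 hF).2 (Finset.mem_insert_self _ _)⟩
  obtain ⟨hi1, hi2⟩ := card_neg_insert (A := A) (τ := τ) (F := F) (v := v) (G := G)
  by_cases hcase : Module.finrank ℝ V < G.card + 2 * (A.neg G F τ).card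
  · -- the wall vertex is counted in the facet sum only
    have e1 := hPge F hF hyF hcase
    have e2 := hP'gt F hF hyF (by by_contra hcon; push Not at hcon; tauto)
    have e3 : P = insert F P' := by rw [e1, e2, ge_eq_insert hτ hF]
    have hFP : F ∉ P' := by rw [e2]; exact notMem_gt
    have hq := mt (iff_of_true hcase) hne
    have hm : m ≠ 0 := by omega
    have h0 := hR u hu (fun j' hj z hz => by
      have := h j' hj z hz
      rwa [mul_assoc, e3, wsum_slack_insert hFP hFv hyF (by omega), ← mul_assoc] at this)
    have e4 : A.wsum τ (insert v G) P (A.slack y ^ m * u * u) =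
        A.wsum τ (insert v G) P' (A.slack y ^ m * u * u) := by
      rw [e3, mul_assoc, wsum_slack_insert hFP hFv hyF hm]
    rw [e4]
    refine ⟨h0.1, fun hz z hzz => ?_⟩
    have h2 := h0.2 hz
    have h3 := eval_eq_zero_of_gt hτ hF hFne hu (k := j + m) (by omega) (by omega)
      (by rwa [← e2])
    rw [e3, wsum_insert hFP, h2 z hzz, map_mul, h3]; ring
  · have e1 := hPgt F hF hyF hcase
    have e2 := hP'ge F hF hyF (by by_contra hcon; tauto)
    have e3 : P' = insert F P := by rw [e1, e2, ge_eq_insert hτ hF]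
    have hFP : F ∉ P := by rw [e1]; exact notMem_gt
    have hq : Module.finrank ℝ V < (insert v G).card + 2 * (A.neg (insert v G) F τ).card := by
      tauto
    have h0 := hR u hu (fun j' hj z hz => by
      rw [mul_assoc, e3, wsum_slack_insert hFP hFv hyF (by omega), ← mul_assoc, h j' hj z hz])
    have hrad : (∀ z : MvPolynomial ι ℝ, z.IsHomogeneous (j + m) →
        A.wsum τ (insert v G) P' (u * z) = 0) → eval (A.lam F τ) u = 0 →
        ∀ z : MvPolynomial ι ℝ, z.IsHomogeneous (j + m) →
        A.wsum τ (insert v G) P (u * z) = 0 := by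
      intro h1 h2 z hz
      have := h1 z hz
      rwa [e3, wsum_insert hFP, map_mul, h2, zero_mul, mul_zero, zero_add] at this
    rcases Nat.eq_zero_or_pos m with hm | hm
    · subst hm
      have e4 : A.wsum τ (insert v G) P' (A.slack y ^ 0 * u * u) =
          A.gam (insert v G) F τ * (eval (A.lam F τ) u) ^ 2 +
          A.wsum τ (insert v G) P (A.slack y ^ 0 * u * u) := by
        rw [e3, wsum_insert hFP, pow_zero, one_mul, map_mul, sq]
      have hi : (A.neg (insert v G) F τ).card = j + 1 := by omega
      have hs := gam_sign (G := insert v G) hτ hFv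
      rw [hi, pow_succ] at hs
      rw [e4] at h0
      set x := eval (A.lam F τ) u
      set g := (-1 : ℝ) ^ j * A.gam (insert v G) F τ with hg
      have hgneg : g < 0 := by rw [hg]; linarith
      have hx : g * x ^ 2 ≤ 0 := mul_nonpos_of_nonpos_of_nonneg hgneg.le (sq_nonneg x)
      have h1 := h0.1
      rw [mul_add, ← mul_assoc, ← hg] at h1
      refine ⟨by linarith, fun hz => ?_⟩
      rw [hz, add_zero] at h1
      have hx0 : x = 0 := by
        have : g * x ^ 2 = 0 := le_antisymm hx h1
        simpa [hgneg.ne] using this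
      refine hrad (h0.2 ?_) hx0
      rw [mul_add, hz, hx0]; ring
    · have e4 : A.wsum τ (insert v G) P (A.slack y ^ m * u * u) =
          A.wsum τ (insert v G) P' (A.slack y ^ m * u * u) := by
        rw [e3, mul_assoc, wsum_slack_insert hFP hFv hyF hm.ne']
      rw [e4]
      refine ⟨h0.1, fun hz => hrad (h0.2 hz) ?_⟩
      exact eval_eq_zero_of_ge hτ hF hFne (k := j + m) (by omega)
        (by rw [← e2]; exact h0.2 hz)

end Sys

namespace Sys

variable {ι V : Type*} [Fintype ι] [DecidableEq ι] [AddCommGroup V] [Module ℝ V]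
  [FiniteDimensional ℝ V] {A : Sys ι V} {τ : Module.Dual ℝ V} {G : Finset ι}

lemma pass_eq_empty (hτ : A.Gen τ) {c : ℝ} (h : ∀ H ∈ A.above G, τ (A.pt H) ≤ c) :
    A.pass τ G c = ∅ := by
  ext H
  simp only [mem_pass, Finset.notMem_empty, iff_false]
  rintro ⟨h1, h2 | ⟨h2, h3⟩⟩
  · exact absurd (h H h1) (not_le.2 h2)
  · have hH := (mem_above.1 h1)
    rw [neg_of_pos (fun w hw hwG => lt_of_le_of_ne
      (lam_nonneg_of_max hH.1 hH.2 (fun K k hK => h2 ▸ h K (mem_above.2 ⟨k, hK⟩)) hw hwG)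
      (hτ.lam_ne hH.1 hw).symm), Finset.card_empty] at h3
    have h4 := Finset.card_le_card hH.2
    rw [card_of_mem hH.1] at h4
    omega

lemma pass_eq_above (hτ : A.Gen τ) {c : ℝ} (hG : G.card < Module.finrank ℝ V)
    (h : ∀ H ∈ A.above G, c ≤ τ (A.pt H)) : A.pass τ G c = A.above G := by
  refine Finset.Subset.antisymm pass_subset fun H h1 => mem_pass.2 ⟨h1, ?_⟩
  rcases (h H h1).lt_or_eq with h2 | h2
  · exact Or.inl h2
  refine Or.inr ⟨h2, ?_⟩
  have hH := (mem_above.1 h1)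
  have hn : ∀ w ∈ H, w ∉ G → A.lam H τ w < 0 := by
    intro w hw hwG
    refine lt_of_le_of_ne ?_ (hτ.lam_ne hH.1 hw)
    have := lam_nonneg_of_max (τ := -τ) hH.1 hH.2 (fun K k hK => by
      have := h K (mem_above.2 ⟨k, hK⟩)
      simp only [LinearMap.neg_apply]
      linarith) hw hwG
    rw [lam_neg] at this
    linarith
  rw [neg_of_neg hn, Finset.card_sdiff_of_subset hH.2, card_of_mem hH.1]
  omega

/-- A linear functional of the form `f ↦ L (u * f)` vanishes if the variables off a face are
killed. -/
lemma wsum_mul_eq_zero (hτ : A.Gen τ) (hG : A.IsFace G) (hc : G.card < Module.finrank ℝ V)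
    {P : Finset (Finset ι)} (hP : P ⊆ A.verts) {u : MvPolynomial ι ℝ} {k : ℕ}
    (h : ∀ v ∉ G, ∀ z : MvPolynomial ι ℝ, z.IsHomogeneous k → A.wsum τ G P (X v * (u * z)) = 0)
    {z : MvPolynomial ι ℝ} (hz : z.IsHomogeneous (k + 1)) : A.wsum τ G P (u * z) = 0 := by
  have := eq_zero_of_X_mul ((A.wsum τ G P).comp (LinearMap.mulLeft ℝ u)) (k := k) ?_ hz
  · exact this
  intro v g hg
  rw [LinearMap.comp_apply, LinearMap.mulLeft_apply, mul_left_comm]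
  by_cases hv : v ∈ G
  swap
  · exact h v hv g hg
  obtain ⟨H, hH, hGH⟩ := hG.exists_vert
  obtain ⟨w, hw, hwG⟩ : ∃ w ∈ H, w ∉ G := by
    by_contra hcon
    push Not at hcon
    have := Finset.card_le_card hcon
    rw [card_of_mem hH] at this
    omega
  have hl := hτ.lam_ne hH hw
  have hlw : τ (A.dv H w) = A.lam H τ w := by rw [lam, if_pos hw]
  have hlv : τ (A.dv H v) = A.lam H τ v := by rw [lam, if_pos (hGH hv)]
  have hf := isFace_of_mem hH
  rw [wsum_X_mul_of_mem hP hv (y := A.dv H v - (A.lam H τ v / A.lam H τ w) • A.dv H w)]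
  · rw [map_sub, map_smul, hlw, hlv, smul_eq_mul, div_mul_cancel₀ _ hl, sub_self, zero_mul,
      Finset.sum_eq_zero, sub_zero]
    intro x hx
    rw [h x (Finset.mem_sdiff.1 hx).2 g hg, mul_zero]
  · rw [map_sub, map_smul, hf.dv_spec (hGH hv), hf.dv_spec (hGH hv), if_pos rfl,
      if_neg (by rintro rfl; exact hwG hv), smul_zero, sub_zero]
  · intro x hx hxv
    rw [map_sub, map_smul, hf.dv_spec (hGH hx), hf.dv_spec (hGH hx), if_neg hxv,
      if_neg (by rintro rfl; exact hwG hx), smul_zero, sub_zero]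

/-- The hard Lefschetz property of a face from the Hodge-Riemann property of its cofaces. -/
lemma HL_of_HR (hτ : A.Gen τ) (hG : A.IsFace G) {y : V} {j m : ℕ}
    (hd : G.card + 2 * j + m + 1 = Module.finrank ℝ V)
    (ih : ∀ v ∉ G, A.IsFace (insert v G) → ∀ y : V, ∀ m', m = m' + 1 →
      HR (A.wsum τ (insert v G) (A.pass τ (insert v G) (τ y))) (A.slack y) j m') :
    HL (A.wsum τ G (A.pass τ G (τ y))) (A.slack y) j m := by
  intro u hu huy z hz
  rcases m with _ | m
  · simpa using huy z (by simpa using hz)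
  by_cases ha : ∀ H ∈ A.above G, τ (A.pt H) ≤ τ y
  · rw [pass_eq_empty hτ ha, wsum_apply, Finset.sum_empty]
  by_cases hb : ∀ H ∈ A.above G, τ y ≤ τ (A.pt H)
  · rw [pass_eq_above hτ (by omega) hb]
    exact wsum_above_eq_zero hτ (by omega) (hu.mul hz)
  push Not at ha hb
  obtain ⟨H, hH, hHy⟩ := ha
  obtain ⟨K, hK, hKy⟩ := hb
  rw [mem_above] at hH hK
  obtain ⟨y0, hyin, hyt, hy0⟩ := hG.exists_between hH.1 hK.1 hH.2 hK.2 hHy hKy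
  have huy0 : ∀ x : MvPolynomial ι ℝ, x.IsHomogeneous j →
      A.wsum τ G (A.pass τ G (τ y0)) (A.slack y0 ^ (m + 1) * (u * x)) = 0 := by
    intro x hx
    rw [wsum_slack_pow_congr pass_subset_verts hy0, hy0, ← mul_assoc]
    exact huy x hx
  rw [← hy0]
  have hlt : ∀ v ∉ G, 0 < 1 - A.a v y0 := by
    intro v hv
    have h1 : A.a v y0 ≠ 1 := fun h => hv (hyt ▸ (mem_tight A).2 h)
    have h2 := lt_of_le_of_ne (hyin v) h1
    linarith
  have hX : ∀ v ∉ G, ∀ f, A.wsum τ G (A.pass τ G (τ y0)) (X v * f) =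
      A.wsum τ (insert v G) ((A.pass τ G (τ y0)).filter fun H => v ∈ H) f :=
    fun v hv f => wsum_X_mul hτ pass_subset_verts hv f
  have key : ∀ v ∉ G,
      0 ≤ (-1) ^ j * A.wsum τ (insert v G) ((A.pass τ G (τ y0)).filter fun H => v ∈ H)
        (A.slack y0 ^ m * u * u) ∧
      ((-1) ^ j * A.wsum τ (insert v G) ((A.pass τ G (τ y0)).filter fun H => v ∈ H)
        (A.slack y0 ^ m * u * u) = 0 → ∀ z : MvPolynomial ι ℝ, z.IsHomogeneous (j + m) →
        A.wsum τ (insert v G) ((A.pass τ G (τ y0)).filter fun H => v ∈ H) (u * z) = 0) := by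
    intro v hv
    by_cases hf : A.IsFace (insert v G)
    · refine link_step hτ hv (by omega) (ih v hv hf y0 m rfl) hu fun j' hj x hx => ?_
      rw [← hX v hv]
      have := huy0 (X v * x) (by
        have := (isHomogeneous_X ℝ v).mul hx
        rwa [add_comm, ← hj] at this)
      rw [← this]; congr 1; ring
    · have he : (A.pass τ G (τ y0)).filter (fun H => v ∈ H) = ∅ := by
        have h1 := above_eq_empty hf
        rw [above_insert] at h1
        exact Finset.subset_empty.1 (h1 ▸ Finset.filter_subset_filter _ pass_subset)
      simp [he, wsum_apply]
  have hsum := huy0 u hu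
  rw [pow_succ', mul_assoc, wsum_slack_mul fun v hv => (mem_tight A).1 (hyt.symm ▸ hv)] at hsum
  have hsum2 : ∑ v ∈ Finset.univ \ G, (1 - A.a v y0) * ((-1) ^ j *
      A.wsum τ (insert v G) ((A.pass τ G (τ y0)).filter fun H => v ∈ H)
        (A.slack y0 ^ m * u * u)) = 0 := by
    rw [← mul_zero ((-1 : ℝ) ^ j), ← hsum, Finset.mul_sum]
    refine Finset.sum_congr rfl fun v hv => ?_
    rw [hX v (Finset.mem_sdiff.1 hv).2, mul_assoc]
    ring
  rw [Finset.sum_eq_zero_iff_of_nonneg fun v hv => mul_nonneg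
    (hlt v (Finset.mem_sdiff.1 hv).2).le (key v (Finset.mem_sdiff.1 hv).2).1] at hsum2
  refine wsum_mul_eq_zero hτ hG (by omega) pass_subset_verts (k := j + m) (fun v hv x hx => ?_) hz
  rw [hX v hv]
  refine (key v hv).2 ?_ x hx
  have := hsum2 v (Finset.mem_sdiff.2 ⟨Finset.mem_univ v, hv⟩)
  exact (mul_eq_zero.1 this).resolve_left (hlt v hv).ne'

end Sys

lemma eventually_posIdx_add_sq {M α : Type*} [AddCommGroup M] [Module ℝ M] [FiniteDimensional ℝ M]
    {l : Filter α} {B B' : α → LinearMap.BilinForm ℝ M} {B₀ : LinearMap.BilinForm ℝ M}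
    (hs : ∀ t u v, B t u v = B t v u) (hs₀ : ∀ u v, B₀ u v = B₀ v u)
    (h : ∀ u v, Filter.Tendsto (fun t => B t u v) l (nhds (B₀ u v)))
    (φ : M →ₗ[ℝ] ℝ) {κ : α → ℝ} (hκ : ∀ᶠ t in l, 0 < κ t)
    (hB' : ∀ᶠ t in l, ∀ u v, B' t u v = B t u v + κ t * φ u * φ v) {N : Submodule ℝ M}
    (hN : ∀ t, N ≤ LinearMap.ker (B t)) (hN₀ : LinearMap.ker B₀ = N)
    (hN' : ∀ᶠ t in l, LinearMap.ker (B' t) = N ⊓ LinearMap.ker φ) {e : M} (he : e ∈ N)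
    (hφ : φ e ≠ 0) :
    ∀ᶠ t in l, posIdx (B' t) = posIdx B₀ + 1 ∧ posIdx (-(B' t)) = posIdx (-B₀) := by
  have hrank : ∀ᶠ t in l, posIdx (B' t) = posIdx (B t) + 1 ∧
      posIdx (-(B' t)) = posIdx (-(B t)) ∧
      LinearMap.ker (B' t) = LinearMap.ker (B t) ⊓ LinearMap.ker φ := by
    filter_upwards [hκ, hB'] with t h1 h2
    exact inertia_add_sq (hs t) φ h1 h2 (LinearMap.mem_ker.1 (hN t he)) hφ
  have hker : ∀ᶠ t in l, LinearMap.ker (B t) = N := by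
    filter_upwards [hrank, hN'] with t h1 h2
    refine le_antisymm (fun u hu => ?_) (hN t)
    have h3 : u - (φ u / φ e) • e ∈ LinearMap.ker (B t) ⊓ LinearMap.ker φ := by
      refine ⟨Submodule.sub_mem _ hu (Submodule.smul_mem _ _ (hN t he)), ?_⟩
      change φ _ = 0
      rw [map_sub, map_smul, smul_eq_mul, div_mul_cancel₀ _ hφ, sub_self]
    rw [← h1.2.2, h2] at h3
    have := Submodule.add_mem _ h3.1 (Submodule.smul_mem _ (φ u / φ e) he)
    simpa using this
  have h4 := eventually_posIdx_eq hs hs₀ h (hker.mono fun t ht => by rw [ht, hN₀])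
  filter_upwards [hrank, h4] with t h1 h2
  rw [h1.1, h1.2.1, h2.1, h2.2]
  exact ⟨rfl, rfl⟩

lemma ker_sign_smul {M : Type*} [AddCommGroup M] [Module ℝ M] {s : ℝ} (hs : s = 1 ∨ s = -1)
    (B : LinearMap.BilinForm ℝ M) : LinearMap.ker (s • B) = LinearMap.ker B :=
  LinearMap.ker_smul _ _ (by rcases hs with rfl | rfl <;> norm_num)

namespace Sys

variable {ι V : Type*} [Fintype ι] [DecidableEq ι] [AddCommGroup V] [Module ℝ V]
  [FiniteDimensional ℝ V] {A : Sys ι V} {τ : Module.Dual ℝ V} {G : Finset ι}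

/-- The form of a set of vertices at level `c`. -/
noncomputable def QP (A : Sys ι V) (τ : Module.Dual ℝ V) (G : Finset ι) (P : Finset (Finset ι))
    (y : V) (j m : ℕ) (c : ℝ) : LinearMap.BilinForm ℝ (homogeneousSubmodule ι ℝ j) :=
  Qf (A.wsum τ G P) (A.slack (c • y)) j m

lemma QP_symm {P : Finset (Finset ι)} {y : V} {j m : ℕ} {c : ℝ}
    (u v : homogeneousSubmodule ι ℝ j) :
    A.QP τ G P y j m c u v = A.QP τ G P y j m c v u := Qf_symm u v

lemma QP_apply {P : Finset (Finset ι)} (hP : P ⊆ A.verts) {y : V} (hy : τ y = 1) {j m : ℕ} {c : ℝ}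
    (u v : homogeneousSubmodule ι ℝ j) :
    A.QP τ G P y j m c u v = ∑ H ∈ P, A.gam G H τ * ((τ (A.pt H) - c) ^ m *
      (eval (A.lam H τ) (u : MvPolynomial ι ℝ) * eval (A.lam H τ) (v : MvPolynomial ι ℝ))) := by
  rw [QP, Qf_apply, mul_assoc, wsum_slack_pow_mul hP]
  simp [hy]

lemma QP_tendsto {P : Finset (Finset ι)} (hP : P ⊆ A.verts) {y : V} (hy : τ y = 1) {j m : ℕ}
    {c : ℝ} {l : Filter ℝ} (hl : l ≤ nhds c) (u v : homogeneousSubmodule ι ℝ j) :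
    Filter.Tendsto (fun t => A.QP τ G P y j m t u v) l (nhds (A.QP τ G P y j m c u v)) := by
  simp only [QP_apply hP hy]
  refine Filter.Tendsto.mono_left (Continuous.tendsto ?_ c) hl
  fun_prop

/-- Evaluation at a vertex. -/
noncomputable def evalAt (A : Sys ι V) (τ : Module.Dual ℝ V) (F : Finset ι) (j : ℕ) :
    homogeneousSubmodule ι ℝ j →ₗ[ℝ] ℝ :=
  (aeval (A.lam F τ)).toLinearMap.comp (Submodule.subtype _)

lemma evalAt_apply {F : Finset ι} {j : ℕ} (u : homogeneousSubmodule ι ℝ j) :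
    A.evalAt τ F j u = eval (A.lam F τ) (u : MvPolynomial ι ℝ) := by
  simp [evalAt, aeval_eq_eval]

lemma QP_insert {P : Finset (Finset ι)} {F : Finset ι} (hF : F ∉ P) (hFv : F ∈ A.verts)
    (hP : P ⊆ A.verts) {y : V} (hy : τ y = 1) {j m : ℕ} {c : ℝ}
    (u v : homogeneousSubmodule ι ℝ j) :
    A.QP τ G (insert F P) y j m c u v = A.QP τ G P y j m c u v +
      (A.gam G F τ * (τ (A.pt F) - c) ^ m) * A.evalAt τ F j u * A.evalAt τ F j v := by
  rw [QP_apply (Finset.insert_subset hFv hP) hy, QP_apply hP hy, Finset.sum_insert hF,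
    evalAt_apply, evalAt_apply]
  ring

lemma posIdx_eventually_eq {Pf : ℝ → Finset (Finset ι)} {y : V} (hy : τ y = 1)
    {j m : ℕ} (hHL : ∀ c, HL (A.wsum τ G (Pf c)) (A.slack (c • y)) j m) {c₀ : ℝ} {l : Filter ℝ}
    (hl : l ≤ nhds c₀) {P : Finset (Finset ι)} (hP : ∀ᶠ c in l, Pf c = P)
    (hPv : P ⊆ A.verts)
    (hN : Nul (A.wsum τ G P) j (j + m) = Nul (A.wsum τ G (Pf c₀)) j (j + m))
    (h0 : ∀ u v, A.QP τ G P y j m c₀ u v = A.QP τ G (Pf c₀) y j m c₀ u v) {s : ℝ}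
    (hs : s = 1 ∨ s = -1) :
    ∀ᶠ c in l, posIdx (s • A.QP τ G (Pf c) y j m c) = posIdx (s • A.QP τ G (Pf c₀) y j m c₀) := by
  have hk : ∀ c, LinearMap.ker (A.QP τ G (Pf c) y j m c) = Nul (A.wsum τ G (Pf c)) j (j + m) :=
    fun c => (hHL c).ker_eq (slack_homogeneous _)
  have h1 : ∀ u v, Filter.Tendsto (fun c => A.QP τ G (Pf c) y j m c u v) l
      (nhds (A.QP τ G (Pf c₀) y j m c₀ u v)) := by
    intro u v
    rw [← h0]
    refine (QP_tendsto hPv hy hl u v).congr' ?_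
    filter_upwards [hP] with c hc
    rw [hc]
  have h2 : ∀ᶠ c in l, Module.finrank ℝ (LinearMap.ker (s • A.QP τ G (Pf c) y j m c)) =
      Module.finrank ℝ (LinearMap.ker (s • A.QP τ G (Pf c₀) y j m c₀)) := by
    filter_upwards [hP] with c hc
    rw [ker_sign_smul hs, ker_sign_smul hs, hk, hk, hc, hN]
  refine (eventually_posIdx_eq (fun c u v => ?_) (fun u v => ?_) (fun u v => ?_) h2).mono
    fun c hc => hc.1
  · simp [QP_symm u v]
  · simp [QP_symm u v]
  · simpa using (h1 u v).const_mul s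

lemma posIdx_eventually_add {Pf : ℝ → Finset (Finset ι)} {y : V} (hy : τ y = 1)
    {j m : ℕ} (hHL : ∀ c, HL (A.wsum τ G (Pf c)) (A.slack (c • y)) j m) {c₀ : ℝ} {l : Filter ℝ}
    (hl : l ≤ nhds c₀) {P : Finset (Finset ι)} (hP : ∀ᶠ c in l, Pf c = P)
    (hPf : ∀ c, Pf c ⊆ A.verts) (φ : homogeneousSubmodule ι ℝ j →ₗ[ℝ] ℝ) {κ : ℝ → ℝ} {t : ℝ}
    (ht : t = 1 ∨ t = -1) (hκ : ∀ᶠ c in l, 0 < t * κ c)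
    (hadd : ∀ c u v, A.QP τ G P y j m c u v = A.QP τ G (Pf c₀) y j m c u v + κ c * φ u * φ v)
    (hN : Nul (A.wsum τ G P) j (j + m) = Nul (A.wsum τ G (Pf c₀)) j (j + m) ⊓ LinearMap.ker φ)
    {e : homogeneousSubmodule ι ℝ j} (he : e ∈ Nul (A.wsum τ G (Pf c₀)) j (j + m))
    (hφ : φ e ≠ 0) {s : ℝ} (hs : s = 1 ∨ s = -1) :
    ∀ᶠ c in l, (posIdx (s • A.QP τ G (Pf c) y j m c) : ℤ) =
      posIdx (s • A.QP τ G (Pf c₀) y j m c₀) + if t = s then 1 else 0 := by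
  have hk : ∀ c, LinearMap.ker (A.QP τ G (Pf c) y j m c) = Nul (A.wsum τ G (Pf c)) j (j + m) :=
    fun c => (hHL c).ker_eq (slack_homogeneous _)
  have h := eventually_posIdx_add_sq (l := l) (B := fun c => t • A.QP τ G (Pf c₀) y j m c)
    (B' := fun c => t • A.QP τ G (Pf c) y j m c) (B₀ := t • A.QP τ G (Pf c₀) y j m c₀)
    (fun c u v => by simp [QP_symm u v]) (fun u v => by simp [QP_symm u v])
    (fun u v => by simpa using (QP_tendsto (hPf c₀) hy hl u v).const_mul t)
    φ (κ := fun c => t * κ c) hκ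
    (by
      filter_upwards [hP] with c hc u v
      simp only [LinearMap.smul_apply, smul_eq_mul, hc, hadd]
      ring)
    (N := Nul (A.wsum τ G (Pf c₀)) j (j + m))
    (fun c => by rw [ker_sign_smul ht]; exact Nul_le_ker (slack_homogeneous _))
    (by rw [ker_sign_smul ht, hk])
    (by
      filter_upwards [hP] with c hc
      rw [ker_sign_smul ht, hk, ← hN, hc])
    he hφ
  filter_upwards [h] with c hc
  by_cases hts : t = s
  · rw [if_pos hts, ← hts, hc.1]; push_cast; rfl
  · have e : ∀ B : LinearMap.BilinForm ℝ (homogeneousSubmodule ι ℝ j), s • B = -(t • B) := by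
      intro B
      have : s = -t := by
        rcases hs with rfl | rfl <;> rcases ht with rfl | rfl <;> simp_all
      ext u v
      simp [this]
    rw [if_neg hts, e, e, hc.2, add_zero]

end Sys

lemma eventually_left {κ : Type*} (s : Finset κ) (f : κ → ℝ) (c₀ : ℝ) :
    ∀ᶠ c in nhdsWithin c₀ (Set.Iio c₀), ∀ H ∈ s, (c < f H ↔ c₀ ≤ f H) ∧ (c ≤ f H ↔ c₀ ≤ f H) := by
  rw [Filter.eventually_all_finset]
  intro H _
  by_cases h : c₀ ≤ f H
  · filter_upwards [self_mem_nhdsWithin] with c hc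
    have : c < c₀ := hc
    exact ⟨iff_of_true (by linarith) h, iff_of_true (by linarith) h⟩
  · push Not at h
    filter_upwards [Ioo_mem_nhdsLT h] with c hc
    exact ⟨iff_of_false (not_lt.2 hc.1.le) (not_le.2 h), iff_of_false (not_le.2 hc.1) (not_le.2 h)⟩

lemma eventually_right {κ : Type*} (s : Finset κ) (f : κ → ℝ) (c₀ : ℝ) :
    ∀ᶠ c in nhdsWithin c₀ (Set.Ioi c₀), ∀ H ∈ s, (c < f H ↔ c₀ < f H) ∧ (c ≤ f H ↔ c₀ < f H) := by
  rw [Filter.eventually_all_finset]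
  intro H _
  by_cases h : c₀ < f H
  · filter_upwards [Ioo_mem_nhdsGT h] with c hc
    exact ⟨iff_of_true hc.2 h, iff_of_true hc.2.le h⟩
  · push Not at h
    filter_upwards [self_mem_nhdsWithin] with c hc
    have : c₀ < c := hc
    exact ⟨iff_of_false (by linarith) (by linarith), iff_of_false (by linarith) (by linarith)⟩

namespace Sys

variable {ι V : Type*} [Fintype ι] [DecidableEq ι] [AddCommGroup V] [Module ℝ V]
  [FiniteDimensional ℝ V] {A : Sys ι V} {τ : Module.Dual ℝ V} {G : Finset ι}

lemma nonempty_of_above {F : Finset ι} (hF : F ∈ A.above G) (hd : 0 < Module.finrank ℝ V) :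
    F.Nonempty := by
  rw [← Finset.card_pos, card_of_mem (above_subset hF)]; exact hd

lemma Nul_ge_le (hτ : A.Gen τ) {F : Finset ι} (hF : F ∈ A.above G) (hd : 0 < Module.finrank ℝ V)
    {j m : ℕ} (h : (A.neg G F τ).card ≤ j + m) :
    Nul (A.wsum τ G (A.ge τ G (τ (A.pt F)))) j (j + m) ≤ LinearMap.ker (A.evalAt τ F j) := by
  intro u hu
  change A.evalAt τ F j u = 0
  rw [evalAt_apply]
  exact eval_eq_zero_of_ge hτ hF (nonempty_of_above hF hd) h hu

lemma Nul_gt_le (hτ : A.Gen τ) {F : Finset ι} (hF : F ∈ A.above G)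
    {j m : ℕ} (hd : G.card + 2 * j + m + 1 = Module.finrank ℝ V)
    (h : j + 1 ≤ (A.neg G F τ).card) :
    Nul (A.wsum τ G (A.gt τ G (τ (A.pt F)))) j (j + m) ≤ LinearMap.ker (A.evalAt τ F j) := by
  intro u hu
  change A.evalAt τ F j u = 0
  rw [evalAt_apply]
  exact eval_eq_zero_of_gt hτ hF (nonempty_of_above hF (by omega)) u.2 (k := j + m) (by omega)
    (by omega) hu

lemma Nul_inf (hτ : A.Gen τ) {F : Finset ι} (hF : F ∈ A.above G) {j m : ℕ} :
    Nul (A.wsum τ G (A.ge τ G (τ (A.pt F)))) j (j + m) ⊓ LinearMap.ker (A.evalAt τ F j) =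
    Nul (A.wsum τ G (A.gt τ G (τ (A.pt F)))) j (j + m) ⊓ LinearMap.ker (A.evalAt τ F j) := by
  ext u
  simp only [Submodule.mem_inf]
  refine and_congr_left fun hu => ?_
  rw [mem_Nul, mem_Nul]
  refine forall_congr' fun z => forall_congr' fun hz => ?_
  have h0 : eval (A.lam F τ) (u : MvPolynomial ι ℝ) = 0 := by
    rw [← evalAt_apply]; exact hu
  rw [ge_eq_insert hτ hF, wsum_insert notMem_gt, map_mul, h0, zero_mul, mul_zero, zero_add]

/-- The expected index of the form at level `c`. -/
noncomputable def cnt (A : Sys ι V) (τ : Module.Dual ℝ V) (G : Finset ι) (s : ℝ) (D j : ℕ)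
    (c : ℝ) : ℤ :=
  ∑ H ∈ A.above G,
    ((if c < τ (A.pt H) then
        (if (A.neg G H τ).card ≤ j ∧ (-1 : ℝ) ^ (A.neg G H τ).card = s then 1 else 0) else 0) -
      (if c ≤ τ (A.pt H) then
        (if D ≤ j + (A.neg G H τ).card ∧ (-1 : ℝ) ^ (D + (A.neg G H τ).card) = s then 1 else 0)
        else 0))

lemma cnt_left (s : ℝ) (D j : ℕ) (c₀ : ℝ) : ∀ᶠ c in nhdsWithin c₀ (Set.Iio c₀),
    A.cnt τ G s D j c = A.cnt τ G s D j c₀ + ∑ H ∈ A.above G, if τ (A.pt H) = c₀ then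
      (if (A.neg G H τ).card ≤ j ∧ (-1 : ℝ) ^ (A.neg G H τ).card = s then 1 else 0) else 0 := by
  filter_upwards [eventually_left (A.above G) (fun H => τ (A.pt H)) c₀] with c hc
  rw [cnt, cnt, ← Finset.sum_add_distrib]
  refine Finset.sum_congr rfl fun H hH => ?_
  simp only [(hc H hH).1, (hc H hH).2]
  rcases lt_trichotomy c₀ (τ (A.pt H)) with h | h | h
  · rw [if_pos h.le, if_pos h, if_pos h.le, if_neg h.ne', add_zero]
  · rw [if_pos h.le, if_pos h.le, if_neg h.not_lt, if_pos h.symm]; ring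
  · rw [if_neg h.not_ge, if_neg h.not_gt, if_neg h.not_ge, if_neg h.ne, add_zero]

lemma cnt_right (s : ℝ) (D j : ℕ) (c₀ : ℝ) : ∀ᶠ c in nhdsWithin c₀ (Set.Ioi c₀),
    A.cnt τ G s D j c = A.cnt τ G s D j c₀ + ∑ H ∈ A.above G, if τ (A.pt H) = c₀ then
      (if D ≤ j + (A.neg G H τ).card ∧ (-1 : ℝ) ^ (D + (A.neg G H τ).card) = s then 1 else 0)
        else 0 := by
  filter_upwards [eventually_right (A.above G) (fun H => τ (A.pt H)) c₀] with c hc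
  rw [cnt, cnt, ← Finset.sum_add_distrib]
  refine Finset.sum_congr rfl fun H hH => ?_
  simp only [(hc H hH).1, (hc H hH).2]
  rcases lt_trichotomy c₀ (τ (A.pt H)) with h | h | h
  · rw [if_pos h, if_pos h, if_pos h.le, if_neg h.ne', add_zero]
  · rw [if_neg h.not_lt, if_neg h.not_lt, if_pos h.le, if_pos h.symm]; ring
  · rw [if_neg h.not_gt, if_neg h.not_gt, if_neg h.not_ge, if_neg h.ne, add_zero]

lemma pass_left (c₀ : ℝ) : ∀ᶠ c in nhdsWithin c₀ (Set.Iio c₀), A.pass τ G c = A.ge τ G c₀ := by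
  filter_upwards [eventually_left (A.above G) (fun H => τ (A.pt H)) c₀] with c hc
  ext H
  rw [mem_pass, mem_ge]
  refine and_congr_right fun hH => ?_
  rw [← (hc H hH).1]
  refine ⟨?_, Or.inl⟩
  rintro (h | ⟨h, -⟩)
  · exact h
  · exact (hc H hH).1.2 ((hc H hH).2.1 h.le)

lemma pass_right (c₀ : ℝ) : ∀ᶠ c in nhdsWithin c₀ (Set.Ioi c₀), A.pass τ G c = A.gt τ G c₀ := by
  filter_upwards [eventually_right (A.above G) (fun H => τ (A.pt H)) c₀] with c hc
  ext H
  rw [mem_pass, mem_gt]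
  refine and_congr_right fun hH => ?_
  rw [← (hc H hH).1]
  refine ⟨?_, Or.inl⟩
  rintro (h | ⟨h, -⟩)
  · exact h
  · exact (hc H hH).1.2 ((hc H hH).2.1 h.le)

lemma sum_wall_eq (hτ : A.Gen τ) {F : Finset ι} (hF : F ∈ A.above G) (g : Finset ι → ℤ) :
    (∑ H ∈ A.above G, if τ (A.pt H) = τ (A.pt F) then g H else 0) = g F := by
  rw [Finset.sum_eq_single F, if_pos rfl]
  · intro H hH hne
    rw [if_neg fun h => hne (eq_of_level hτ hH hF h)]
  · intro h; exact absurd hF h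

lemma posIdx_left (hτ : A.Gen τ) {y : V} (hy : τ y = 1) {j m : ℕ}
    (hd : G.card + 2 * j + m + 1 = Module.finrank ℝ V)
    (hHL : ∀ c, HL (A.wsum τ G (A.pass τ G c)) (A.slack (c • y)) j m) {s : ℝ}
    (hs : s = 1 ∨ s = -1) (c₀ : ℝ) : ∀ᶠ c in nhdsWithin c₀ (Set.Iio c₀),
    (posIdx (s • A.QP τ G (A.pass τ G c) y j m c) : ℤ) =
      posIdx (s • A.QP τ G (A.pass τ G c₀) y j m c₀) +
      ∑ H ∈ A.above G, if τ (A.pt H) = c₀ then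
      (if (A.neg G H τ).card ≤ j ∧ (-1 : ℝ) ^ (A.neg G H τ).card = s then 1 else 0) else 0 := by
  have hp := pass_left (A := A) (τ := τ) (G := G) c₀
  have hge : A.ge τ G c₀ ⊆ A.verts := ge_subset.trans above_subset
  have same : A.pass τ G c₀ = A.ge τ G c₀ → ∀ᶠ c in nhdsWithin c₀ (Set.Iio c₀),
      posIdx (s • A.QP τ G (A.pass τ G c) y j m c) =
      posIdx (s • A.QP τ G (A.pass τ G c₀) y j m c₀) := fun h =>
    posIdx_eventually_eq hy hHL nhdsWithin_le_nhds hp hge (by rw [h]) (fun u v => by rw [h]) hs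
  by_cases hw : ∃ F ∈ A.above G, c₀ = τ (A.pt F)
  swap
  · push Not at hw
    filter_upwards [same (pass_eq_ge fun F hF h => absurd h (hw F hF))] with c hc
    rw [hc, Finset.sum_eq_zero fun H hH => if_neg fun h => hw H hH h.symm, add_zero]
  obtain ⟨F, hF, rfl⟩ := hw
  rw [sum_wall_eq hτ hF fun H => if (A.neg G H τ).card ≤ j ∧
    (-1 : ℝ) ^ (A.neg G H τ).card = s then (1 : ℤ) else 0]
  by_cases h1 : Module.finrank ℝ V < G.card + 2 * (A.neg G F τ).card
  · filter_upwards [same (pass_eq_ge fun F' hF' h => by rwa [← eq_of_level hτ hF hF' h])]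
      with c hc
    rw [hc, if_neg (by omega), add_zero]
  have h2 : A.pass τ G (τ (A.pt F)) = A.gt τ G (τ (A.pt F)) :=
    pass_eq_gt fun F' hF' h => by rw [← eq_of_level hτ hF hF' h]; omega
  have hFv := above_subset hF
  have hgt : A.gt τ G (τ (A.pt F)) ⊆ A.verts := gt_subset.trans above_subset
  have hadd : ∀ c u v, A.QP τ G (A.ge τ G (τ (A.pt F))) y j m c u v =
      A.QP τ G (A.pass τ G (τ (A.pt F))) y j m c u v +
      (A.gam G F τ * (τ (A.pt F) - c) ^ m) * A.evalAt τ F j u * A.evalAt τ F j v := by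
    intro c u v
    rw [h2, ge_eq_insert hτ hF, QP_insert notMem_gt hFv hgt hy]
  by_cases h3 : (A.neg G F τ).card ≤ j
  · obtain ⟨f, hf, hf0⟩ := exists_homogeneous_eval_ne hτ hFv
      (nonempty_of_above hF (by omega)) (j - (A.neg G F τ).card)
    have he : (xm (A.neg G F τ) * f).IsHomogeneous j := by
      have := (xm_homogeneous (A.neg G F τ)).mul hf
      rwa [Nat.add_sub_cancel' h3] at this
    have hN1 := Nul_ge_le hτ hF (by omega) (show (A.neg G F τ).card ≤ j + m by omega)
    have := posIdx_eventually_add hy hHL nhdsWithin_le_nhds hp (fun c => pass_subset_verts)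
      (A.evalAt τ F j) (t := (-1) ^ (A.neg G F τ).card) (neg_one_pow_eq_or ℝ _) (by
        filter_upwards [self_mem_nhdsWithin] with c hc
        have h4 := gam_sign (G := G) hτ hFv
        have h5 : 0 < (τ (A.pt F) - c) ^ m := pow_pos (sub_pos.2 hc) m
        have := mul_pos h4 h5
        rwa [mul_assoc] at this) hadd
      (by rw [h2, ← Nul_inf hτ hF, inf_eq_left.2 hN1]) (e := ⟨_, he⟩)
      (by
        rw [h2]
        intro z _
        rw [mul_assoc]
        exact wsum_gt_xm_neg hτ hF _)
      (by
        rw [evalAt_apply, map_mul]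
        exact mul_ne_zero (eval_xm_ne_zero hτ hFv
          ((Finset.filter_subset _ _).trans Finset.sdiff_subset)) hf0) hs
    filter_upwards [this] with c hc
    rw [hc]
    simp only [h3, true_and]
  · have hN1 := Nul_ge_le hτ hF (by omega) (show (A.neg G F τ).card ≤ j + m by omega)
    have hN2 := Nul_gt_le hτ hF hd (by omega)
    have := posIdx_eventually_eq hy hHL nhdsWithin_le_nhds hp hge
      (by rw [h2, ← inf_eq_left.2 hN1, Nul_inf hτ hF, inf_eq_left.2 hN2])
      (fun u v => by rw [hadd, sub_self, zero_pow (by omega)]; ring) hs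
    filter_upwards [this] with c hc
    rw [hc, if_neg (fun h => h3 h.1), add_zero]

lemma posIdx_right (hτ : A.Gen τ) {y : V} (hy : τ y = 1) {j m D : ℕ}
    (hd : G.card + D = Module.finrank ℝ V) (hD : D = 2 * j + m + 1)
    (hHL : ∀ c, HL (A.wsum τ G (A.pass τ G c)) (A.slack (c • y)) j m) {s : ℝ}
    (hs : s = 1 ∨ s = -1) (c₀ : ℝ) : ∀ᶠ c in nhdsWithin c₀ (Set.Ioi c₀),
    (posIdx (s • A.QP τ G (A.pass τ G c) y j m c) : ℤ) =
      posIdx (s • A.QP τ G (A.pass τ G c₀) y j m c₀) +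
      ∑ H ∈ A.above G, if τ (A.pt H) = c₀ then
      (if D ≤ j + (A.neg G H τ).card ∧ (-1 : ℝ) ^ (D + (A.neg G H τ).card) = s then 1 else 0)
        else 0 := by
  have hp := pass_right (A := A) (τ := τ) (G := G) c₀
  have hgt : A.gt τ G c₀ ⊆ A.verts := gt_subset.trans above_subset
  have same : A.pass τ G c₀ = A.gt τ G c₀ → ∀ᶠ c in nhdsWithin c₀ (Set.Ioi c₀),
      posIdx (s • A.QP τ G (A.pass τ G c) y j m c) =
      posIdx (s • A.QP τ G (A.pass τ G c₀) y j m c₀) := fun h =>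
    posIdx_eventually_eq hy hHL nhdsWithin_le_nhds hp hgt (by rw [h]) (fun u v => by rw [h]) hs
  by_cases hw : ∃ F ∈ A.above G, c₀ = τ (A.pt F)
  swap
  · push Not at hw
    filter_upwards [same (pass_eq_gt fun F hF h => absurd h (hw F hF))] with c hc
    rw [hc, Finset.sum_eq_zero fun H hH => if_neg fun h => hw H hH h.symm, add_zero]
  obtain ⟨F, hF, rfl⟩ := hw
  rw [sum_wall_eq hτ hF fun H => if D ≤ j + (A.neg G H τ).card ∧
    (-1 : ℝ) ^ (D + (A.neg G H τ).card) = s then (1 : ℤ) else 0]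
  by_cases h1 : G.card + 2 * (A.neg G F τ).card ≤ Module.finrank ℝ V
  · filter_upwards [same (pass_eq_gt fun F' hF' h => by rwa [← eq_of_level hτ hF hF' h])]
      with c hc
    rw [hc, if_neg (by omega), add_zero]
  have h2 : A.pass τ G (τ (A.pt F)) = A.ge τ G (τ (A.pt F)) :=
    pass_eq_ge fun F' hF' h => by rw [← eq_of_level hτ hF hF' h]; omega
  have hFv := above_subset hF
  have hadd : ∀ c u v, A.QP τ G (A.gt τ G (τ (A.pt F))) y j m c u v =
      A.QP τ G (A.pass τ G (τ (A.pt F))) y j m c u v +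
      (-(A.gam G F τ * (τ (A.pt F) - c) ^ m)) * A.evalAt τ F j u * A.evalAt τ F j v := by
    intro c u v
    rw [h2, ge_eq_insert hτ hF, QP_insert notMem_gt hFv hgt hy]
    ring
  have hN2 := Nul_gt_le hτ hF (j := j) (m := m) (by omega) (by omega)
  by_cases h3 : D ≤ j + (A.neg G F τ).card
  · have hns : A.neg G F τ ⊆ F \ G := Finset.filter_subset _ _
    have hJ : ((F \ G) \ A.neg G F τ).card + (A.neg G F τ).card = D := by
      have h4 := Finset.card_sdiff_add_card_eq_card hns
      have h5 := Finset.card_sdiff_add_card_eq_card (mem_above.1 hF).2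
      rw [card_of_mem hFv] at h5
      omega
    obtain ⟨f, hf, hf0⟩ := exists_homogeneous_eval_ne hτ hFv
      (nonempty_of_above hF (by omega)) (j - ((F \ G) \ A.neg G F τ).card)
    have he : (xm ((F \ G) \ A.neg G F τ) * f).IsHomogeneous j := by
      have := (xm_homogeneous ((F \ G) \ A.neg G F τ)).mul hf
      rwa [Nat.add_sub_cancel' (by omega)] at this
    have := posIdx_eventually_add hy hHL nhdsWithin_le_nhds hp (fun c => pass_subset_verts)
      (A.evalAt τ F j) (t := (-1) ^ (D + (A.neg G F τ).card)) (neg_one_pow_eq_or ℝ _) (by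
        filter_upwards [self_mem_nhdsWithin] with c hc
        have h4 := gam_sign (G := G) hτ hFv
        have h5 : 0 < (c - τ (A.pt F)) ^ m := pow_pos (sub_pos.2 hc) m
        have h6 := mul_pos h4 h5
        have h7 : (-1 : ℝ) ^ (D + (A.neg G F τ).card) * -(A.gam G F τ * (τ (A.pt F) - c) ^ m) =
            (-1) ^ (A.neg G F τ).card * A.gam G F τ * (c - τ (A.pt F)) ^ m := by
          rw [show τ (A.pt F) - c = (-1) * (c - τ (A.pt F)) by ring, mul_pow, pow_add, hD,
            show 2 * j + m + 1 = m + (2 * j + 1) by ring, pow_add]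
          have h8 : (-1 : ℝ) ^ (2 * j + 1) = -1 := by rw [pow_succ, pow_mul]; norm_num
          have h9 : (-1 : ℝ) ^ m * (-1) ^ m = 1 := by rw [← mul_pow]; norm_num
          rw [h8]
          linear_combination (A.gam G F τ * (c - τ (A.pt F)) ^ m * (-1) ^ (A.neg G F τ).card) * h9
        rwa [h7]) hadd
      (by rw [h2, Nul_inf hτ hF, inf_eq_left.2 hN2]) (e := ⟨_, he⟩)
      (by
        rw [h2]
        intro z hz
        rw [mul_assoc]
        exact wsum_ge_xm_pos hτ hF (hf.mul hz) (by omega))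
      (by
        rw [evalAt_apply, map_mul]
        exact mul_ne_zero (eval_xm_ne_zero hτ hFv
          (Finset.sdiff_subset.trans Finset.sdiff_subset)) hf0) hs
    filter_upwards [this] with c hc
    rw [hc]
    simp only [h3, true_and]
  · have hN1 := Nul_ge_le hτ hF (by omega) (show (A.neg G F τ).card ≤ j + m by omega)
    have := posIdx_eventually_eq hy hHL nhdsWithin_le_nhds hp hgt
      (by rw [h2, ← inf_eq_left.2 hN1, Nul_inf hτ hF, inf_eq_left.2 hN2])
      (fun u v => by rw [hadd, sub_self, zero_pow (by omega)]; ring) hs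
    filter_upwards [this] with c hc
    rw [hc, if_neg (fun h => h3 h.1), add_zero]

end Sys

lemma neg_smul_form {M : Type*} [AddCommGroup M] [Module ℝ M] (c : ℝ)
    (B : LinearMap.BilinForm ℝ M) : -(c • B) = (-c) • B := by
  ext u v
  simp

namespace Sys

variable {ι V : Type*} [Fintype ι] [DecidableEq ι] [AddCommGroup V] [Module ℝ V]
  [FiniteDimensional ℝ V] {A : Sys ι V} {τ : Module.Dual ℝ V} {G : Finset ι}

lemma posIdx_eq_cnt (hτ : A.Gen τ) {y : V} (hy : τ y = 1) {j m D : ℕ}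
    (hd : G.card + D = Module.finrank ℝ V) (hD : D = 2 * j + m + 1)
    (hHL : ∀ c, HL (A.wsum τ G (A.pass τ G c)) (A.slack (c • y)) j m) {s : ℝ}
    (hs : s = 1 ∨ s = -1) (c : ℝ) :
    (posIdx (s • A.QP τ G (A.pass τ G c) y j m c) : ℤ) = A.cnt τ G s D j c := by
  let f : ℝ → ℤ := fun c => posIdx (s • A.QP τ G (A.pass τ G c) y j m c) - A.cnt τ G s D j c
  have hf : IsLocallyConstant f := by
    rw [IsLocallyConstant.iff_eventually_eq]
    intro c₀
    have hl : ∀ᶠ c in nhdsWithin c₀ (Set.Iio c₀), f c = f c₀ := by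
      filter_upwards [posIdx_left hτ hy (by omega) hHL hs c₀, cnt_left (A := A) (τ := τ) (G := G)
        s D j c₀] with c h1 h2
      simp only [f, h1, h2]
      ring
    have hr : ∀ᶠ c in nhdsWithin c₀ (Set.Ioi c₀), f c = f c₀ := by
      filter_upwards [posIdx_right hτ hy hd hD hHL hs c₀, cnt_right (A := A) (τ := τ) (G := G)
        s D j c₀] with c h1 h2
      simp only [f, h1, h2]
      ring
    rw [← nhdsNE_sup_pure, ← nhdsLT_sup_nhdsGT]
    exact Filter.eventually_sup.2 ⟨Filter.eventually_sup.2 ⟨hl, hr⟩, rfl⟩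
  obtain ⟨M, hM⟩ := ((A.above G).image fun H => τ (A.pt H)).bddAbove
  have hM' : ∀ H ∈ A.above G, τ (A.pt H) ≤ M := fun H hH =>
    hM (Finset.mem_coe.2 (Finset.mem_image_of_mem _ hH))
  have h0 : f (M + 1) = 0 := by
    have h1 : A.pass τ G (M + 1) = ∅ := pass_eq_empty hτ fun H hH => by
      have := hM' H hH; linarith
    have h2 : s • A.QP τ G (A.pass τ G (M + 1)) y j m (M + 1) = 0 := by
      ext u v
      simp [h1, QP_apply (A := A) (G := G) (P := ∅) (by simp) hy]
    have h3 : A.cnt τ G s D j (M + 1) = 0 := by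
      refine Finset.sum_eq_zero fun H hH => ?_
      have := hM' H hH
      rw [if_neg (by linarith), if_neg (by linarith), sub_zero]
    simp only [f, h2, h3, posIdx_zero, Nat.cast_zero, sub_zero]
  have := hf.apply_eq_of_preconnectedSpace c (M + 1)
  rw [h0] at this
  exact sub_eq_zero.1 this

lemma cnt_succ {D j m : ℕ} (hD : D = 2 * (j + 1) + m + 1) (c : ℝ) :
    A.cnt τ G (-(-1) ^ (j + 1)) D (j + 1) c = A.cnt τ G (-(-1) ^ (j + 1)) D j c := by
  refine Finset.sum_congr rfl fun H _ => ?_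
  have h1 : ((A.neg G H τ).card ≤ j + 1 ∧ (-1 : ℝ) ^ (A.neg G H τ).card = -(-1) ^ (j + 1)) ↔
      ((A.neg G H τ).card ≤ j ∧ (-1 : ℝ) ^ (A.neg G H τ).card = -(-1) ^ (j + 1)) := by
    refine and_congr_left fun h => ⟨fun h' => ?_, fun h' => by omega⟩
    by_contra hc
    rw [show (A.neg G H τ).card = j + 1 by omega] at h
    rcases neg_one_pow_eq_or ℝ (j + 1) with h2 | h2 <;> rw [h2] at h <;> norm_num at h
  have h2 : (D ≤ j + 1 + (A.neg G H τ).card ∧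
      (-1 : ℝ) ^ (D + (A.neg G H τ).card) = -(-1) ^ (j + 1)) ↔
      (D ≤ j + (A.neg G H τ).card ∧
      (-1 : ℝ) ^ (D + (A.neg G H τ).card) = -(-1) ^ (j + 1)) := by
    refine and_congr_left fun h => ⟨fun h' => ?_, fun h' => by omega⟩
    by_contra hc
    rw [show D + (A.neg G H τ).card = 2 * (A.neg G H τ).card + (j + 1) by omega, pow_add,
      pow_mul] at h
    rcases neg_one_pow_eq_or ℝ (j + 1) with h2 | h2 <;> rw [h2] at h <;> norm_num at h
  simp only [h1, h2]

lemma cnt_zero {D m : ℕ} (hD : D = m + 1) (hc : G.card + D = Module.finrank ℝ V) (c : ℝ) :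
    A.cnt τ G (-1) D 0 c = 0 := by
  refine Finset.sum_eq_zero fun H hH => ?_
  rw [if_neg (c := _ ∧ _), if_neg (c := _ ∧ _)]
  · simp
  · rintro ⟨h1, h2⟩
    have h3 : (A.neg G H τ).card ≤ (H \ G).card := Finset.card_filter_le _ _
    have h4 := Finset.card_sdiff_add_card_eq_card (mem_above.1 hH).2
    rw [card_of_mem (above_subset hH)] at h4
    rw [show D + (A.neg G H τ).card = 2 * D by omega, pow_mul] at h2
    norm_num at h2
  · rintro ⟨h1, h2⟩
    rw [show (A.neg G H τ).card = 0 by omega] at h2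
    norm_num at h2

lemma exists_apply_eq_one (hτ : A.Gen τ) (hG : A.IsFace G) (hd : 0 < Module.finrank ℝ V) :
    ∃ y, τ y = 1 := by
  obtain ⟨H, hH, -⟩ := hG.exists_vert
  obtain ⟨w, hw⟩ : H.Nonempty := by rw [← Finset.card_pos, card_of_mem hH]; exact hd
  have h := hτ.lam_ne hH hw
  rw [lam, if_pos hw] at h
  exact ⟨(τ (A.dv H w))⁻¹ • A.dv H w, by rw [map_smul, smul_eq_mul, inv_mul_cancel₀ h]⟩

lemma Qf_pass_eq_QP {y y₁ : V} (hy : τ y₁ = 1) (j m : ℕ) :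
    Qf (A.wsum τ G (A.pass τ G (τ y))) (A.slack y) j m =
      A.QP τ G (A.pass τ G (τ y)) y₁ j m (τ y) := by
  ext u v
  rw [QP, Qf_apply, Qf_apply, mul_assoc, mul_assoc]
  exact wsum_slack_pow_congr pass_subset_verts (by rw [map_smul, hy, smul_eq_mul, mul_one]) _ _

/-- The Hodge-Riemann property from the hard Lefschetz property in all levels. -/
lemma HR_of_HL (hτ : A.Gen τ) (hG : A.IsFace G) {j m : ℕ}
    (hd : G.card + 2 * j + m + 1 = Module.finrank ℝ V)
    (hHL : ∀ y, HL (A.wsum τ G (A.pass τ G (τ y))) (A.slack y) j m)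
    (hHL' : ∀ j', j = j' + 1 → ∀ y,
      HL (A.wsum τ G (A.pass τ G (τ y))) (A.slack y) j' (m + 2)) (y : V) :
    HR (A.wsum τ G (A.pass τ G (τ y))) (A.slack y) j m := by
  obtain ⟨y₁, hy₁⟩ := exists_apply_eq_one hτ hG (by omega)
  have hc : ∀ c : ℝ, τ (c • y₁) = c := fun c => by rw [map_smul, hy₁, smul_eq_mul, mul_one]
  have hs : (-(-1 : ℝ) ^ j = 1 ∨ -(-1 : ℝ) ^ j = -1) := by
    rcases neg_one_pow_eq_or ℝ j with h | h <;> simp [h]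
  have h1 := posIdx_eq_cnt (G := G) hτ hy₁ (j := j) (m := m) (D := 2 * j + m + 1) (by omega) rfl
    (fun c => by simpa only [hc] using hHL (c • y₁)) hs (τ y)
  refine HR_of_posIdx_le (A.slack_homogeneous y) (hHL y) ?_ ?_
  · rintro rfl
    rw [Qf_pass_eq_QP hy₁, neg_smul_form]
    rw [pow_zero, cnt_zero (m := m) (by omega) (by omega)] at h1
    rw [pow_zero]
    exact_mod_cast h1
  · rintro j' rfl
    have h2 := posIdx_eq_cnt (G := G) hτ hy₁ (j := j') (m := m + 2) (D := 2 * (j' + 1) + m + 1) (by omega)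
      (by ring) (fun c => by simpa only [hc] using hHL' j' rfl (c • y₁)) hs (τ y)
    rw [Qf_pass_eq_QP hy₁, Qf_pass_eq_QP hy₁, neg_smul_form, neg_smul_form]
    rw [cnt_succ (m := m) rfl, ← h2] at h1
    exact le_of_eq (by exact_mod_cast h1)

theorem HL_HR (hτ : A.Gen τ) (n : ℕ) : ∀ (G : Finset ι) (j m : ℕ), A.IsFace G →
    G.card + n + 1 = Module.finrank ℝ V → n = 2 * j + m → ∀ y : V,
    HL (A.wsum τ G (A.pass τ G (τ y))) (A.slack y) j m ∧
    HR (A.wsum τ G (A.pass τ G (τ y))) (A.slack y) j m := by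
  induction n with
  | zero =>
    intro G j m hG hd hn
    have hHL : ∀ y, HL (A.wsum τ G (A.pass τ G (τ y))) (A.slack y) j m := fun y =>
      HL_of_HR hτ hG (by omega) fun v _ _ y m' hm => by omega
    exact fun y => ⟨hHL y, HR_of_HL hτ hG (by omega) hHL (fun j' hj => by omega) y⟩
  | succ n ih =>
    have hHL : ∀ (G : Finset ι) (j m : ℕ), A.IsFace G →
        G.card + (n + 1) + 1 = Module.finrank ℝ V → n + 1 = 2 * j + m → ∀ y : V,
        HL (A.wsum τ G (A.pass τ G (τ y))) (A.slack y) j m := by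
      intro G j m hG hd hn y
      refine HL_of_HR hτ hG (by omega) fun v hv hvG y m' hm => ?_
      exact (ih (insert v G) j m' hvG (by rw [Finset.card_insert_of_notMem hv]; omega)
        (by omega) y).2
    intro G j m hG hd hn y
    exact ⟨hHL G j m hG hd hn y, HR_of_HL hτ hG (by omega) (hHL G j m hG hd hn)
      (fun j' hj => hHL G j' (m + 2) hG hd (by omega)) y⟩

end Sys

lemma card_between {κ : Type*} [Fintype κ] [DecidableEq κ] {S H : Finset κ} (hS : S ⊆ H) (m : ℕ) :
    (Finset.univ.filter fun F : Finset κ => S ⊆ F ∧ F ⊆ H ∧ F.card = S.card + m).card =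
      (H.card - S.card).choose m := by
  rw [← Finset.card_sdiff_of_subset hS, ← Finset.card_powersetCard]
  refine Finset.card_bij' (fun F _ => F \ S) (fun T _ => S ∪ T) ?_ ?_ ?_ ?_
  · intro F hF
    obtain ⟨h1, h2, h3⟩ := (Finset.mem_filter.1 hF).2
    rw [Finset.mem_powersetCard]
    refine ⟨Finset.sdiff_subset_sdiff h2 le_rfl, ?_⟩
    rw [Finset.card_sdiff_of_subset h1]
    omega
  · intro T hT
    obtain ⟨h1, h2⟩ := Finset.mem_powersetCard.1 hT
    rw [Finset.subset_sdiff] at h1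
    exact Finset.mem_filter.2 ⟨Finset.mem_univ _, Finset.subset_union_left,
      Finset.union_subset hS h1.1, by rw [Finset.card_union_of_disjoint h1.2.symm, h2]⟩
  · intro F hF
    exact Finset.union_sdiff_of_subset (Finset.mem_filter.1 hF).2.1
  · intro T hT
    have h1 := (Finset.subset_sdiff.1 (Finset.mem_powersetCard.1 hT).1).2
    rw [Finset.union_sdiff_cancel_left h1.symm]

namespace Sys

variable {ι V : Type*} [Fintype ι] [DecidableEq ι] [AddCommGroup V] [Module ℝ V]
  [FiniteDimensional ℝ V] {A : Sys ι V} {τ : Module.Dual ℝ V} {G H : Finset ι}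

/-- The number of facets above `G` of index `i`. -/
noncomputable def idx (A : Sys ι V) (τ : Module.Dual ℝ V) (G : Finset ι) (i : ℕ) : ℕ :=
  ((A.above G).filter fun H => (A.neg G H τ).card = i).card

open Classical in
/-- The faces above `G` with `k` additional elements. -/
noncomputable def faces (A : Sys ι V) (G : Finset ι) (k : ℕ) : Finset (Finset ι) :=
  Finset.univ.filter fun F => A.IsFace F ∧ G ⊆ F ∧ F.card = G.card + k

lemma mem_faces {k : ℕ} {F : Finset ι} :
    F ∈ A.faces G k ↔ A.IsFace F ∧ G ⊆ F ∧ F.card = G.card + k := by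
  simp [faces]

lemma eq_of_neg_subset (hτ : A.Gen τ) {F H K : Finset ι} (hH : H ∈ A.verts) (hK : K ∈ A.verts)
    (hFH : F ⊆ H) (hFK : F ⊆ K) (h1 : A.neg G H τ ⊆ F) (h2 : A.neg G K τ ⊆ F) (hG : G ⊆ F) :
    H = K := by
  have key : ∀ {H K : Finset ι}, H ∈ A.verts → K ∈ A.verts → F ⊆ K → A.neg G H τ ⊆ F →
      τ (A.pt K) ≤ τ (A.pt H) := by
    intro H K hH hK hFK h1
    refine (vert_le_of_lam_pos hH hK fun w hw hwK => ?_).1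
    have h3 : w ∉ A.neg G H τ := fun h => hwK (hFK (h1 h))
    rw [mem_neg] at h3
    push Not at h3
    exact lt_of_le_of_ne (h3 hw fun h => hwK (hFK (hG h))) (hτ.lam_ne hH hw).symm
  exact hτ.2 H hH K hK (le_antisymm (key hK hH hFH h2) (key hH hK hFK h1))

lemma neg_subset : A.neg G H τ ⊆ H \ G := Finset.filter_subset _ _

lemma disjoint_neg : Disjoint G (A.neg G H τ) :=
  Finset.disjoint_of_subset_right neg_subset Finset.disjoint_sdiff

lemma card_faces_eq_sum (hτ : A.Gen τ) (k : ℕ) : (A.faces G k).card = ∑ H ∈ A.above G,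
    if (A.neg G H τ).card ≤ k then
      (Module.finrank ℝ V - G.card - (A.neg G H τ).card).choose (k - (A.neg G H τ).card) else 0 := by
  have h1 : A.faces G k = (A.above G).biUnion fun H => Finset.univ.filter fun F =>
      G ∪ A.neg G H τ ⊆ F ∧ F ⊆ H ∧ F.card = G.card + k := by
    ext F
    simp only [mem_faces, Finset.mem_biUnion, Finset.mem_filter, Finset.mem_univ, true_and,
      mem_above]
    constructor
    · rintro ⟨hF, hG, hc⟩
      obtain ⟨H, hH, hFH, hp⟩ := exists_max hτ hF
      refine ⟨H, ⟨hH, hG.trans hFH⟩, Finset.union_subset hG fun w hw => ?_, hFH, hc⟩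
      by_contra hwF
      rw [mem_neg] at hw
      exact absurd (hp w hw.1 hwF) (not_lt.2 hw.2.2.le)
    · rintro ⟨H, ⟨hH, hGH⟩, h1, h2, h3⟩
      exact ⟨(isFace_of_mem hH).subset h2, Finset.subset_union_left.trans h1, h3⟩
  rw [h1, Finset.card_biUnion]
  · refine Finset.sum_congr rfl fun H hH => ?_
    obtain ⟨hH, hGH⟩ := mem_above.1 hH
    have hc : (G ∪ A.neg G H τ).card = G.card + (A.neg G H τ).card :=
      Finset.card_union_of_disjoint disjoint_neg
    split_ifs with h
    · have := card_between (S := G ∪ A.neg G H τ) (H := H)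
        (Finset.union_subset hGH (neg_subset.trans Finset.sdiff_subset)) (k - (A.neg G H τ).card)
      rw [hc, card_of_mem hH, ← Nat.sub_sub] at this
      rw [← this]
      congr 1
      ext F
      simp only [Finset.mem_filter, Finset.mem_univ, true_and]
      rw [show G.card + (A.neg G H τ).card + (k - (A.neg G H τ).card) = G.card + k by omega]
    · rw [Finset.card_eq_zero, Finset.filter_eq_empty_iff]
      rintro F - ⟨h3, -, h5⟩
      have := Finset.card_le_card h3
      omega
  · intro H hH K hK hne
    rw [Function.onFun, Finset.disjoint_left]
    intro F hF hF'
    simp only [Finset.mem_filter, Finset.mem_univ, true_and] at hF hF'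
    have h2 := Finset.union_subset_iff.1 hF.1
    exact hne (eq_of_neg_subset hτ (mem_above.1 hH).1 (mem_above.1 hK).1 hF.2.1 hF'.2.1 h2.2
      (Finset.union_subset_iff.1 hF'.1).2 h2.1)

lemma card_faces (hτ : A.Gen τ) (k : ℕ) : (A.faces G k).card = ∑ i ∈ Finset.range (k + 1),
    A.idx τ G i * (Module.finrank ℝ V - G.card - i).choose (k - i) := by
  rw [card_faces_eq_sum hτ, ← Finset.sum_filter]
  rw [← Finset.sum_fiberwise_of_maps_to (t := Finset.range (k + 1))
    (g := fun H => (A.neg G H τ).card) (by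
      intro H hH
      have := (Finset.mem_filter.1 hH).2
      simp only [Finset.mem_range]; omega)]
  refine Finset.sum_congr rfl fun i hi => ?_
  rw [Finset.sum_congr rfl (g := fun _ => (Module.finrank ℝ V - G.card - i).choose (k - i))
    (fun H hH => by rw [(Finset.mem_filter.1 hH).2])]
  rw [Finset.sum_const, smul_eq_mul, idx, Finset.filter_filter]
  congr 2
  ext H
  simp only [Finset.mem_filter]
  have := Finset.mem_range.1 hi
  refine and_congr_right fun _ => ⟨fun h => h.2, fun h => ⟨by omega, h⟩⟩

lemma idx_eq {τ' : Module.Dual ℝ V} (hτ : A.Gen τ) (hτ' : A.Gen τ') (i : ℕ) :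
    A.idx τ G i = A.idx τ' G i := by
  induction i using Nat.strong_induction_on with
  | _ i ih =>
    have h := (card_faces (G := G) hτ i).symm.trans (card_faces hτ' i)
    rw [Finset.sum_range_succ, Finset.sum_range_succ, Finset.sum_congr rfl
      (fun k hk => by rw [ih k (Finset.mem_range.1 hk)])] at h
    simpa using h

lemma neg_card_add (hτ : A.Gen τ) {H : Finset ι} (hH : H ∈ A.above G) :
    (A.neg G H τ).card + (A.neg G H (-τ)).card + G.card = Module.finrank ℝ V := by
  obtain ⟨hH, hGH⟩ := mem_above.1 hH
  have h1 : A.neg G H (-τ) = (H \ G) \ A.neg G H τ := by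
    ext w
    simp only [mem_neg, Finset.mem_sdiff, lam_neg, neg_neg_iff_pos]
    constructor
    · rintro ⟨h1, h2, h3⟩
      exact ⟨⟨h1, h2⟩, fun h => absurd h.2.2 (not_lt.2 h3.le)⟩
    · rintro ⟨⟨h1, h2⟩, h3⟩
      refine ⟨h1, h2, lt_of_le_of_ne ?_ (hτ.lam_ne hH h1).symm⟩
      by_contra h
      exact h3 ⟨h1, h2, not_le.1 h⟩
  have h2 := Finset.card_sdiff_add_card_eq_card (neg_subset (A := A) (G := G) (H := H) (τ := τ))
  have h3 := Finset.card_sdiff_add_card_eq_card hGH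
  rw [card_of_mem hH] at h3
  rw [h1]
  omega

end Sys

namespace Sys

variable {ι V : Type*} [Fintype ι] [DecidableEq ι] [AddCommGroup V] [Module ℝ V]
  [FiniteDimensional ℝ V] {A : Sys ι V} {τ : Module.Dual ℝ V} {G : Finset ι}

lemma card_neg_lt (hτ : A.Gen τ) {τ' : Module.Dual ℝ V} (hτ' : A.Gen τ') (j : ℕ) :
    ((A.above G).filter fun H => (A.neg G H τ).card < j).card =
    ((A.above G).filter fun H => (A.neg G H τ').card < j).card := by
  have key : ∀ σ : Module.Dual ℝ V,
      ((A.above G).filter fun H => (A.neg G H σ).card < j).card =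
      ∑ i ∈ Finset.range j, A.idx σ G i := by
    intro σ
    rw [Finset.card_eq_sum_card_fiberwise (f := fun H => (A.neg G H σ).card)
      (t := Finset.range j) (by
        intro H hH
        have := (Finset.mem_filter.1 hH).2
        simpa using this)]
    refine Finset.sum_congr rfl fun i hi => ?_
    rw [idx, Finset.filter_filter]
    congr 1
    refine Finset.filter_congr fun H _ => ?_
    have := Finset.mem_range.1 hi
    exact ⟨fun h => h.2, fun h => ⟨by omega, h⟩⟩
  rw [key, key, Finset.sum_congr rfl fun i _ => idx_eq hτ hτ' i]

lemma sum_index (hτ : A.Gen τ) {n j : ℕ} (hn : G.card + n = Module.finrank ℝ V) :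
    (∑ H ∈ A.above G, ((if (A.neg G H τ).card ≤ j then (1 : ℤ) else 0) -
      if n + 1 ≤ j + (A.neg G H τ).card then 1 else 0)) = A.idx τ G j := by
  rw [Finset.sum_sub_distrib]
  have h1 : (∑ H ∈ A.above G, if n + 1 ≤ j + (A.neg G H τ).card then (1 : ℤ) else 0) =
      ∑ H ∈ A.above G, if (A.neg G H τ).card < j then (1 : ℤ) else 0 := by
    rw [Finset.sum_boole, Finset.sum_boole, card_neg_lt hτ hτ.neg]
    congr 2
    refine Finset.filter_congr fun H hH => ?_
    have := neg_card_add hτ hH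
    omega
  rw [h1, ← Finset.sum_sub_distrib, idx, ← Finset.sum_boole]
  refine Finset.sum_congr rfl fun H _ => ?_
  rcases lt_trichotomy (A.neg G H τ).card j with h | h | h
  · rw [if_pos h.le, if_pos h, if_neg h.ne]; rfl
  · rw [if_pos h.le, if_neg h.not_lt, if_pos h]; rfl
  · rw [if_neg (not_le.2 h), if_neg (by omega), if_neg h.ne']; rfl

lemma cnt_add_cnt_neg {v : ι} {s c : ℝ} (hs : s = 1 ∨ s = -1) {D j : ℕ}
    (hc : ∀ H ∈ A.above G, (c < τ (A.pt H) ↔ v ∈ H) ∧ (c ≤ τ (A.pt H) ↔ v ∈ H))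
    (hp : ∀ H ∈ A.above (insert v G), 0 < A.lam H τ v) :
    A.cnt τ G s D j c + A.cnt τ G (-s) D j c =
      ∑ H ∈ A.above (insert v G), ((if (A.neg (insert v G) H τ).card ≤ j then (1 : ℤ) else 0) -
        if D ≤ j + (A.neg (insert v G) H τ).card then 1 else 0) := by
  rw [cnt, cnt, ← Finset.sum_add_distrib]
  have key : ∀ (P : Prop) [Decidable P] (k : ℕ),
      (if P ∧ (-1 : ℝ) ^ k = s then (1 : ℤ) else 0) + (if P ∧ (-1 : ℝ) ^ k = -s then 1 else 0) =
        if P then 1 else 0 := by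
    intro P _ k
    by_cases hP : P <;> rcases hs with rfl | rfl <;>
      rcases neg_one_pow_eq_or ℝ k with h | h <;> simp [hP, h] <;> norm_num
  rw [above_insert, Finset.sum_filter]
  refine Finset.sum_congr rfl fun H hH => ?_
  have hc' := hc H hH
  simp only [hc'.1, hc'.2]
  by_cases hv : v ∈ H
  · have h1 : A.neg (insert v G) H τ = A.neg G H τ := by
      have h2 := hp H (by rw [above_insert]; exact Finset.mem_filter.2 ⟨hH, hv⟩)
      ext w
      simp only [mem_neg, Finset.mem_insert, not_or]
      refine and_congr_right fun _ => ⟨fun h => ⟨h.1.2, h.2⟩, fun h => ⟨⟨?_, h.1⟩, h.2⟩⟩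
      rintro rfl
      exact absurd h.2 (not_lt.2 h2.le)
    rw [if_pos hv, if_pos hv, if_pos hv, if_pos hv, if_pos hv, h1]
    have k1 := key ((A.neg G H τ).card ≤ j) (A.neg G H τ).card
    have k2 := key (D ≤ j + (A.neg G H τ).card) (D + (A.neg G H τ).card)
    linear_combination k1 - k2
  · simp [hv]

/-- Evaluation of the functional of the whole link is invariant under shifts. -/
lemma wsum_shift (hτ : A.Gen τ) {v : ι} (c : ℝ) : ∀ (k i : ℕ), k + i + G.card ≤ Module.finrank ℝ V →
    ∀ f g : MvPolynomial ι ℝ, f.IsHomogeneous i → g.IsHomogeneous k →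
    ∑ H ∈ A.above G, A.gam G H τ * (eval (A.lam H τ) f *
      eval (fun w => A.lam H τ w - if w = v then c else 0) g) =
    A.wsum τ G (A.above G) (f * g) := by
  intro k
  induction k with
  | zero =>
    intro i _ f g _ hg
    obtain ⟨r, rfl⟩ : ∃ r, g = C r := 
      ⟨_, totalDegree_eq_zero_iff_eq_C.1 ((totalDegree_zero_iff_isHomogeneous _).2 hg)⟩
    simp [wsum_apply]
  | succ k ih =>
    intro i hd f g hf hg
    obtain ⟨g', hg', rfl⟩ := IsHomogeneous.exists_eq_sum_X_mul hg
    have h1 : ∀ w, ∑ H ∈ A.above G, A.gam G H τ * (eval (A.lam H τ) f *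
        eval (fun w => A.lam H τ w - if w = v then c else 0) (X w * g' w)) =
        A.wsum τ G (A.above G) (f * (X w * g' w)) := by
      intro w
      have e1 := ih (i + 1) (by omega) (f * X w) (g' w) (hf.mul (isHomogeneous_X _ w)) (hg' w)
      have e2 := ih i (by omega) f (g' w) hf (hg' w)
      rw [wsum_above_eq_zero hτ (k := i + k) (by omega) (hf.mul (hg' w))] at e2
      rw [← mul_assoc, ← e1, ← sub_eq_zero, ← Finset.sum_sub_distrib]
      have e3 := congrArg (fun t => -(if w = v then c else 0) * t) e2
      simp only [mul_zero, Finset.mul_sum] at e3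
      refine Eq.trans (Finset.sum_congr rfl fun H _ => ?_) e3
      rw [map_mul, map_mul, eval_X, eval_X]
      ring
    simp only [map_sum, Finset.mul_sum]
    rw [Finset.sum_comm]
    exact Finset.sum_congr rfl fun w _ => by rw [← Finset.sum_congr rfl (fun _ _ => rfl), h1 w]

end Sys

lemma eventually_affine_ne {a b : ℝ} (h : b ≠ 0 ∨ a ≠ 0) :
    ∀ᶠ ε in nhdsWithin (0 : ℝ) (Set.Ioi 0), a + ε * b ≠ 0 := by
  by_cases ha : a = 0
  · filter_upwards [self_mem_nhdsWithin] with ε hε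
    have hε : 0 < ε := hε
    have hb : b ≠ 0 := by tauto
    rw [ha, zero_add]
    exact mul_ne_zero hε.ne' hb
  · have h1 : Filter.Tendsto (fun ε : ℝ => a + ε * b) (nhds 0) (nhds a) := by
      have : Continuous fun ε : ℝ => a + ε * b := by fun_prop
      simpa using this.tendsto 0
    exact nhdsWithin_le_nhds (h1.eventually_ne ha)

lemma eventually_affine_pos {a b : ℝ} (h : 0 < a) :
    ∀ᶠ ε in nhdsWithin (0 : ℝ) (Set.Ioi 0), 0 < a + ε * b := by
  have h1 : Filter.Tendsto (fun ε : ℝ => a + ε * b) (nhds 0) (nhds a) := by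
    have : Continuous fun ε : ℝ => a + ε * b := by fun_prop
    simpa using this.tendsto 0
  exact nhdsWithin_le_nhds (h1.eventually (lt_mem_nhds h))

lemma eval_mul_of_homogeneous {ι : Type*} [Fintype ι] (ε : ℝ) (q : ι → ℝ) : ∀ (n : ℕ)
    (g : MvPolynomial ι ℝ), g.IsHomogeneous n →
    eval (fun w => ε * q w) g = ε ^ n * eval q g := by
  intro n
  induction n with
  | zero =>
    intro g hg
    obtain ⟨r, rfl⟩ : ∃ r, g = C r :=
      ⟨_, totalDegree_eq_zero_iff_eq_C.1 ((totalDegree_zero_iff_isHomogeneous _).2 hg)⟩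
    simp
  | succ n ih =>
    intro g hg
    obtain ⟨g', hg', rfl⟩ := IsHomogeneous.exists_eq_sum_X_mul hg
    rw [map_sum, map_sum, Finset.mul_sum]
    refine Finset.sum_congr rfl fun w _ => ?_
    rw [map_mul, map_mul, ih _ (hg' w), eval_X, eval_X]
    ring

lemma eventually_posIdx_le_posIdx {M M' α : Type*} [AddCommGroup M] [Module ℝ M]
    [FiniteDimensional ℝ M] [AddCommGroup M'] [Module ℝ M'] [FiniteDimensional ℝ M']
    {l : Filter α} {B : α → LinearMap.BilinForm ℝ M'} {B₀ : LinearMap.BilinForm ℝ M}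
    (f : M →ₗ[ℝ] M') (hs : ∀ t u v, B t u v = B t v u) (hs₀ : ∀ u v, B₀ u v = B₀ v u)
    (h : ∀ u v, Filter.Tendsto (fun t => B t (f u) (f v)) l (nhds (B₀ u v))) :
    ∀ᶠ t in l, posIdx B₀ ≤ posIdx (B t) := by
  obtain ⟨W, hW, hk⟩ := exists_posOn B₀
  have := eventually_posIdx_le (B := fun t => (B t).comp f f) (fun t u v => by simp [hs t])
    hs₀ (by simpa using h) hW
  filter_upwards [this] with t ht
  rw [← hk]
  exact posIdx_le_of_map f ht fun u _ => rfl

namespace Sys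

variable {ι V : Type*} [Fintype ι] [DecidableEq ι] [AddCommGroup V] [Module ℝ V]
  [FiniteDimensional ℝ V] {A : Sys ι V} {η : Module.Dual ℝ V} {G : Finset ι}

/-- The perturbation of `a v` in direction `η`. -/
noncomputable def pert (A : Sys ι V) (η : Module.Dual ℝ V) (v : ι) (ε : ℝ) : Module.Dual ℝ V :=
  A.a v + ε • η

lemma pert_apply (v : ι) (ε : ℝ) (x : V) : A.pert η v ε x = A.a v x + ε * η x := rfl

lemma lam_pert {H : Finset ι} {w : ι} (hw : w ∈ H) (v : ι) (ε : ℝ) :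
    A.lam H (A.pert η v ε) w = A.a v (A.dv H w) + ε * A.lam H η w := by
  rw [lam, lam, if_pos hw, if_pos hw, pert_apply]

lemma lam_pert_of_mem {H : Finset ι} (hH : H ∈ A.verts) {v w : ι} (hw : w ∈ H) (hv : v ∈ H)
    (ε : ℝ) : A.lam H (A.pert η v ε) w = (if v = w then 1 else 0) + ε * A.lam H η w := by
  rw [lam_pert hw, (isFace_of_mem hH).dv_spec hv]

lemma gen_pert (hη : A.Gen η) (v : ι) :
    ∀ᶠ ε in nhdsWithin (0 : ℝ) (Set.Ioi 0), A.Gen (A.pert η v ε) := by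
  have h1 : ∀ᶠ ε in nhdsWithin (0 : ℝ) (Set.Ioi 0), ∀ H ∈ A.verts, ∀ w ∈ H,
      A.a v (A.dv H w) + ε * A.lam H η w ≠ 0 := by
    rw [Filter.eventually_all_finset]
    intro H hH
    rw [Filter.eventually_all_finset]
    intro w hw
    exact eventually_affine_ne (Or.inl (hη.lam_ne hH hw))
  have h2 : ∀ᶠ ε in nhdsWithin (0 : ℝ) (Set.Ioi 0), ∀ H ∈ A.verts, ∀ K ∈ A.verts, H ≠ K →
      (A.a v (A.pt H) - A.a v (A.pt K)) + ε * (η (A.pt H) - η (A.pt K)) ≠ 0 := by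
    rw [Filter.eventually_all_finset]
    intro H hH
    rw [Filter.eventually_all_finset]
    intro K hK
    by_cases h : H = K
    · exact Filter.Eventually.of_forall fun ε h' => absurd h h'
    · filter_upwards [eventually_affine_ne (a := A.a v (A.pt H) - A.a v (A.pt K))
        (b := η (A.pt H) - η (A.pt K)) (Or.inl fun h0 =>
          h (hη.2 H hH K hK (sub_eq_zero.1 h0)))] with ε hε _
      exact hε
  filter_upwards [h1, h2] with ε h1 h2
  refine ⟨fun H hH w hw => by rw [lam_pert hw]; exact h1 H hH w hw, fun H hH K hK he => ?_⟩
  by_contra hne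
  refine h2 H hH K hK hne ?_
  rw [pert_apply, pert_apply] at he
  linear_combination he

lemma level_pert {v : ι} {y : V} (hy : A.a v y = 1)
    (hη : ∀ H ∈ A.above (insert v G), η y < η (A.pt H)) :
    ∀ᶠ ε in nhdsWithin (0 : ℝ) (Set.Ioi 0), ∀ H ∈ A.above G,
      (A.pert η v ε y < A.pert η v ε (A.pt H) ↔ v ∈ H) ∧
      (A.pert η v ε y ≤ A.pert η v ε (A.pt H) ↔ v ∈ H) := by
  rw [Filter.eventually_all_finset]
  intro H hH
  by_cases hv : v ∈ H
  · filter_upwards [self_mem_nhdsWithin] with ε hε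
    have hε : 0 < ε := hε
    have h1 := hη H (by rw [above_insert]; exact Finset.mem_filter.2 ⟨hH, hv⟩)
    have h2 : A.pert η v ε y < A.pert η v ε (A.pt H) := by
      rw [pert_apply, pert_apply, hy, (isFace_of_mem (above_subset hH)).pt_eq_one.2 hv]
      linarith [mul_lt_mul_of_pos_left h1 hε]
    exact ⟨iff_of_true h2 hv, iff_of_true h2.le hv⟩
  · have h1 := (isFace_of_mem (above_subset hH)).pt_lt_one hv
    filter_upwards [eventually_affine_pos (a := 1 - A.a v (A.pt H)) (b := η y - η (A.pt H))
      (by linarith)] with ε hε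
    have h2 : A.pert η v ε (A.pt H) < A.pert η v ε y := by
      rw [pert_apply, pert_apply, hy]
      linarith
    exact ⟨iff_of_false (not_lt.2 h2.le) hv, iff_of_false (not_le.2 h2) hv⟩

lemma lam_pert_pos {v : ι} : ∀ᶠ ε in nhdsWithin (0 : ℝ) (Set.Ioi 0),
    ∀ H ∈ A.above (insert v G), 0 < A.lam H (A.pert η v ε) v := by
  rw [Filter.eventually_all_finset]
  intro H hH
  have hv : v ∈ H := (mem_above.1 hH).2 (Finset.mem_insert_self _ _)
  filter_upwards [eventually_affine_pos (a := 1) (b := A.lam H η v) one_pos] with ε hε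
  rwa [lam_pert_of_mem (above_subset hH) hv hv, if_pos rfl]

lemma pass_pert {v : ι} {y : V} {ε : ℝ} (h : ∀ H ∈ A.above G,
      (A.pert η v ε y < A.pert η v ε (A.pt H) ↔ v ∈ H) ∧
      (A.pert η v ε y ≤ A.pert η v ε (A.pt H) ↔ v ∈ H)) :
    A.pass (A.pert η v ε) G (A.pert η v ε y) = A.above (insert v G) := by
  rw [above_insert]
  ext H
  rw [mem_pass, Finset.mem_filter]
  refine and_congr_right fun hH => ?_
  rw [(h H hH).1]
  refine ⟨fun h' => h'.elim id fun h' => ?_, Or.inl⟩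
  exact (h H hH).2.1 h'.1.le

/-- The substitution eliminating `X v`. -/
noncomputable def elimX (A : Sys ι V) (v : ι) (y : V) : MvPolynomial ι ℝ →ₐ[ℝ] MvPolynomial ι ℝ :=
  aeval fun w => if w = v then -∑ w' ∈ Finset.univ.erase v, C (A.a w' y) * X w' else X w

lemma elimX_homogeneous (v : ι) (y : V) {j : ℕ} {g : MvPolynomial ι ℝ} (hg : g.IsHomogeneous j) :
    (A.elimX v y g).IsHomogeneous j := by
  have := hg.aeval (S := ℝ) (n := 1)
    (fun w => if w = v then -∑ w' ∈ Finset.univ.erase v, C (A.a w' y) * X w' else X w)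
    (fun w => by
      split_ifs
      · refine (IsHomogeneous.sum _ _ _ fun w' _ => ?_).neg
        exact isHomogeneous_C_mul_X _ _
      · exact isHomogeneous_X _ _)
  rwa [one_mul] at this

lemma elimX_sum {v : ι} {y : V} (hy : A.a v y = 1) : A.elimX v y (∑ w, X w) = A.slack y := by
  rw [map_sum, ← Finset.add_sum_erase _ _ (Finset.mem_univ v), slack,
    ← Finset.add_sum_erase _ _ (Finset.mem_univ v), hy]
  simp only [elimX, aeval_X, if_pos]
  rw [Finset.sum_congr rfl (g := fun w => X w) fun w hw => if_neg (Finset.ne_of_mem_erase hw),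
    neg_add_eq_sub, ← Finset.sum_sub_distrib]
  simp [sub_mul]

lemma eval_elimX (p : ι → ℝ) (v : ι) (y : V) (g : MvPolynomial ι ℝ) :
    eval p (A.elimX v y g) = eval (fun w => if w = v then
      -∑ w' ∈ Finset.univ.erase v, A.a w' y * p w' else p w) g := by
  have h : (aeval p : MvPolynomial ι ℝ →ₐ[ℝ] ℝ).comp (A.elimX v y) = aeval (fun w => if w = v then
      -∑ w' ∈ Finset.univ.erase v, A.a w' y * p w' else p w) := by
    refine algHom_ext fun w => ?_
    simp only [AlgHom.comp_apply, elimX, aeval_X]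
    split_ifs <;> simp
  have := congrArg (fun f => f g) h
  simpa [aeval_eq_eval] using this

end Sys

namespace Sys

variable {ι V : Type*} [Fintype ι] [DecidableEq ι] [AddCommGroup V] [Module ℝ V]
  [FiniteDimensional ℝ V] {A : Sys ι V} {η : Module.Dual ℝ V} {G : Finset ι}

lemma eval_elimX_pert {H : Finset ι} (hH : H ∈ A.verts) {v : ι} (hv : v ∈ H) {y : V}
    (hy : A.a v y = 1) {n : ℕ} {g : MvPolynomial ι ℝ} (hg : g.IsHomogeneous n) (ε : ℝ) :
    eval (A.lam H (A.pert η v ε)) (A.elimX v y g) =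
      ε ^ n * eval (fun w => A.lam H η w - if w = v then η y else 0) g := by
  rw [eval_elimX, ← eval_mul_of_homogeneous ε _ n g hg]
  congr 2
  ext w
  have h1 : ∀ w, w ≠ v → A.lam H (A.pert η v ε) w = ε * A.lam H η w := by
    intro w hw
    by_cases hwH : w ∈ H
    · rw [lam_pert_of_mem hH hwH hv, if_neg hw.symm, zero_add]
    · rw [lam_of_notMem hwH, lam_of_notMem hwH, mul_zero]
  split_ifs with hw
  · have h2 : η y = A.lam H η v + ∑ w ∈ Finset.univ.erase v, A.a w y * A.lam H η w := by
      rw [apply_eq_sum_lam hH η y, ← sum_lam, ← Finset.add_sum_erase _ _ (Finset.mem_univ v), hy,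
        one_mul]
    rw [hw, Finset.sum_congr rfl (g := fun w => ε * (A.a w y * A.lam H η w)) fun w' hw' => by
      rw [h1 w' (Finset.ne_of_mem_erase hw')]; ring, ← Finset.mul_sum, h2]
    ring
  · rw [h1 w hw, sub_zero]

lemma gam_pert {v : ι} {H : Finset ι} (hH : H ∈ A.above (insert v G)) (hv : v ∉ G) {n : ℕ}
    (hn : (insert v G).card + n = Module.finrank ℝ V) {ε : ℝ} (hε : ε ≠ 0) :
    A.gam G H (A.pert η v ε) * ε ^ n =
      A.gam (insert v G) H η * (1 + ε * A.lam H η v)⁻¹ := by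
  obtain ⟨hH, hGH⟩ := mem_above.1 hH
  have hvH := hGH (Finset.mem_insert_self v G)
  have h1 : H \ G = insert v (H \ insert v G) := by
    ext w
    simp only [Finset.mem_sdiff, Finset.mem_insert, not_or]
    by_cases hw : w = v
    · simp [hw, hvH, hv]
    · simp [hw]
  have h2 : (H \ insert v G).card = n := by
    have := Finset.card_sdiff_add_card_eq_card hGH
    rw [card_of_mem hH] at this
    omega
  have h3 : ∏ w ∈ H \ insert v G, A.lam H (A.pert η v ε) w =
      ε ^ n * ∏ w ∈ H \ insert v G, A.lam H η w := by
    rw [← h2, ← Finset.prod_const, ← Finset.prod_mul_distrib]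
    refine Finset.prod_congr rfl fun w hw => ?_
    obtain ⟨hwH, hw⟩ := Finset.mem_sdiff.1 hw
    rw [lam_pert_of_mem hH hwH hvH, if_neg, zero_add]
    rintro rfl
    exact hw (Finset.mem_insert_self _ _)
  rw [gam, gam, h1, Finset.prod_insert (by simp), h3, lam_pert_of_mem hH hvH hvH, if_pos rfl,
    div_mul_eq_mul_div, div_mul_eq_mul_div, mul_left_comm, mul_comm _ (ε ^ n),
    mul_div_mul_left _ _ (pow_ne_zero n hε), ← div_div, div_div, div_eq_mul_inv, div_eq_mul_inv,
    mul_inv]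
  ring

lemma tendsto_pert (hη : A.Gen η) {v : ι} (hv : v ∉ G) {y : V} (hy : A.a v y = 1) {n : ℕ}
    (hn : (insert v G).card + n = Module.finrank ℝ V) {g : MvPolynomial ι ℝ}
    (hg : g.IsHomogeneous n) :
    Filter.Tendsto (fun ε => A.wsum (A.pert η v ε) G (A.above (insert v G)) (A.elimX v y g))
      (nhdsWithin 0 (Set.Ioi 0)) (nhds (A.wsum η (insert v G) (A.above (insert v G)) g)) := by
  have h0 := wsum_shift hη (G := insert v G) (v := v) (η y) n 0 (by omega) 1 g
    (isHomogeneous_one _ _) hg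
  simp only [map_one, one_mul] at h0
  rw [← h0]
  have h1 : Filter.Tendsto (fun ε : ℝ => ∑ H ∈ A.above (insert v G),
      (A.gam (insert v G) H η * (1 + ε * A.lam H η v)⁻¹) *
        eval (fun w => A.lam H η w - if w = v then η y else 0) g)
      (nhdsWithin 0 (Set.Ioi 0)) (nhds (∑ H ∈ A.above (insert v G), A.gam (insert v G) H η *
        eval (fun w => A.lam H η w - if w = v then η y else 0) g)) := by
    refine tendsto_finsetSum _ fun H _ => ?_
    have h2 : Filter.Tendsto (fun ε : ℝ => (1 + ε * A.lam H η v)⁻¹) (nhds 0) (nhds 1) := by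
      have : ContinuousAt (fun ε : ℝ => (1 + ε * A.lam H η v)⁻¹) 0 := by
        refine ContinuousAt.inv₀ (by fun_prop) (by simp)
      simpa [ContinuousAt] using this
    have := ((h2.const_mul (A.gam (insert v G) H η)).mul_const
      (eval (fun w => A.lam H η w - if w = v then η y else 0) g))
    rw [mul_one] at this
    exact this.mono_left nhdsWithin_le_nhds
  refine h1.congr' ?_
  filter_upwards [self_mem_nhdsWithin] with ε hε
  have hε : 0 < ε := hε
  rw [wsum_apply]
  refine Finset.sum_congr rfl fun H hH => ?_
  rw [eval_elimX_pert (above_subset hH) ((mem_above.1 hH).2 (Finset.mem_insert_self v G)) hy hg,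
    ← gam_pert hH hv hn hε.ne']
  ring

/-- The class `∑ X v`. -/
noncomputable def sumX (ι : Type*) [Fintype ι] : MvPolynomial ι ℝ := ∑ v, X v

lemma sumX_homogeneous : (sumX ι).IsHomogeneous 1 :=
  IsHomogeneous.sum _ _ _ fun _ _ => isHomogeneous_X _ _

/-- `elimX` on homogeneous polynomials. -/
noncomputable def elimH (A : Sys ι V) (v : ι) (y : V) (j : ℕ) :
    homogeneousSubmodule ι ℝ j →ₗ[ℝ] homogeneousSubmodule ι ℝ j :=
  (A.elimX v y).toLinearMap.restrict fun _ hg => elimX_homogeneous v y hg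

lemma eventually_posIdx_pert (hη : A.Gen η) {v : ι} (hv : v ∉ G) {y : V} (hy : A.a v y = 1)
    {j m : ℕ} (hn : (insert v G).card + (2 * j + m) = Module.finrank ℝ V) (s : ℝ) :
    ∀ᶠ ε in nhdsWithin (0 : ℝ) (Set.Ioi 0),
      posIdx (s • Qf (A.wsum η (insert v G) (A.above (insert v G))) (sumX ι) j m) ≤
      posIdx (s • Qf (A.wsum (A.pert η v ε) G (A.above (insert v G))) (A.slack y) j m) := by
  refine eventually_posIdx_le_posIdx (B := fun ε =>
    s • Qf (A.wsum (A.pert η v ε) G (A.above (insert v G))) (A.slack y) j m) (A.elimH v y j) ?_ ?_ ?_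
  · intro t u w
    simp only [LinearMap.smul_apply]
    rw [Qf_symm]
  · intro u w
    simp only [LinearMap.smul_apply]
    rw [Qf_symm]
  · intro u w
    have h1 : (sumX ι ^ m * (u : MvPolynomial ι ℝ) * w).IsHomogeneous (2 * j + m) := by
      have := ((sumX_homogeneous (ι := ι)).pow m |>.mul u.2).mul w.2
      rwa [show 1 * m + j + j = 2 * j + m by ring] at this
    have h2 := (tendsto_pert hη hv hy hn h1).const_mul s
    simp only [map_mul, map_pow] at h2
    rw [sumX, elimX_sum hy] at h2
    exact h2

end Sys

lemma card_add_finrank_le {M κ : Type*} [AddCommGroup M] [Module ℝ M] [FiniteDimensional ℝ M]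
    (S : Finset κ) (t : κ → ℝ) (ht : ∀ H ∈ S, ∀ K ∈ S, t H = t K → H = K) (e : κ → M)
    (φ : κ → M →ₗ[ℝ] ℝ) (h : ∀ H ∈ S, ∀ K ∈ S, φ K (e H) ≠ 0 → t K ≤ t H)
    (h1 : ∀ H ∈ S, φ H (e H) ≠ 0) {N : Submodule ℝ M} (hN : ∀ H ∈ S, N ≤ LinearMap.ker (φ H)) :
    S.card + Module.finrank ℝ N ≤ Module.finrank ℝ M := by
  classical
  let f : (({H // H ∈ S} → ℝ) × N) →ₗ[ℝ] M :=
    (Fintype.linearCombination ℝ fun H : {H // H ∈ S} => e H).coprod N.subtype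
  have hf : Function.Injective f := by
    rw [← LinearMap.ker_eq_bot, LinearMap.ker_eq_bot']
    rintro ⟨c, x⟩ h0
    have h0 : ∑ H : {H // H ∈ S}, c H • e H + (x : M) = 0 := h0
    have hc : c = 0 := by
      by_contra hne
      obtain ⟨K₀, hK₀⟩ := Function.ne_iff.1 hne
      obtain ⟨K, hK, hmax⟩ := Finset.exists_max_image
        (Finset.univ.filter fun H : {H // H ∈ S} => c H ≠ 0) (fun H => t H)
        ⟨K₀, by simpa using hK₀⟩
      have hcK : c K ≠ 0 := (Finset.mem_filter.1 hK).2
      have h2 := congrArg (φ K) h0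
      rw [map_add, map_sum, map_zero, show φ K x = 0 from hN K K.2 x.2, add_zero,
        Finset.sum_eq_single K] at h2
      · rw [map_smul, smul_eq_mul] at h2
        exact mul_ne_zero hcK (h1 K K.2) h2
      · intro H _ hHK
        rw [map_smul, smul_eq_mul]
        by_contra h3
        have h4 := h H H.2 K K.2 (right_ne_zero_of_mul h3)
        have h5 := hmax H (Finset.mem_filter.2 ⟨Finset.mem_univ _, left_ne_zero_of_mul h3⟩)
        exact hHK (Subtype.ext (ht H H.2 K K.2 (le_antisymm h5 h4)))
      · exact fun h => absurd (Finset.mem_univ _) h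
    subst hc
    simp only [Pi.zero_apply, zero_smul, Finset.sum_const_zero, zero_add] at h0
    exact Prod.ext rfl (Subtype.ext h0)
  have := LinearMap.finrank_le_finrank_of_injective hf
  simpa [Module.finrank_prod] using this

namespace Sys

variable {ι V : Type*} [Fintype ι] [DecidableEq ι] [AddCommGroup V] [Module ℝ V]
  [FiniteDimensional ℝ V] {A : Sys ι V} {η : Module.Dual ℝ V} {G : Finset ι}

lemma le_of_wsum_above_ne_zero (hη : A.Gen η) {H K : Finset ι} (hH : H ∈ A.above G)
    (hK : K ∈ A.above G)
    (h : A.wsum η G (A.above G) (xm (A.neg G H η) * xm ((K \ G) \ A.neg G K η)) ≠ 0) :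
    η (A.pt K) ≤ η (A.pt H) := by
  rw [wsum_apply] at h
  obtain ⟨F, hF, hne⟩ := Finset.exists_ne_zero_of_sum_ne_zero h
  rw [map_mul] at hne
  have h1 : A.neg G H η ⊆ F := by
    by_contra hc
    exact hne (by rw [eval_xm_eq_zero hc]; ring)
  have h2 : (K \ G) \ A.neg G K η ⊆ F := by
    by_contra hc
    exact hne (by rw [eval_xm_eq_zero hc]; ring)
  obtain ⟨hF, hGF⟩ := mem_above.1 hF
  obtain ⟨hH, hGH⟩ := mem_above.1 hH
  obtain ⟨hK, hGK⟩ := mem_above.1 hK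
  refine (le_vert_of_lam_neg hK hF fun w hw hwF => ?_).1.trans
    (vert_le_of_lam_pos hH hF fun w hw hwF => ?_).1
  · by_contra hc
    refine hwF (h2 (Finset.mem_sdiff.2 ⟨Finset.mem_sdiff.2 ⟨hw, fun h => hwF (hGF h)⟩, fun h => ?_⟩))
    exact hc (mem_neg.1 h).2.2
  · by_contra hc
    refine hwF (h1 (mem_neg.2 ⟨hw, fun h => hwF (hGF h), ?_⟩))
    exact lt_of_le_of_ne (not_lt.1 hc) (hη.lam_ne hH hw)

lemma wsum_above_diag_ne_zero (hη : A.Gen η) {H : Finset ι} (hH : H ∈ A.above G) :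
    A.wsum η G (A.above G) (xm (A.neg G H η) * xm ((H \ G) \ A.neg G H η)) ≠ 0 := by
  obtain ⟨hHv, hGH⟩ := mem_above.1 hH
  have h1 : ∀ F ∈ A.above G, F ≠ H → A.gam G F η *
      eval (A.lam F η) (xm (A.neg G H η) * xm ((H \ G) \ A.neg G H η)) = 0 := by
    intro F hF hne
    obtain ⟨hFv, hGF⟩ := mem_above.1 hF
    have h2 : ¬H ⊆ F := fun h => hne (eq_of_subset hHv hFv h).symm
    rw [Finset.not_subset] at h2
    obtain ⟨w, hw, hwF⟩ := h2
    rw [map_mul]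
    by_cases hn : w ∈ A.neg G H η
    · rw [eval_xm_eq_zero fun h => hwF (h hn)]; ring
    · rw [eval_xm_eq_zero (I := (H \ G) \ _) fun h => hwF (h (Finset.mem_sdiff.2
        ⟨Finset.mem_sdiff.2 ⟨hw, fun h => hwF (hGF h)⟩, hn⟩))]; ring
  rw [wsum_apply, Finset.sum_eq_single H h1 (fun h => absurd hH h), map_mul]
  exact mul_ne_zero (gam_ne_zero hη hHv) (mul_ne_zero
    (eval_xm_ne_zero hη hHv (neg_subset.trans Finset.sdiff_subset))
    (eval_xm_ne_zero hη hHv (Finset.sdiff_subset.trans Finset.sdiff_subset)))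

lemma idx_add_finrank_Nul_le (hη : A.Gen η) {j k : ℕ}
    (hd : G.card + (j + k) = Module.finrank ℝ V) :
    A.idx η G j + Module.finrank ℝ (Nul (A.wsum η G (A.above G)) j k) ≤
      Module.finrank ℝ (homogeneousSubmodule ι ℝ j) := by
  classical
  let e : Finset ι → homogeneousSubmodule ι ℝ j := fun H =>
    if h : (A.neg G H η).card = j then ⟨xm (A.neg G H η), by
      have := xm_homogeneous (A.neg G H η); rwa [h] at this⟩ else 0
  let φ : Finset ι → homogeneousSubmodule ι ℝ j →ₗ[ℝ] ℝ := fun K =>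
    ((A.wsum η G (A.above G)).comp
      (LinearMap.mulRight ℝ (xm ((K \ G) \ A.neg G K η)))).comp (Submodule.subtype _)
  have he : ∀ H K, (A.neg G H η).card = j → φ K (e H) = A.wsum η G (A.above G)
      (xm (A.neg G H η) * xm ((K \ G) \ A.neg G K η)) := by
    intro H K h
    simp [φ, e, h]
  refine card_add_finrank_le _ (fun H => η (A.pt H)) ?_ e φ ?_ ?_ ?_
  · intro H hH K hK h
    exact hη.2 H (above_subset (Finset.mem_filter.1 hH).1) K
      (above_subset (Finset.mem_filter.1 hK).1) h
  · intro H hH K hK h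
    rw [he H K (Finset.mem_filter.1 hH).2] at h
    exact le_of_wsum_above_ne_zero hη (Finset.mem_filter.1 hH).1 (Finset.mem_filter.1 hK).1 h
  · intro H hH
    rw [he H H (Finset.mem_filter.1 hH).2]
    exact wsum_above_diag_ne_zero hη (Finset.mem_filter.1 hH).1
  · intro K hK u hu
    obtain ⟨hK, hKj⟩ := Finset.mem_filter.1 hK
    have h1 := Finset.card_sdiff_add_card_eq_card (mem_above.1 hK).2
    have h2 := Finset.card_sdiff_add_card_eq_card (neg_subset (A := A) (G := G) (H := K) (τ := η))
    rw [card_of_mem (above_subset hK)] at h1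
    refine hu (xm ((K \ G) \ A.neg G K η)) ?_
    have := xm_homogeneous ((K \ G) \ A.neg G K η)
    rwa [show ((K \ G) \ A.neg G K η).card = k by omega] at this

lemma wsum_above_X_mul (hη : A.Gen η) {v : ι} (hv : v ∉ G) (f : MvPolynomial ι ℝ) :
    A.wsum η G (A.above G) (X v * f) = A.wsum η (insert v G) (A.above (insert v G)) f := by
  rw [wsum_X_mul hη above_subset hv, above_insert]

lemma wsum_above_sumX_mul (hη : A.Gen η) (hG : A.IsFace G) {k : ℕ}
    (hk : k + 1 + G.card = Module.finrank ℝ V) {f : MvPolynomial ι ℝ} (hf : f.IsHomogeneous k) :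
    A.wsum η G (A.above G) (sumX ι * f) = ∑ v ∈ Finset.univ \ G,
      (1 - A.a v (A.pt G)) * A.wsum η (insert v G) (A.above (insert v G)) f := by
  have h1 : sumX ι = A.slack (A.pt G) + A.theta (A.pt G) := by
    rw [sumX, slack, theta, ← Finset.sum_add_distrib]
    refine Finset.sum_congr rfl fun v _ => ?_
    rw [map_sub, map_one]
    ring
  rw [h1, add_mul, map_add, wsum_theta_mul above_subset, wsum_above_eq_zero hη (by omega) hf,
    mul_zero, add_zero, wsum_slack_mul fun v hv => hG.pt_eq_one.2 hv]
  refine Finset.sum_congr rfl fun v hv => ?_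
  rw [wsum_above_X_mul hη (Finset.mem_sdiff.1 hv).2]

lemma HL_link (hη : A.Gen η) (hG : A.IsFace G) {j m : ℕ}
    (hd : G.card + 2 * j + m = Module.finrank ℝ V)
    (ih : ∀ v ∉ G, A.IsFace (insert v G) → ∀ m', m = m' + 1 →
      HR (A.wsum η (insert v G) (A.above (insert v G))) (sumX ι) j m') :
    HL (A.wsum η G (A.above G)) (sumX ι) j m := by
  intro u hu h
  rcases m with - | m
  · intro z hz
    have := h z hz
    rwa [pow_zero, one_mul] at this
  have hf : (sumX ι ^ m * u * u).IsHomogeneous (2 * j + m) := by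
    have := ((sumX_homogeneous (ι := ι)).pow m |>.mul hu).mul hu
    rwa [show 1 * m + j + j = 2 * j + m by ring] at this
  have h1 := wsum_above_sumX_mul hη hG (by omega) hf
  have h2 : A.wsum η G (A.above G) (sumX ι * (sumX ι ^ m * u * u)) = 0 := by
    rw [← h u hu]; congr 1; ring
  rw [h2] at h1
  have hR : ∀ v ∈ Finset.univ \ G,
      0 ≤ (-1) ^ j * A.wsum η (insert v G) (A.above (insert v G)) (sumX ι ^ m * u * u) ∧
      ((-1) ^ j * A.wsum η (insert v G) (A.above (insert v G)) (sumX ι ^ m * u * u) = 0 →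
        ∀ z : MvPolynomial ι ℝ, z.IsHomogeneous (j + m) →
        A.wsum η (insert v G) (A.above (insert v G)) (u * z) = 0) := by
    intro v hv
    have hv := (Finset.mem_sdiff.1 hv).2
    by_cases hF : A.IsFace (insert v G)
    · refine ih v hv hF m rfl u hu ?_
      rintro j' rfl z hz
      rw [← wsum_above_X_mul hη hv]
      have := h (X v * z) (by
        have := (isHomogeneous_X ℝ v).mul hz
        rwa [add_comm] at this)
      rw [← this]
      congr 1
      ring
    · rw [above_eq_empty hF]
      simp [wsum_apply]
  have hpos : ∀ v ∈ Finset.univ \ G, 0 < 1 - A.a v (A.pt G) := fun v hv =>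
    sub_pos.2 (hG.pt_lt_one (Finset.mem_sdiff.1 hv).2)
  have h3 : ∑ v ∈ Finset.univ \ G, (1 - A.a v (A.pt G)) *
      ((-1) ^ j * A.wsum η (insert v G) (A.above (insert v G)) (sumX ι ^ m * u * u)) = 0 := by
    have := congrArg (fun t => (-1) ^ j * t) h1
    simp only [mul_zero, Finset.mul_sum] at this
    rw [this]
    exact Finset.sum_congr rfl fun v _ => by ring
  rw [Finset.sum_eq_zero_iff_of_nonneg fun v hv => mul_nonneg (hpos v hv).le (hR v hv).1] at h3
  intro z hz
  refine wsum_mul_eq_zero hη hG (by omega) above_subset (k := j + m) ?_ hz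
  intro v hv z hz
  have hv' : v ∈ Finset.univ \ G := Finset.mem_sdiff.2 ⟨Finset.mem_univ v, hv⟩
  rw [wsum_above_X_mul hη hv]
  refine (hR v hv').2 ?_ z hz
  exact (mul_eq_zero.1 (h3 v hv')).resolve_left (hpos v hv').ne'

end Sys

lemma posIdx_eq_zero {M : Type*} [AddCommGroup M] [Module ℝ M] [FiniteDimensional ℝ M]
    {B : LinearMap.BilinForm ℝ M} (h : ∀ u, B u u ≤ 0) : posIdx B = 0 := by
  obtain ⟨W, hW, hd⟩ := exists_posOn B
  have : W = ⊥ := by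
    rw [eq_bot_iff]
    intro u hu
    by_contra hne
    exact absurd (hW u hu hne) (not_lt.2 (h u))
  rw [← hd, this, finrank_bot]

namespace Sys

variable {ι V : Type*} [Fintype ι] [DecidableEq ι] [AddCommGroup V] [Module ℝ V]
  [FiniteDimensional ℝ V] {A : Sys ι V} {η : Module.Dual ℝ V} {G : Finset ι}

lemma wsum_sq_nonneg (hG : A.IsFace G) (hd : G.card = Module.finrank ℝ V) (f : MvPolynomial ι ℝ) :
    0 ≤ A.wsum η G (A.above G) (f * f) := by
  rw [wsum_apply]
  refine Finset.sum_nonneg fun H hH => ?_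
  obtain ⟨hv, hs⟩ := mem_above.1 hH
  obtain rfl := eq_of_subset (hG.mem_verts hd) hv hs
  rw [map_mul]
  refine mul_nonneg ?_ (mul_self_nonneg _)
  simpa [gam] using (vol_pos hv).le

lemma exists_level_below (hη : A.Gen η) (hG : A.IsFace G) (hd : G.card < Module.finrank ℝ V)
    {v : ι} (hv : v ∈ G) : ∃ y, A.a v y = 1 ∧ ∀ H ∈ A.above G, η y < η (A.pt H) := by
  obtain ⟨H, hH, hGH, hn⟩ := exists_min hη hG
  have hc : G.card < H.card := by rwa [card_of_mem hH]
  obtain ⟨w, hw, hwG⟩ := Finset.exists_mem_notMem_of_card_lt_card hc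
  have hf := isFace_of_mem hH
  refine ⟨A.pt H + A.dv H w, ?_, fun K hK => ?_⟩
  · rw [map_add, hf.pt_eq_one.2 (hGH hv), hf.dv_spec (hGH hv), if_neg, add_zero]
    rintro rfl
    exact hwG hv
  · obtain ⟨hK, hGK⟩ := mem_above.1 hK
    have h1 := (le_vert_of_lam_neg hH hK (τ := η)
      fun w hw hwK => hn w hw fun h => hwK (hGK h)).1
    have h2 := hn w hw hwG
    rw [lam, if_pos hw] at h2
    rw [map_add]
    linarith

lemma HR_link (hη : A.Gen η) {K : Finset ι} {v : ι} (hv : v ∉ K) (hG : A.IsFace (insert v K))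
    {j m : ℕ} (hd : (insert v K).card + 2 * j + m = Module.finrank ℝ V)
    (hHL : HL (A.wsum η (insert v K) (A.above (insert v K))) (sumX ι) j m)
    (hHL' : ∀ j', j = j' + 1 →
      HL (A.wsum η (insert v K) (A.above (insert v K))) (sumX ι) j' (m + 2)) :
    HR (A.wsum η (insert v K) (A.above (insert v K))) (sumX ι) j m := by
  have hcard := Finset.card_insert_of_notMem hv
  rcases Nat.eq_zero_or_pos (2 * j + m) with hn | hn
  · obtain rfl : j = 0 := by omega
    obtain rfl : m = 0 := by omega
    refine HR_of_posIdx_le sumX_homogeneous hHL (fun _ => posIdx_eq_zero fun u => ?_)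
      (fun j' hj => by omega)
    have := wsum_sq_nonneg (η := η) hG (by omega) (u : MvPolynomial ι ℝ)
    simpa [Qf_apply] using this
  have hK : A.IsFace K := hG.subset (Finset.subset_insert v K)
  obtain ⟨y, hy, hlow⟩ := exists_level_below hη hG (by omega) (Finset.mem_insert_self v K)
  have hs : (-(-1 : ℝ) ^ j = 1 ∨ -(-1 : ℝ) ^ j = -1) := by
    rcases neg_one_pow_eq_or ℝ j with h | h <;> simp [h]
  have hpert : ∀ᶠ ε in nhdsWithin (0 : ℝ) (Set.Ioi 0), ∀ j', j = j' + 1 →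
      posIdx (-(-(-1 : ℝ) ^ j) • Qf (A.wsum η (insert v K) (A.above (insert v K)))
        (sumX ι) j' (m + 2)) ≤
      posIdx (-(-(-1 : ℝ) ^ j) • Qf (A.wsum (A.pert η v ε) K (A.above (insert v K)))
        (A.slack y) j' (m + 2)) := by
    rcases j with _ | j'
    · exact Filter.Eventually.of_forall fun ε j' hj => by omega
    · refine (eventually_posIdx_pert (G := K) hη hv hy (j := j') (m := m + 2) (by omega)
        (-(-(-1 : ℝ) ^ (j' + 1)))).mono fun ε hε j'' hj => ?_
      obtain rfl : j' = j'' := by omega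
      exact hε
  obtain ⟨ε, ⟨⟨⟨⟨hgen, hlev⟩, hlam⟩, hp0⟩, hp1⟩⟩ :=
    ((((gen_pert hη v).and (level_pert (G := K) hy hlow)).and (lam_pert_pos (A := A) (G := K)
      (η := η) (v := v))).and (eventually_posIdx_pert (G := K) hη hv hy (j := j) (m := m)
        (by omega) (-(-1 : ℝ) ^ j))).and hpert |>.exists
  set τ := A.pert η v ε with hτ
  have hpass : A.pass τ K (τ y) = A.above (insert v K) := pass_pert hlev
  obtain ⟨y₁, hy₁⟩ := exists_apply_eq_one hgen hK (by omega)
  have hc : ∀ c : ℝ, τ (c • y₁) = c := fun c => by rw [map_smul, hy₁, smul_eq_mul, mul_one]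
  have hcnt : ∀ i k s, (s = 1 ∨ s = -1) → i * 2 + k = 2 * j + m →
      (posIdx (s • Qf (A.wsum τ K (A.above (insert v K))) (A.slack y) i k) : ℤ) =
        A.cnt τ K s (2 * j + m + 1) i (τ y) := by
    intro i k s hs hik
    rw [← hpass, Qf_pass_eq_QP hy₁]
    refine posIdx_eq_cnt hgen hy₁ (by omega) (by omega) (fun c => ?_) hs (τ y)
    simpa only [hc] using (HL_HR hgen (2 * j + m) K i k hK (by omega) (by omega) (c • y₁)).1
  have h0 := hcnt j m _ hs (by ring)
  refine HR_of_posIdx_le sumX_homogeneous hHL ?_ ?_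
  · rintro rfl
    rw [neg_smul_form]
    have h1 := cnt_zero (A := A) (τ := τ) (G := K) (D := 2 * 0 + m + 1) (m := m) (by omega)
      (by omega) (τ y)
    rw [pow_zero] at h0 hp0 ⊢
    omega
  · rintro j' rfl
    rw [neg_smul_form, neg_smul_form]
    have hs' : (-(-(-1 : ℝ) ^ (j' + 1)) = 1 ∨ -(-(-1 : ℝ) ^ (j' + 1)) = -1) := by
      rcases hs with h | h <;> simp [h]
    have h1 := hcnt j' (m + 2) _ hs' (by omega)
    have h2 := cnt_succ (A := A) (τ := τ) (G := K) (D := 2 * (j' + 1) + m + 1) (j := j') (m := m)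
      rfl (τ y)
    have h3 := cnt_add_cnt_neg (D := 2 * (j' + 1) + m + 1) (j := j') hs hlev hlam
    rw [sum_index hgen (by omega), idx_eq hgen hη] at h3
    have h4 := idx_add_finrank_Nul_le (G := insert v K) hη (j := j') (k := j' + (m + 2)) (by omega)
    have h5 := posIdx_add_posIdx_neg (B := -(-1 : ℝ) ^ (j' + 1) •
      Qf (A.wsum η (insert v K) (A.above (insert v K))) (sumX ι) j' (m + 2))
      (fun u w => by simp only [LinearMap.smul_apply]; rw [Qf_symm])
    rw [ker_sign_smul hs, (hHL' j' rfl).ker_eq sumX_homogeneous, neg_smul_form] at h5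
    have h6 := hp1 j' rfl
    omega

theorem HL_face (hη : A.Gen η) (n : ℕ) : ∀ (G : Finset ι) (j m : ℕ), A.IsFace G →
    G.card + n = Module.finrank ℝ V → n = 2 * j + m →
    HL (A.wsum η G (A.above G)) (sumX ι) j m ∧
    (G.Nonempty → HR (A.wsum η G (A.above G)) (sumX ι) j m) := by
  induction n with
  | zero =>
    intro G j m hG hd hn
    have hHL : HL (A.wsum η G (A.above G)) (sumX ι) j m :=
      HL_link hη hG (by omega) fun v _ _ m' hm => by omega
    refine ⟨hHL, ?_⟩
    rintro ⟨v, hv⟩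
    have h := Finset.insert_erase hv
    have := HR_link (K := G.erase v) (v := v) hη (Finset.notMem_erase v G) (by rwa [h])
      (j := j) (m := m) (by rw [h]; omega) (by rw [h]; exact hHL) (fun j' hj => by omega)
    rwa [h] at this
  | succ n ih =>
    have hHL : ∀ (G : Finset ι) (j m : ℕ), A.IsFace G →
        G.card + (n + 1) = Module.finrank ℝ V → n + 1 = 2 * j + m →
        HL (A.wsum η G (A.above G)) (sumX ι) j m := by
      intro G j m hG hd hn
      refine HL_link hη hG (by omega) fun v hv hvG m' hm => ?_
      exact (ih (insert v G) j m' hvG (by rw [Finset.card_insert_of_notMem hv]; omega)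
        (by omega)).2 (Finset.insert_nonempty v G)
    intro G j m hG hd hn
    refine ⟨hHL G j m hG hd hn, ?_⟩
    rintro ⟨v, hv⟩
    have h := Finset.insert_erase hv
    have := HR_link (K := G.erase v) (v := v) hη (Finset.notMem_erase v G) (by rwa [h])
      (j := j) (m := m) (by rw [h]; omega) (by rw [h]; exact hHL G j m hG hd hn)
      (fun j' hj => by rw [h]; exact hHL G j' (m + 2) hG hd (by omega))
    rwa [h] at this

end Sys

/-- Partial sums of an integer sequence. -/
def psum : Module.End ℤ (ℕ → ℤ) where
  toFun x i := ∑ k ∈ Finset.range (i + 1), x k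
  map_add' x y := by ext i; simp [Finset.sum_add_distrib]
  map_smul' c x := by ext i; simp [Finset.mul_sum]

lemma psum_apply (x : ℕ → ℤ) (i : ℕ) : psum x i = ∑ k ∈ Finset.range (i + 1), x k := rfl

lemma psum_injective : Function.Injective psum := by
  rw [← LinearMap.ker_eq_bot, LinearMap.ker_eq_bot']
  intro x hx
  ext i
  have h1 := congrFun hx i
  rw [psum_apply, Finset.sum_range_succ] at h1
  rcases i with _ | i
  · simpa using h1
  · have h2 := congrFun hx i
    rw [psum_apply] at h2
    simpa [h2] using h1

lemma psum_mono {x y : ℕ → ℤ} (h : ∀ i, x i ≤ y i) (i : ℕ) : psum x i ≤ psum y i :=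
  by
    rw [psum_apply, psum_apply]
    exact Finset.sum_le_sum fun k _ => h k

lemma psum_pow_succ (d : ℕ) (x : ℕ → ℤ) : (psum ^ (d + 1)) x = (psum ^ d) (psum x) := by
  rw [pow_succ, Module.End.mul_apply]

lemma psum_pow_mono (d : ℕ) {x y : ℕ → ℤ} (h : ∀ i, x i ≤ y i) (i : ℕ) :
    (psum ^ d) x i ≤ (psum ^ d) y i := by
  induction d generalizing x y with
  | zero => exact h i
  | succ d ih => rw [psum_pow_succ, psum_pow_succ]; exact ih (psum_mono h)

lemma psum_pow_injective (d : ℕ) : Function.Injective (psum ^ d) := by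
  induction d with
  | zero => exact Function.injective_id
  | succ d ih =>
    intro x y h
    rw [psum_pow_succ, psum_pow_succ] at h
    exact psum_injective (ih h)

lemma psum_pow_choose (d : ℕ) :
    (psum ^ d) (fun j => (-1) ^ j * (d.choose j : ℤ)) = fun i => if i = 0 then 1 else 0 := by
  induction d with
  | zero =>
    ext i
    rcases i with _ | i <;> simp
  | succ d ih =>
    rw [psum_pow_succ, ← ih]
    congr 1
    ext i
    rw [psum_apply]
    exact Int.alternating_sum_range_choose_eq_choose

lemma psum_pow_single (d j : ℕ) (i : ℕ) : (psum ^ d) (fun k => if k = j then 1 else 0) i =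
    if j ≤ i then ((d.multichoose (i - j) : ℕ) : ℤ) else 0 := by
  induction d generalizing i with
  | zero =>
    rcases lt_trichotomy i j with h | rfl | h
    · simp [h.ne, h.not_ge]
    · simp
    · obtain ⟨k, rfl⟩ := Nat.exists_eq_add_of_lt h
      simp [show j + k + 1 - j = k + 1 by omega, show j + k + 1 ≠ j by omega]
  | succ d ih =>
    rw [pow_succ', Module.End.mul_apply]
    induction i with
    | zero =>
      rw [psum_apply, Finset.sum_range_one, ih]
      simp
    | succ i ih' =>
      rw [psum_apply, Finset.sum_range_succ, ← psum_apply, ih', ih]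
      rcases lt_trichotomy (i + 1) j with h | rfl | h
      · rw [if_neg (by omega), if_neg (by omega), if_neg (by omega), add_zero]
      · simp
      · rw [if_pos (by omega), if_pos (by omega), if_pos (by omega),
          show i + 1 - j = i - j + 1 by omega, Nat.multichoose_succ_succ]
        push_cast
        ring

lemma finrank_le_of_le_map {M : Type*} [AddCommGroup M] [Module ℝ M] [FiniteDimensional ℝ M]
    {K S : Submodule ℝ M} {L : Submodule ℝ S} (h : K ≤ L.map S.subtype) :
    Module.finrank ℝ K ≤ Module.finrank ℝ L :=
  (Submodule.finrank_mono h).trans (Submodule.finrank_map_le _ _)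

lemma finrank_sup_map_le {M M' : Type*} [AddCommGroup M] [Module ℝ M] [FiniteDimensional ℝ M]
    [AddCommGroup M'] [Module ℝ M'] [FiniteDimensional ℝ M'] (f : M →ₗ[ℝ] M')
    {K S : Submodule ℝ M} {N : Submodule ℝ M'} (hKS : K ≤ S) (hf : K.map f ≤ N) :
    Module.finrank ℝ ↥(N ⊔ S.map f) + Module.finrank ℝ K ≤
      Module.finrank ℝ N + Module.finrank ℝ S := by
  have h1 := Submodule.finrank_sup_add_finrank_inf_eq N (S.map f)
  have h2 := LinearMap.finrank_range_add_finrank_ker (f.domRestrict S)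
  have h3 := LinearMap.finrank_range_add_finrank_ker (f.domRestrict K)
  rw [LinearMap.range_domRestrict] at h2 h3
  have h4 : Module.finrank ℝ (K.map f) ≤ Module.finrank ℝ ↥(N ⊓ S.map f) :=
    Submodule.finrank_mono (le_inf hf (Submodule.map_mono hKS))
  have h5 : Module.finrank ℝ (LinearMap.ker (f.domRestrict K)) ≤
      Module.finrank ℝ (LinearMap.ker (f.domRestrict S)) := by
    have h6 := Submodule.finrank_map_subtype_eq K (LinearMap.ker (f.domRestrict K))
    rw [← h6]
    refine finrank_le_of_le_map ?_
    rintro _ ⟨x, hx, rfl⟩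
    exact ⟨⟨x, hKS x.2⟩, hx, rfl⟩
  omega

lemma finrank_add_le_of_comap_le {M M' : Type*} [AddCommGroup M] [Module ℝ M]
    [FiniteDimensional ℝ M] [AddCommGroup M'] [Module ℝ M'] [FiniteDimensional ℝ M']
    (f : M →ₗ[ℝ] M') {K S : Submodule ℝ M} {N T : Submodule ℝ M'} (hf : S.map f ≤ T)
    (hNT : N ≤ T) (h : ∀ u ∈ S, f u ∈ N → u ∈ K) :
    Module.finrank ℝ S + Module.finrank ℝ N ≤ Module.finrank ℝ T + Module.finrank ℝ K := by
  let g : S →ₗ[ℝ] M' ⧸ N := N.mkQ.comp (f.comp S.subtype)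
  have h2 := LinearMap.finrank_range_add_finrank_ker g
  have h3 : Module.finrank ℝ (LinearMap.ker g) ≤ Module.finrank ℝ K := by
    refine LinearMap.finrank_le_finrank_of_injective
      (f := (S.subtype.comp (LinearMap.ker g).subtype).codRestrict K fun x => h _ x.1.2 ?_)
      fun x y h => Subtype.ext (Subtype.ext (congrArg (fun z : K => (z : M)) h))
    have := x.2
    rw [LinearMap.mem_ker] at this
    exact (Submodule.Quotient.mk_eq_zero N).1 this
  have h4 : Module.finrank ℝ (LinearMap.range g) ≤ Module.finrank ℝ (T.map N.mkQ) := by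
    refine Submodule.finrank_mono ?_
    rintro _ ⟨x, rfl⟩
    exact Submodule.mem_map_of_mem (hf (Submodule.mem_map_of_mem x.2))
  have h5 := LinearMap.finrank_range_add_finrank_ker (N.mkQ.domRestrict T)
  rw [LinearMap.range_domRestrict] at h5
  have h6 : Module.finrank ℝ N ≤ Module.finrank ℝ (LinearMap.ker (N.mkQ.domRestrict T)) := by
    refine finrank_le_of_le_map fun x hx => ⟨⟨x, hNT hx⟩, ?_, rfl⟩
    exact (Submodule.Quotient.mk_eq_zero N).2 hx
  omega

lemma card_add_finrank_le_of_dual {M κ : Type*} [AddCommGroup M] [Module ℝ M]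
    [FiniteDimensional ℝ M] {K S : Submodule ℝ M} (hKS : K ≤ S) (E : Finset κ)
    (φ : κ → M →ₗ[ℝ] ℝ) (hK : ∀ m ∈ E, K ≤ LinearMap.ker (φ m)) (u : κ → M)
    (hu : ∀ m ∈ E, u m ∈ S) (h1 : ∀ m ∈ E, φ m (u m) = 1)
    (h0 : ∀ m ∈ E, ∀ m' ∈ E, m ≠ m' → φ m (u m') = 0) :
    E.card + Module.finrank ℝ K ≤ Module.finrank ℝ S := by
  classical
  let g : S →ₗ[ℝ] ({m // m ∈ E} → ℝ) := LinearMap.pi fun m => (φ m).comp S.subtype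
  have hg : Function.Surjective g := by
    intro c
    refine ⟨∑ m : {m // m ∈ E}, c m • ⟨u m, hu m m.2⟩, ?_⟩
    ext m
    simp only [g, LinearMap.pi_apply, map_sum, map_smul, smul_eq_mul]
    rw [Finset.sum_eq_single m]
    · simp [h1 m m.2]
    · intro m' _ hne
      simp [h0 m m.2 m' m'.2 fun h => hne (Subtype.ext h.symm)]
    · simp
  have h2 := LinearMap.finrank_range_add_finrank_ker g
  rw [LinearMap.range_eq_top.2 hg, finrank_top, Module.finrank_fintype_fun_eq_card,
    Fintype.card_coe] at h2
  have h3 : Module.finrank ℝ K ≤ Module.finrank ℝ (LinearMap.ker g) := by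
    refine finrank_le_of_le_map fun x hx => ⟨⟨x, hKS hx⟩, ?_, rfl⟩
    ext m
    exact hK m m.2 hx
  omega

section Filtration

variable {M : ℕ → Type*} [∀ i, AddCommGroup (M i)] [∀ i, Module ℝ (M i)]
  [∀ i, FiniteDimensional ℝ (M i)]

/-- The degree `i` part of the submodule generated by `I` and the images of `t k` for `k < s`. -/
def filt (S I : ∀ i, Submodule ℝ (M i)) (t : ℕ → ∀ i, M i →ₗ[ℝ] M (i + 1)) :
    ℕ → ∀ i, Submodule ℝ (M i)
  | 0, i => I i
  | s + 1, 0 => filt S I t s 0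
  | s + 1, i + 1 => filt S I t s (i + 1) ⊔ (S i).map (t s i)

variable {S I : ∀ i, Submodule ℝ (M i)} {t : ℕ → ∀ i, M i →ₗ[ℝ] M (i + 1)}

lemma filt_le (hI : ∀ i, I i ≤ S i) (hS : ∀ k i, (S i).map (t k i) ≤ S (i + 1)) (s i : ℕ) :
    filt S I t s i ≤ S i := by
  induction s with
  | zero => exact hI i
  | succ s ih =>
    rcases i with _ | i
    · exact ih
    · exact sup_le ih (hS s i)

lemma le_filt (s i : ℕ) : I i ≤ filt S I t s i := by
  induction s with
  | zero => exact le_rfl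
  | succ s ih =>
    rcases i with _ | i
    · exact ih
    · exact ih.trans le_sup_left

lemma map_le_filt {k s : ℕ} (h : k < s) (i : ℕ) : (S i).map (t k i) ≤ filt S I t s (i + 1) := by
  induction s with
  | zero => omega
  | succ s ih =>
    rcases Nat.lt_succ_iff_lt_or_eq.1 h with h | rfl
    · exact (ih h).trans le_sup_left
    · exact le_sup_right

lemma filt_le_of (s : ℕ) {N : ∀ i, Submodule ℝ (M i)} (hI : ∀ i, I i ≤ N i)
    (h : ∀ k i, (S i).map (t k i) ≤ N (i + 1)) (i : ℕ) : filt S I t s i ≤ N i := by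
  induction s with
  | zero => exact hI i
  | succ s ih =>
    rcases i with _ | i
    · exact ih
    · exact sup_le ih (h s i)

lemma map_filt_le (hI : ∀ k i, (I i).map (t k i) ≤ I (i + 1))
    (hS : ∀ k i, (S i).map (t k i) ≤ S (i + 1))
    (hc : ∀ k l i u, t k (i + 1) (t l i u) = t l (i + 1) (t k i u)) (k s i : ℕ) :
    (filt S I t s i).map (t k i) ≤ filt S I t s (i + 1) := by
  induction s with
  | zero => exact hI k i
  | succ s ih =>
    rcases i with _ | i
    · exact ih.trans le_sup_left
    · rw [filt, Submodule.map_sup]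
      refine sup_le (ih.trans le_sup_left) (le_trans ?_ le_sup_right)
      rintro _ ⟨_, ⟨u, hu, rfl⟩, rfl⟩
      rw [hc]
      exact Submodule.mem_map_of_mem (hS k i (Submodule.mem_map_of_mem hu))

/-- The codimension of `filt` in degree `i`. -/
noncomputable def codim (S I : ∀ i, Submodule ℝ (M i)) (t : ℕ → ∀ i, M i →ₗ[ℝ] M (i + 1))
    (s i : ℕ) : ℤ :=
  (Module.finrank ℝ (S i) : ℤ) - Module.finrank ℝ (filt S I t s i)

lemma codim_zero_le (hI' : ∀ i, I i ≤ S i) (hI : ∀ k i, (I i).map (t k i) ≤ I (i + 1))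
    (hS : ∀ k i, (S i).map (t k i) ≤ S (i + 1))
    (hc : ∀ k l i u, t k (i + 1) (t l i u) = t l (i + 1) (t k i u)) (s i : ℕ) :
    codim S I t 0 i ≤ (psum ^ s) (codim S I t s) i := by
  have h : ∀ s i, codim S I t s i ≤ psum (codim S I t (s + 1)) i := by
    intro s i
    induction i with
    | zero => rw [psum_apply, Finset.sum_range_one]; exact le_rfl
    | succ i ih =>
      rw [psum_apply, Finset.sum_range_succ, ← psum_apply]
      refine le_trans ?_ (add_le_add_left ih _)
      have := finrank_sup_map_le (t s i) (filt_le hI' hS s i) (map_filt_le hI hS hc s s i)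
      rw [codim, codim, codim, filt]
      push_cast [← Nat.cast_le (α := ℤ)] at this
      linarith
  induction s with
  | zero => exact le_rfl
  | succ s ih =>
    rw [psum_pow_succ]
    exact ih.trans (psum_pow_mono s (h s) i)

end Filtration

/-- If two sequences dominate `a` after `d` summations together but are bounded by `n`, whose
`d`-fold sum is `a`, then everything is an equality. -/
lemma eq_choose_of_psum {d : ℕ} {n a x y x₀ y₀ : ℕ → ℤ} (hxy : ∀ i, x i + y i ≤ n i)
    (hn : (psum ^ d) n = a) (hx : ∀ i, x₀ i ≤ (psum ^ d) x i) (hy : ∀ i, y₀ i ≤ (psum ^ d) y i)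
    (hax : ∀ i, i ≠ 0 → a i ≤ 2 * x₀ i) (hay : ∀ i, i ≠ 0 → a i ≤ 2 * y₀ i)
    (ha0 : a 0 ≤ 1) (hx0 : 1 ≤ x₀ 0) (hy0 : 0 ≤ y₀ 0) (i : ℕ) :
    x i + y i = n i ∧ x i - y i = (-1) ^ i * (d.choose i : ℤ) := by
  have h1 : ∀ i, (psum ^ d) x i + (psum ^ d) y i ≤ a i := by
    intro i
    rw [← hn]
    have := psum_pow_mono d (x := x + y) (y := n) hxy i
    rwa [map_add] at this
  have h2 : x + y = n := by
    refine psum_pow_injective d ?_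
    rw [map_add]
    ext i
    rw [Pi.add_apply, hn]
    have := h1 i
    have := hx i
    have := hy i
    rcases Nat.eq_zero_or_pos i with rfl | hi
    · omega
    · have := hax i hi.ne'
      have := hay i hi.ne'
      omega
  have h3 : x - y = fun j => (-1) ^ j * (d.choose j : ℤ) := by
    refine psum_pow_injective d ?_
    rw [map_sub, psum_pow_choose]
    ext i
    rw [Pi.sub_apply]
    have := h1 i
    have := hx i
    have := hy i
    rcases Nat.eq_zero_or_pos i with rfl | hi
    · rw [if_pos rfl]
      omega
    · have := hax i hi.ne'
      have := hay i hi.ne'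
      rw [if_neg hi.ne']
      omega
  exact ⟨congrFun h2 i, congrFun h3 i⟩

section Rename

variable {ι : Type*} [Fintype ι] [DecidableEq ι] {σ : Equiv.Perm ι}

/-- The permutation action on forms of degree `i`, twisted by `(-1) ^ i`. -/
noncomputable def twist (σ : Equiv.Perm ι) (i : ℕ) :
    homogeneousSubmodule ι ℝ i →ₗ[ℝ] homogeneousSubmodule ι ℝ i :=
  LinearMap.restrict ((-1 : ℝ) ^ i • (rename σ : MvPolynomial ι ℝ →ₐ[ℝ] _).toLinearMap)
    fun _ hf => Submodule.smul_mem _ _ ((mem_homogeneousSubmodule _ _).2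
      (((mem_homogeneousSubmodule _ _).1 hf).rename_isHomogeneous))

lemma twist_coe (i : ℕ) (f : homogeneousSubmodule ι ℝ i) :
    (twist σ i f : MvPolynomial ι ℝ) = (-1 : ℝ) ^ i • rename σ (f : MvPolynomial ι ℝ) := rfl

lemma neg_one_pow_mul_self (i : ℕ) : (-1 : ℝ) ^ i * (-1) ^ i = 1 := by
  rw [← mul_pow]; norm_num

lemma twist_twist (hσ : ∀ v, σ (σ v) = v) (i : ℕ) (f : homogeneousSubmodule ι ℝ i) :
    twist σ i (twist σ i f) = f := by
  apply Subtype.ext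
  rw [twist_coe, twist_coe, map_smul, rename_rename, smul_smul, neg_one_pow_mul_self, one_smul,
    show (σ ∘ σ : ι → ι) = id from funext hσ, rename_id_apply]

lemma twist_mulH {ω : MvPolynomial ι ℝ} (hω : ω.IsHomogeneous 1) {c : ℝ}
    (h : rename σ ω = -c • ω) (i : ℕ) (f : homogeneousSubmodule ι ℝ i) :
    twist σ (i + 1) (mulH hω i f) = c • mulH hω i (twist σ i f) := by
  apply Subtype.ext
  rw [Submodule.coe_smul, twist_coe, mulH_apply, mulH_apply, twist_coe, map_mul, h]
  simp only [neg_smul, smul_mul_assoc, mul_smul_comm, neg_mul, smul_neg, smul_smul, pow_succ]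
  rw [← neg_smul]
  congr 1
  ring

/-- The eigenspace of `twist`. -/
noncomputable def eig (σ : Equiv.Perm ι) (s : ℝ) (i : ℕ) :
    Submodule ℝ (homogeneousSubmodule ι ℝ i) :=
  LinearMap.ker (twist σ i - s • LinearMap.id)

lemma mem_eig {s : ℝ} {i : ℕ} {f : homogeneousSubmodule ι ℝ i} :
    f ∈ eig σ s i ↔ twist σ i f = s • f := by
  rw [eig, LinearMap.mem_ker, LinearMap.sub_apply, sub_eq_zero]
  rfl

lemma mulH_mem_eig {ω : MvPolynomial ι ℝ} (hω : ω.IsHomogeneous 1) {c : ℝ}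
    (h : rename σ ω = -c • ω) {s : ℝ} {i : ℕ} {f : homogeneousSubmodule ι ℝ i}
    (hf : f ∈ eig σ s i) : mulH hω i f ∈ eig σ (c * s) (i + 1) := by
  rw [mem_eig] at hf ⊢
  rw [twist_mulH hω h, hf, map_smul, smul_smul]

lemma exists_eig_add (hσ : ∀ v, σ (σ v) = v) {i : ℕ} (f : homogeneousSubmodule ι ℝ i) :
    (1 / 2 : ℝ) • (f + twist σ i f) ∈ eig σ 1 i ∧
    (1 / 2 : ℝ) • (f - twist σ i f) ∈ eig σ (-1) i ∧
    f = (1 / 2 : ℝ) • (f + twist σ i f) + (1 / 2 : ℝ) • (f - twist σ i f) := by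
  refine ⟨?_, ?_, ?_⟩
  · rw [mem_eig, map_smul, map_add, twist_twist hσ, one_smul, add_comm]
  · rw [mem_eig, map_smul, map_sub, twist_twist hσ]
    module
  · module

lemma eig_inf (i : ℕ) : eig σ 1 i ⊓ eig σ (-1) i = ⊥ := by
  rw [eq_bot_iff]
  rintro f ⟨h1, h2⟩
  rw [SetLike.mem_coe, mem_eig] at h1 h2
  rw [h1] at h2
  have : (2 : ℝ) • f = 0 := by
    calc (2 : ℝ) • f = (1 : ℝ) • f - (-1 : ℝ) • f := by module
      _ = 0 := sub_eq_zero.2 h2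
  exact (smul_eq_zero.1 this).resolve_left (by norm_num)

lemma finrank_eig_add_le (i : ℕ) : Module.finrank ℝ (eig σ 1 i) + Module.finrank ℝ (eig σ (-1) i) ≤
    Module.finrank ℝ (homogeneousSubmodule ι ℝ i) := by
  rw [← Submodule.finrank_sup_add_finrank_inf_eq, eig_inf, finrank_bot, add_zero]
  exact Submodule.finrank_le _

lemma coeff_rename_perm (f : MvPolynomial ι ℝ) (m : ι →₀ ℕ) :
    coeff (m.mapDomain σ) (rename σ f) = coeff m f :=
  coeff_rename_mapDomain σ σ.injective f m

lemma support_mapDomain_perm (m : ι →₀ ℕ) : (m.mapDomain σ).support = m.support.image σ :=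
  Finsupp.mapDomain_support_of_injective σ.injective m

lemma mapDomain_mapDomain (hσ : ∀ v, σ (σ v) = v) (m : ι →₀ ℕ) :
    (m.mapDomain σ).mapDomain σ = m := by
  rw [← Finsupp.mapDomain_comp, show (σ ∘ σ : ι → ι) = id from funext hσ, Finsupp.mapDomain_id]

end Rename

namespace Sys

variable {ι V : Type*} [Fintype ι] [DecidableEq ι] [AddCommGroup V] [Module ℝ V]
  [FiniteDimensional ℝ V] {A : Sys ι V} {η : Module.Dual ℝ V} {σ : Equiv.Perm ι}

/-- Forms of degree `i` with no monomial supported on a face. -/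
noncomputable def SR (A : Sys ι V) (i : ℕ) : Submodule ℝ (homogeneousSubmodule ι ℝ i) where
  carrier := {f | ∀ m : ι →₀ ℕ, A.IsFace m.support → coeff m (f : MvPolynomial ι ℝ) = 0}
  add_mem' := fun hf hg m hm => by
    rw [Submodule.coe_add, coeff_add, hf m hm, hg m hm, add_zero]
  zero_mem' := fun m _ => by simp
  smul_mem' := fun c f hf m hm => by
    rw [Submodule.coe_smul, coeff_smul, hf m hm, smul_zero]

lemma mem_SR {i : ℕ} {f : homogeneousSubmodule ι ℝ i} : f ∈ A.SR i ↔
    ∀ m : ι →₀ ℕ, A.IsFace m.support → coeff m (f : MvPolynomial ι ℝ) = 0 := Iff.rfl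

lemma coeff_mul_eq_zero {f : MvPolynomial ι ℝ}
    (hf : ∀ m : ι →₀ ℕ, A.IsFace m.support → coeff m f = 0) (g : MvPolynomial ι ℝ)
    (m : ι →₀ ℕ) (hm : A.IsFace m.support) : coeff m (g * f) = 0 := by
  classical
  rw [coeff_mul]
  refine Finset.sum_eq_zero fun p hp => ?_
  rw [hf p.2 (hm.subset ?_), mul_zero]
  rw [← Finset.HasAntidiagonal.mem_antidiagonal.1 hp]
  intro v hv
  rw [Finsupp.mem_support_iff] at hv ⊢
  rw [Finsupp.add_apply]
  omega

lemma mulH_mem_SR {ω : MvPolynomial ι ℝ} (hω : ω.IsHomogeneous 1) {i : ℕ}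
    {f : homogeneousSubmodule ι ℝ i} (hf : f ∈ A.SR i) : mulH hω i f ∈ A.SR (i + 1) := by
  intro m hm
  rw [mulH_apply]
  exact coeff_mul_eq_zero hf ω m hm

lemma eval_eq_zero_of_coeff {f : MvPolynomial ι ℝ}
    (hf : ∀ m : ι →₀ ℕ, A.IsFace m.support → coeff m f = 0) {H : Finset ι} (hH : H ∈ A.verts) :
    eval (A.lam H η) f = 0 := by
  rw [eval_eq']
  refine Finset.sum_eq_zero fun m _ => ?_
  by_cases h : m.support ⊆ H
  · rw [hf m ((isFace_of_mem hH).subset h), zero_mul]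
  · obtain ⟨v, hv, hvH⟩ := Finset.not_subset.1 h
    rw [Finset.prod_eq_zero (Finset.mem_univ v), mul_zero]
    rw [lam_of_notMem hvH, zero_pow (Finsupp.mem_support_iff.1 hv)]

lemma IsFace.image (h1 : ∀ v, A.a (σ v) = -A.a v) {F : Finset ι} (hF : A.IsFace F) :
    A.IsFace (F.image σ) := by
  obtain ⟨y, hy, rfl⟩ := hF
  have hs : ∀ v, A.a (σ v) (-y) = A.a v y := fun v => by
    rw [h1, LinearMap.neg_apply, map_neg, neg_neg]
  refine ⟨-y, fun v => ?_, ?_⟩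
  · rw [← σ.apply_symm_apply v, hs]
    exact hy _
  · ext v
    rw [← σ.apply_symm_apply v, mem_tight, hs, Finset.mem_image]
    constructor
    · exact fun h => ⟨_, (mem_tight A).2 h, rfl⟩
    · rintro ⟨w, hw, he⟩
      rw [σ.injective he] at hw
      exact (mem_tight A).1 hw

lemma image_ne (h1 : ∀ v, A.a (σ v) = -A.a v) {F : Finset ι} (hF : A.IsFace F)
    (hne : F.Nonempty) : F.image σ ≠ F := by
  obtain ⟨v, hv⟩ := hne
  obtain ⟨y, hy, rfl⟩ := hF
  intro h
  have h2 : σ v ∈ A.tight y := by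
    rw [← h]
    exact Finset.mem_image_of_mem σ hv
  rw [mem_tight] at hv h2
  rw [h1, LinearMap.neg_apply, hv] at h2
  norm_num at h2

lemma twist_mem_SR (h1 : ∀ v, A.a (σ v) = -A.a v) (hσ : ∀ v, σ (σ v) = v) {i : ℕ}
    {f : homogeneousSubmodule ι ℝ i} (hf : f ∈ A.SR i) : twist σ i f ∈ A.SR i := by
  intro m hm
  rw [twist_coe, coeff_smul, ← mapDomain_mapDomain hσ m, coeff_rename_perm, hf, smul_zero]
  rw [support_mapDomain_perm]
  exact hm.image h1

lemma rename_theta (h1 : ∀ v, A.a (σ v) = -A.a v) (y : V) :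
    rename σ (A.theta y) = -(1 : ℝ) • A.theta y := by
  rw [theta, map_sum, neg_smul, one_smul, ← Finset.sum_neg_distrib,
    ← Equiv.sum_comp σ (fun v => -(C (A.a v y) * X v : MvPolynomial ι ℝ))]
  refine Finset.sum_congr rfl fun v _ => ?_
  rw [map_mul, rename_C, rename_X, h1, LinearMap.neg_apply, C_neg, neg_mul, neg_neg]

lemma rename_sumX : rename σ (sumX ι) = -(-1 : ℝ) • sumX ι := by
  rw [sumX, map_sum, neg_neg, one_smul, ← Equiv.sum_comp σ (fun v => (X v : MvPolynomial ι ℝ))]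
  exact Finset.sum_congr rfl fun v _ => rename_X _ _

end Sys

namespace Sys

variable {ι V : Type*} [Fintype ι] [DecidableEq ι] [AddCommGroup V] [Module ℝ V]
  [FiniteDimensional ℝ V] {A : Sys ι V} {η : Module.Dual ℝ V} {σ : Equiv.Perm ι}

/-- A sequence of vectors whose first `finrank ℝ V` terms form a basis. -/
noncomputable def basisSeq (V : Type*) [AddCommGroup V] [Module ℝ V] [FiniteDimensional ℝ V]
    (k : ℕ) : V :=
  if h : k < Module.finrank ℝ V then Module.finBasis ℝ V ⟨k, h⟩ else 0

/-- Multiplication by the linear form attached to a term of `basisSeq`. -/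
noncomputable def thetaMul (A : Sys ι V) (k i : ℕ) :
    homogeneousSubmodule ι ℝ i →ₗ[ℝ] homogeneousSubmodule ι ℝ (i + 1) :=
  mulH (A.theta_homogeneous (basisSeq V k)) i

/-- The eigenspace of the ideal generated by the nonface monomials and the linear forms
`theta`. -/
noncomputable def eigIdeal (A : Sys ι V) (σ : Equiv.Perm ι) (s : ℝ) (i : ℕ) :
    Submodule ℝ (homogeneousSubmodule ι ℝ i) :=
  filt (eig σ s) (fun i => A.SR i ⊓ eig σ s i) A.thetaMul (Module.finrank ℝ V) i

lemma thetaMul_eig (h1 : ∀ v, A.a (σ v) = -A.a v) (s : ℝ) (k i : ℕ) :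
    (eig σ s i).map (A.thetaMul k i) ≤ eig σ s (i + 1) := by
  rintro _ ⟨f, hf, rfl⟩
  have := mulH_mem_eig (A.theta_homogeneous (basisSeq V k)) (rename_theta h1 _) hf
  rwa [one_mul] at this

lemma eigIdeal_le (h1 : ∀ v, A.a (σ v) = -A.a v) (s : ℝ) (i : ℕ) :
    A.eigIdeal σ s i ≤ eig σ s i :=
  filt_le (fun _ => inf_le_right) (thetaMul_eig h1 s) _ i

lemma SR_le_sup (h1 : ∀ v, A.a (σ v) = -A.a v) (hσ : ∀ v, σ (σ v) = v) (i : ℕ) :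
    A.SR i ≤ A.eigIdeal σ 1 i ⊔ A.eigIdeal σ (-1) i := by
  intro f hf
  obtain ⟨e1, e2, he⟩ := exists_eig_add hσ f
  have ht := twist_mem_SR h1 hσ hf
  rw [he]
  exact Submodule.add_mem_sup
    (le_filt (S := eig σ 1) (I := fun i => A.SR i ⊓ eig σ 1 i) (t := A.thetaMul) _ i
      ⟨Submodule.smul_mem _ _ (Submodule.add_mem _ hf ht), e1⟩)
    (le_filt (S := eig σ (-1)) (I := fun i => A.SR i ⊓ eig σ (-1) i) (t := A.thetaMul) _ i
      ⟨Submodule.smul_mem _ _ (Submodule.sub_mem _ hf ht), e2⟩)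

lemma thetaMul_mem_sup (hσ : ∀ v, σ (σ v) = v) {k : ℕ}
    (hk : k < Module.finrank ℝ V) {i : ℕ} (f : homogeneousSubmodule ι ℝ i) :
    A.thetaMul k i f ∈ A.eigIdeal σ 1 (i + 1) ⊔ A.eigIdeal σ (-1) (i + 1) := by
  obtain ⟨e1, e2, he⟩ := exists_eig_add hσ f
  rw [he, map_add]
  exact Submodule.add_mem_sup
    (map_le_filt (S := eig σ 1) (I := fun i => A.SR i ⊓ eig σ 1 i) (t := A.thetaMul) hk i
      (Submodule.mem_map_of_mem e1))
    (map_le_filt (S := eig σ (-1)) (I := fun i => A.SR i ⊓ eig σ (-1) i) (t := A.thetaMul) hk i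
      (Submodule.mem_map_of_mem e2))

lemma theta_eq_sum (y : V) : A.theta y = ∑ k : Fin (Module.finrank ℝ V),
    (Module.finBasis ℝ V).repr y k • A.theta (basisSeq V k) := by
  simp only [theta, Finset.smul_sum]
  rw [Finset.sum_comm]
  refine Finset.sum_congr rfl fun v _ => ?_
  simp only [smul_eq_C_mul, ← mul_assoc, ← C_mul]
  rw [← Finset.sum_mul, ← map_sum]
  congr 2
  conv_lhs => rw [← (Module.finBasis ℝ V).sum_repr y]
  rw [map_sum]
  exact Finset.sum_congr rfl fun k _ => by simp [basisSeq]

lemma mulH_theta_mem_sup (hσ : ∀ v, σ (σ v) = v) (y : V) {i : ℕ}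
    (f : homogeneousSubmodule ι ℝ i) :
    mulH (A.theta_homogeneous y) i f ∈
      A.eigIdeal σ 1 (i + 1) ⊔ A.eigIdeal σ (-1) (i + 1) := by
  have : mulH (A.theta_homogeneous y) i f = ∑ k : Fin (Module.finrank ℝ V),
      (Module.finBasis ℝ V).repr y k • A.thetaMul k i f := by
    apply Subtype.ext
    rw [mulH_apply, theta_eq_sum, Finset.sum_mul, Submodule.coe_sum]
    refine Finset.sum_congr rfl fun k _ => ?_
    rw [Submodule.coe_smul, thetaMul, mulH_apply, smul_mul_assoc]
  rw [this]
  exact Submodule.sum_mem _ fun k _ => Submodule.smul_mem _ _ (thetaMul_mem_sup hσ k.2 f)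

lemma SR_le_Nul {i k : ℕ} : A.SR i ≤ Nul (A.wsum η ∅ (A.above ∅)) i k := by
  intro f hf
  rw [mem_Nul]
  intro z _
  rw [wsum_apply]
  refine Finset.sum_eq_zero fun H hH => ?_
  rw [map_mul, eval_eq_zero_of_coeff hf (mem_above.1 hH).1, zero_mul, mul_zero]

lemma eigIdeal_le_Nul (hη : A.Gen η) {s : ℝ} {i k : ℕ} (hd : i + k = Module.finrank ℝ V) :
    A.eigIdeal σ s i ≤ Nul (A.wsum η ∅ (A.above ∅)) i k := by
  have key : A.eigIdeal σ s i ≤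
      Nul (A.wsum η ∅ (A.above ∅)) i (Module.finrank ℝ V - i) ⊔
        (if i ≤ Module.finrank ℝ V then ⊥ else ⊤) := by
    refine filt_le_of (S := eig σ s) (I := fun i => A.SR i ⊓ eig σ s i) (t := A.thetaMul)
      (Module.finrank ℝ V) (N := fun i => Nul (A.wsum η ∅ (A.above ∅)) i (Module.finrank ℝ V - i) ⊔
        (if i ≤ Module.finrank ℝ V then ⊥ else ⊤))
      (fun i => inf_le_left.trans (SR_le_Nul.trans le_sup_left)) (fun l i => ?_) i
    split_ifs with hi
    · refine le_trans ?_ le_sup_left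
      rintro _ ⟨f, -, rfl⟩
      rw [mem_Nul]
      intro z hz
      rw [thetaMul, mulH_apply, mul_assoc, wsum_theta_mul above_subset,
        wsum_above_eq_zero hη (k := i + (Module.finrank ℝ V - (i + 1))) (by simp; omega)
          (f.2.mul hz), mul_zero]
    · exact le_top.trans le_sup_right
  rw [if_pos (by omega), sup_bot_eq, show Module.finrank ℝ V - i = k by omega] at key
  exact key

lemma monomial_eq_xm {m : ι →₀ ℕ} (h : ∀ v ∈ m.support, m v = 1) :
    (monomial m 1 : MvPolynomial ι ℝ) = xm m.support := by
  rw [monomial_eq, C_1, one_mul, xm]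
  exact Finset.prod_congr rfl fun v hv => by simp only [h v hv, pow_one]

end Sys

namespace Sys

variable {ι V : Type*} [Fintype ι] [DecidableEq ι] [AddCommGroup V] [Module ℝ V]
  [FiniteDimensional ℝ V] {A : Sys ι V} {η : Module.Dual ℝ V} {σ : Equiv.Perm ι}

/-- The span of the monomials attached to the vertices of index `i`. -/
noncomputable def vertSpan (A : Sys ι V) (η : Module.Dual ℝ V) (i : ℕ) :
    Submodule ℝ (homogeneousSubmodule ι ℝ i) :=
  Submodule.span ℝ (Set.range fun H : {H // H ∈ (A.above ∅).filter
    fun H => (A.neg ∅ H η).card = i} => (⟨xm (A.neg ∅ H η), by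
      have := xm_homogeneous (A.neg ∅ H η)
      rw [(Finset.mem_filter.1 H.2).2] at this
      exact this⟩ : homogeneousSubmodule ι ℝ i))

lemma finrank_vertSpan_le (i : ℕ) : Module.finrank ℝ (A.vertSpan η i) ≤ A.idx η ∅ i := by
  refine (finrank_range_le_card (R := ℝ) _).trans ?_
  rw [Fintype.card_coe]
  exact le_rfl

/-- The sum of the eigenspaces of the ideal and the monomials attached to vertices. -/
noncomputable def stdSpan (A : Sys ι V) (η : Module.Dual ℝ V) (σ : Equiv.Perm ι) (i : ℕ) :
    Submodule ℝ (MvPolynomial ι ℝ) :=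
  (A.eigIdeal σ 1 i ⊔ A.eigIdeal σ (-1) i ⊔ A.vertSpan η i).map (Submodule.subtype _)

lemma theta_mul_mem_stdSpan (hσ : ∀ v, σ (σ v) = v) (y : V) {i : ℕ} {f : MvPolynomial ι ℝ}
    (hf : f.IsHomogeneous i) : A.theta y * f ∈ A.stdSpan η σ (i + 1) :=
  ⟨_, Submodule.mem_sup_left (mulH_theta_mem_sup hσ y ⟨f, hf⟩), rfl⟩

lemma monomial_homogeneous (m : ι →₀ ℕ) :
    (monomial m 1 : MvPolynomial ι ℝ).IsHomogeneous m.degree :=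
  isHomogeneous_monomial 1 rfl

lemma monomial_mem_of_not_isFace (h1 : ∀ v, A.a (σ v) = -A.a v) (hσ : ∀ v, σ (σ v) = v)
    {m : ι →₀ ℕ} (hm : ¬A.IsFace m.support) : monomial m 1 ∈ A.stdSpan η σ m.degree := by
  refine ⟨⟨monomial m 1, monomial_homogeneous m⟩, Submodule.mem_sup_left
    (SR_le_sup h1 hσ _ fun m' hm' => ?_), rfl⟩
  rw [coeff_monomial, if_neg]
  rintro rfl
  exact hm hm'

lemma exists_first (hη : A.Gen η) {F : Finset ι} (hF : A.IsFace F) :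
    ∃ H ∈ A.verts, A.neg ∅ H η ⊆ F ∧ F ⊆ H := by
  obtain ⟨H, hH, hFH, hp⟩ := exists_max hη hF
  refine ⟨H, hH, fun w hw => ?_, hFH⟩
  obtain ⟨hwH, -, hlt⟩ := mem_neg.1 hw
  by_contra hwF
  exact absurd (hp w hwH hwF) (not_lt.2 hlt.le)

lemma X_mul_monomial_eq {H : Finset ι} (hH : H ∈ A.verts) {w : ι} (hw : w ∈ H)
    (f : MvPolynomial ι ℝ) : X w * f = A.theta (A.dv H w) * f -
      ∑ v ∈ Finset.univ \ H, A.a v (A.dv H w) • (X v * f) := by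
  have : A.theta (A.dv H w) =
      X w + ∑ v ∈ Finset.univ \ H, A.a v (A.dv H w) • (X v : MvPolynomial ι ℝ) := by
    rw [theta, ← Finset.sum_sdiff (Finset.subset_univ H), add_comm]
    congr 1
    · rw [Finset.sum_eq_single_of_mem w hw]
      · rw [(isFace_of_mem hH).dv_spec hw, if_pos rfl, C_1, one_mul]
      · intro v hv hvw
        rw [(isFace_of_mem hH).dv_spec hv, if_neg hvw, C_0, zero_mul]
    · exact Finset.sum_congr rfl fun v _ => by rw [smul_eq_C_mul]
  rw [this, add_mul, Finset.sum_mul]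
  simp only [smul_mul_assoc, add_sub_cancel_right]

lemma X_mul_monomial (v : ι) (m : ι →₀ ℕ) :
    X v * monomial m 1 = (monomial (Finsupp.single v 1 + m) 1 : MvPolynomial ι ℝ) := by
  rw [X, monomial_mul, one_mul]

lemma monomial_mem_stdSpan_of_vert (h1 : ∀ v, A.a (σ v) = -A.a v) (hσ : ∀ v, σ (σ v) = v)
    (hη : A.Gen η) (n : ℕ) : ∀ (H : Finset ι) (m : ι →₀ ℕ), H ∈ A.verts →
    (A.verts.filter fun K => η (A.pt K) < η (A.pt H)).card = n →
    A.neg ∅ H η ⊆ m.support → m.support ⊆ H → monomial m 1 ∈ A.stdSpan η σ m.degree := by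
  induction n using Nat.strong_induction_on with
  | _ n ih =>
  intro H m hH hn hneg hsub
  by_cases hex : ∃ w ∈ m.support, w ∉ A.neg ∅ H η ∨ 2 ≤ m w
  · obtain ⟨w, hw, hw2⟩ := hex
    obtain ⟨m', rfl⟩ : ∃ m', m = Finsupp.single w 1 + m' := by
      refine ⟨m - Finsupp.single w 1, (add_tsub_cancel_of_le ?_).symm⟩
      rw [Finsupp.single_le_iff]
      exact Nat.one_le_iff_ne_zero.2 (Finsupp.mem_support_iff.1 hw)
    have hneg' : A.neg ∅ H η ⊆ m'.support := by
      intro v hv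
      have h2 := hneg hv
      rw [Finsupp.mem_support_iff, Finsupp.add_apply] at h2
      rw [Finsupp.mem_support_iff]
      by_cases hvw : w = v
      · subst hvw
        rcases hw2 with h | h
        · exact absurd hv h
        · rw [Finsupp.add_apply, Finsupp.single_eq_same] at h
          omega
      · rwa [Finsupp.single_eq_of_ne (Ne.symm hvw), zero_add] at h2
    have hdeg : ∀ v, (Finsupp.single v 1 + m').degree = m'.degree + 1 := fun v => by
      rw [map_add, Finsupp.degree_single, add_comm]
    rw [hdeg, ← X_mul_monomial, X_mul_monomial_eq hH (hsub hw)]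
    refine Submodule.sub_mem _ (theta_mul_mem_stdSpan hσ _ (monomial_homogeneous m'))
      (Submodule.sum_mem _ fun v hv => Submodule.smul_mem _ _ ?_)
    rw [X_mul_monomial, ← hdeg v]
    by_cases hF : A.IsFace (Finsupp.single v 1 + m').support
    · obtain ⟨K, hK, hnK, hmK⟩ := exists_first hη hF
      have hvK : v ∈ K := hmK (by simp)
      have hm'K : m'.support ⊆ K := by
        intro u hu
        refine hmK ?_
        rw [Finsupp.mem_support_iff] at hu ⊢
        rw [Finsupp.add_apply]
        omega
      have h3 := vert_le_of_lam_pos hH hK (τ := η) fun u hu huK => by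
        refine lt_of_le_of_ne (not_lt.1 fun hlt => huK ?_) (hη.lam_ne hH hu).symm
        exact hm'K (hneg' (mem_neg.2 ⟨hu, by simp, hlt⟩))
      have h4 : η (A.pt K) < η (A.pt H) := by
        refine lt_of_le_of_ne h3.1 fun he => ?_
        rw [h3.2 he] at hvK
        exact (Finset.mem_sdiff.1 hv).2 hvK
      refine ih _ ?_ K _ hK rfl hnK hmK
      rw [← hn]
      refine Finset.card_lt_card (Finset.ssubset_iff_of_subset ?_ |>.2 ⟨K, ?_, ?_⟩)
      · intro L hL
        rw [Finset.mem_filter] at hL ⊢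
        exact ⟨hL.1, hL.2.trans h4⟩
      · exact Finset.mem_filter.2 ⟨hK, h4⟩
      · simp
    · exact monomial_mem_of_not_isFace h1 hσ hF
  · push Not at hex
    have he : m.support = A.neg ∅ H η :=
      Finset.Subset.antisymm (fun w hw => (hex w hw).1) hneg
    have h1m : ∀ v ∈ m.support, m v = 1 := fun v hv => by
      have := (hex v hv).2
      have := Finsupp.mem_support_iff.1 hv
      omega
    have hdeg : (A.neg ∅ H η).card = m.degree := by
      rw [Finsupp.degree, ← he, Finset.card_eq_sum_ones]
      exact (Finset.sum_congr rfl h1m).symm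
    refine ⟨_, Submodule.mem_sup_right (Submodule.subset_span
      ⟨⟨H, Finset.mem_filter.2 ⟨mem_above.2 ⟨hH, Finset.empty_subset _⟩, hdeg⟩⟩, rfl⟩), ?_⟩
    rw [monomial_eq_xm h1m, he]
    rfl

lemma top_le_sup (h1 : ∀ v, A.a (σ v) = -A.a v) (hσ : ∀ v, σ (σ v) = v) (hη : A.Gen η) (i : ℕ) :
    ⊤ ≤ A.eigIdeal σ 1 i ⊔ A.eigIdeal σ (-1) i ⊔ A.vertSpan η i := by
  rintro ⟨f, hf⟩ -
  have : f ∈ A.stdSpan η σ i := by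
    rw [f.as_sum]
    refine Submodule.sum_mem _ fun m hm => ?_
    obtain rfl : m.degree = i := by
      have h := (mem_homogeneousSubmodule _ _).1 hf (mem_support_iff.1 hm)
      exact (DFunLike.congr_fun (Finsupp.degree_eq_weight_one (R := ℕ)) m).trans h
    rw [show monomial m (coeff m f) = coeff m f • (monomial m 1 : MvPolynomial ι ℝ) by
      rw [smul_monomial, smul_eq_mul, mul_one]]
    refine Submodule.smul_mem _ _ ?_
    by_cases hF : A.IsFace m.support
    · obtain ⟨H, hH, hn, hs⟩ := exists_first hη hF
      exact monomial_mem_stdSpan_of_vert h1 hσ hη _ H m hH rfl hn hs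
    · exact monomial_mem_of_not_isFace h1 hσ hF
  obtain ⟨g, hg, he⟩ := this
  rwa [show (⟨f, hf⟩ : homogeneousSubmodule ι ℝ i) = g from Subtype.ext he.symm]

lemma finrank_le_eigIdeal_add (h1 : ∀ v, A.a (σ v) = -A.a v) (hσ : ∀ v, σ (σ v) = v)
    (hη : A.Gen η) (i : ℕ) : Module.finrank ℝ (homogeneousSubmodule ι ℝ i) ≤
      Module.finrank ℝ (A.eigIdeal σ 1 i) + Module.finrank ℝ (A.eigIdeal σ (-1) i) +
        A.idx η ∅ i := by
  have h := Submodule.finrank_mono (top_le_sup h1 hσ hη i)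
  rw [finrank_top] at h
  have h2 := Submodule.finrank_add_le_finrank_add_finrank
    (A.eigIdeal σ 1 i ⊔ A.eigIdeal σ (-1) i) (A.vertSpan η i)
  have h3 := Submodule.finrank_add_le_finrank_add_finrank (A.eigIdeal σ 1 i) (A.eigIdeal σ (-1) i)
  have h4 := finrank_vertSpan_le (A := A) (η := η) i
  omega

end Sys

namespace Sys

variable {ι V : Type*} [Fintype ι] [DecidableEq ι] [AddCommGroup V] [Module ℝ V]
  [FiniteDimensional ℝ V] {A : Sys ι V} {η : Module.Dual ℝ V} {σ : Equiv.Perm ι}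

lemma isFace_empty : A.IsFace ∅ :=
  ⟨0, fun v => by simp, by ext v; simp [mem_tight A]⟩

open Classical in
/-- The exponents of degree `i` supported on faces. -/
noncomputable def faceExp (A : Sys ι V) (i : ℕ) : Finset (ι →₀ ℕ) :=
  (Finset.univ.finsuppAntidiag i).filter fun m => A.IsFace m.support

lemma mem_faceExp {i : ℕ} {m : ι →₀ ℕ} :
    m ∈ A.faceExp i ↔ m.degree = i ∧ A.IsFace m.support := by
  classical
  rw [faceExp, Finset.mem_filter, Finset.mem_finsuppAntidiag']
  simp only [Finset.subset_univ, and_true]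
  rfl

/-- The exponents of degree `i` whose support is between two given sets. -/
noncomputable def expBetween (N H : Finset ι) (i : ℕ) : Finset (ι →₀ ℕ) :=
  (H.finsuppAntidiag i).filter fun m => N ⊆ m.support

lemma mem_expBetween {N H : Finset ι} {i : ℕ} {m : ι →₀ ℕ} :
    m ∈ expBetween N H i ↔ m.degree = i ∧ m.support ⊆ H ∧ N ⊆ m.support := by
  rw [expBetween, Finset.mem_filter, Finset.mem_finsuppAntidiag', and_assoc]
  rfl

/-- The exponent of a squarefree monomial. -/
noncomputable def indExp (N : Finset ι) : ι →₀ ℕ := Finsupp.indicator N fun _ _ => 1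

lemma indExp_apply (N : Finset ι) (v : ι) : indExp N v = if v ∈ N then 1 else 0 := by
  simp [indExp, Finsupp.indicator_apply]

lemma degree_indExp (N : Finset ι) : (indExp N).degree = N.card := by
  rw [Finsupp.degree_eq_sum]
  simp [indExp_apply]

lemma card_expBetween {N H : Finset ι} (h : N ⊆ H) (i : ℕ) :
    (expBetween N H i).card = if N.card ≤ i then H.card.multichoose (i - N.card) else 0 := by
  split_ifs with hi
  · rw [← Finset.card_finsuppAntidiag_nat_eq_multichoose]
    symm
    refine Finset.card_bij (fun m _ => m + indExp N) ?_ (fun _ _ _ _ h => add_right_cancel h) ?_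
    · intro m hm
      rw [Finset.mem_finsuppAntidiag'] at hm
      have hd : m.degree = i - N.card := hm.1
      refine mem_expBetween.2 ⟨by rw [map_add, hd, degree_indExp]; omega, fun v hv => ?_,
        fun v hv => ?_⟩
      · by_contra hvH
        rw [Finsupp.mem_support_iff, Finsupp.add_apply, indExp_apply, if_neg fun h' => hvH (h h'),
          add_zero, ← Finsupp.mem_support_iff] at hv
        exact hvH (hm.2 hv)
      · rw [Finsupp.mem_support_iff, Finsupp.add_apply, indExp_apply, if_pos hv]
        omega
    · intro m hm
      obtain ⟨hd, hH, hN⟩ := mem_expBetween.1 hm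
      have hle : indExp N ≤ m := fun v => by
        rw [indExp_apply]
        split_ifs with hv
        · have := Finsupp.mem_support_iff.1 (hN hv)
          omega
        · exact Nat.zero_le _
      refine ⟨m - indExp N, ?_, tsub_add_cancel_of_le hle⟩
      rw [Finset.mem_finsuppAntidiag']
      refine ⟨?_, fun v hv => hH ?_⟩
      · change (m - indExp N).degree = _
        have := congrArg Finsupp.degree (tsub_add_cancel_of_le hle)
        rw [map_add, degree_indExp, hd] at this
        omega
      · rw [Finsupp.mem_support_iff] at hv ⊢
        rw [Finsupp.tsub_apply] at hv
        omega
  · rw [Finset.card_eq_zero, Finset.eq_empty_iff_forall_notMem]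
    intro m hm
    obtain ⟨hd, hH, hN⟩ := mem_expBetween.1 hm
    refine hi ((Finset.card_le_card hN).trans ?_)
    rw [← hd, Finsupp.degree, Finset.card_eq_sum_ones]
    exact Finset.sum_le_sum fun v hv => Nat.one_le_iff_ne_zero.2 (Finsupp.mem_support_iff.1 hv)

lemma card_faceExp (hη : A.Gen η) (i : ℕ) : (A.faceExp i).card =
    ∑ H ∈ A.above ∅, (expBetween (A.neg ∅ H η) H i).card := by
  have : A.faceExp i = (A.above ∅).biUnion fun H => expBetween (A.neg ∅ H η) H i := by
    ext m
    simp only [mem_faceExp, Finset.mem_biUnion, mem_expBetween, mem_above]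
    constructor
    · rintro ⟨hd, hF⟩
      obtain ⟨H, hH, hn, hs⟩ := exists_first hη hF
      exact ⟨H, ⟨hH, Finset.empty_subset _⟩, hd, hs, hn⟩
    · rintro ⟨H, ⟨hH, -⟩, hd, hs, hn⟩
      exact ⟨hd, (isFace_of_mem hH).subset hs⟩
  rw [this, Finset.card_biUnion]
  intro H hH K hK hne
  rw [Function.onFun, Finset.disjoint_left]
  intro m hm hm'
  rw [mem_expBetween] at hm hm'
  exact hne (eq_of_neg_subset hη (mem_above.1 hH).1 (mem_above.1 hK).1 hm.2.1 hm'.2.1 hm.2.2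
    hm'.2.2 (Finset.empty_subset _))

lemma psum_idx (hη : A.Gen η) : (psum ^ Module.finrank ℝ V) (fun j => (A.idx η ∅ j : ℤ)) =
    fun i => ((A.faceExp i).card : ℤ) := by
  have : (fun j => (A.idx η ∅ j : ℤ)) =
      ∑ H ∈ A.above ∅, fun k => if k = (A.neg ∅ H η).card then (1 : ℤ) else 0 := by
    funext j
    rw [Finset.sum_apply, idx, Finset.card_filter]
    push_cast
    exact Finset.sum_congr rfl fun H _ => if_congr eq_comm rfl rfl
  funext i
  rw [this, map_sum, Finset.sum_apply, card_faceExp hη]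
  push_cast
  refine Finset.sum_congr rfl fun H hH => ?_
  rw [psum_pow_single, card_expBetween fun v hv => (mem_neg.1 hv).1,
    card_of_mem (mem_above.1 hH).1]
  push_cast
  rfl

end Sys

namespace Sys

variable {ι V : Type*} [Fintype ι] [DecidableEq ι] [AddCommGroup V] [Module ℝ V]
  [FiniteDimensional ℝ V] {A : Sys ι V} {η : Module.Dual ℝ V} {σ : Equiv.Perm ι}

lemma mapDomain_mem_faceExp (h1 : ∀ v, A.a (σ v) = -A.a v) {i : ℕ} {m : ι →₀ ℕ}
    (hm : m ∈ A.faceExp i) : m.mapDomain σ ∈ A.faceExp i := by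
  rw [mem_faceExp] at hm ⊢
  refine ⟨?_, ?_⟩
  · rw [Finsupp.degree_mapDomain]
    exact hm.1
  · rw [support_mapDomain_perm]
    exact hm.2.image h1

lemma exists_half (h1 : ∀ v, A.a (σ v) = -A.a v) (hσ : ∀ v, σ (σ v) = v) {i : ℕ} (hi : i ≠ 0) :
    ∃ E ⊆ A.faceExp i, (A.faceExp i).card ≤ 2 * E.card ∧
      ∀ m ∈ E, ∀ m' ∈ E, m'.mapDomain σ ≠ m := by
  obtain ⟨key, hkey⟩ := Countable.exists_injective_nat (ι →₀ ℕ)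
  set E := (A.faceExp i).filter fun m => key m < key (m.mapDomain σ) with hE
  refine ⟨E, Finset.filter_subset _ _, ?_, ?_⟩
  · have h : A.faceExp i ⊆ E ∪ E.image (fun m => m.mapDomain σ) := by
      intro m hm
      have hne : m.mapDomain σ ≠ m := by
        intro he
        obtain ⟨hd, hF⟩ := mem_faceExp.1 hm
        refine image_ne h1 hF ?_ ((support_mapDomain_perm (σ := σ) m).symm.trans (by rw [he]))
        rw [Finsupp.support_nonempty_iff]
        rintro rfl
        exact hi (by rw [← hd, map_zero])
      rcases lt_or_gt_of_ne (fun he => hne (hkey he)) with h | h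
      · refine Finset.mem_union_right _ (Finset.mem_image.2 ⟨m.mapDomain σ, ?_,
          mapDomain_mapDomain hσ m⟩)
        refine Finset.mem_filter.2 ⟨mapDomain_mem_faceExp h1 hm, ?_⟩
        rwa [mapDomain_mapDomain hσ]
      · exact Finset.mem_union_left _ (Finset.mem_filter.2 ⟨hm, h⟩)
    have h2 := (Finset.card_le_card h).trans (Finset.card_union_le _ _)
    have h3 : (E.image fun m => m.mapDomain σ).card ≤ E.card := Finset.card_image_le
    omega
  · rintro m hm m' hm' rfl
    have h2 := (Finset.mem_filter.1 hm).2
    rw [mapDomain_mapDomain hσ] at h2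
    exact absurd h2 (not_lt.2 (Finset.mem_filter.1 hm').2.le)

/-- The coefficient functional on forms. -/
noncomputable def coeffH (i : ℕ) (m : ι →₀ ℕ) : homogeneousSubmodule ι ℝ i →ₗ[ℝ] ℝ :=
  (lcoeff ℝ m).comp (Submodule.subtype _)

lemma coeffH_apply (i : ℕ) (m : ι →₀ ℕ) (f : homogeneousSubmodule ι ℝ i) :
    coeffH i m f = coeff m (f : MvPolynomial ι ℝ) := rfl

lemma card_add_finrank_SR_le (h1 : ∀ v, A.a (σ v) = -A.a v) (hσ : ∀ v, σ (σ v) = v) {i : ℕ}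
    (hi : i ≠ 0) {s : ℝ} (hs : s * s = 1) :
    (A.faceExp i).card + 2 * Module.finrank ℝ ↥(A.SR i ⊓ eig σ s i) ≤
      2 * Module.finrank ℝ (eig σ s i) := by
  obtain ⟨E, hE, hcard, hfree⟩ := exists_half h1 hσ hi
  let u : (ι →₀ ℕ) → homogeneousSubmodule ι ℝ i := fun m =>
    if h : m.degree = i then
      let e : homogeneousSubmodule ι ℝ i := ⟨monomial m 1, isHomogeneous_monomial 1 h⟩
      e + s • twist σ i e
    else 0
  have hu : ∀ m ∈ E, (u m : MvPolynomial ι ℝ) =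
      monomial m 1 + (s * (-1) ^ i) • monomial (m.mapDomain σ) 1 := by
    intro m hm
    simp only [u, dif_pos (mem_faceExp.1 (hE hm)).1]
    rw [Submodule.coe_add, Submodule.coe_smul, twist_coe, rename_monomial, smul_smul]
  have h := card_add_finrank_le_of_dual (K := A.SR i ⊓ eig σ s i) (S := eig σ s i) inf_le_right E
    (coeffH i) (fun m hm f hf => ?_) u (fun m hm => ?_) (fun m hm => ?_) fun m hm m' hm' hne => ?_
  · omega
  · rw [LinearMap.mem_ker, coeffH_apply]
    exact mem_SR.1 hf.1 m (mem_faceExp.1 (hE hm)).2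
  · simp only [u, dif_pos (mem_faceExp.1 (hE hm)).1]
    rw [mem_eig, map_add, map_smul, twist_twist hσ, smul_add, smul_smul, hs, one_smul, add_comm]
  · rw [coeffH_apply, hu m hm, coeff_add, coeff_smul, coeff_monomial, coeff_monomial, if_pos rfl,
      if_neg (hfree m hm m hm), smul_zero, add_zero]
  · rw [coeffH_apply, hu m' hm', coeff_add, coeff_smul, coeff_monomial, coeff_monomial,
      if_neg hne.symm, if_neg (hfree m hm m' hm'), smul_zero, add_zero]

lemma one_add_finrank_SR_zero_le :
    1 + Module.finrank ℝ ↥(A.SR 0 ⊓ eig σ 1 0) ≤ Module.finrank ℝ (eig σ (1 : ℝ) 0) := by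
  have h := card_add_finrank_le_of_dual (K := A.SR 0 ⊓ eig σ 1 0) (S := eig σ 1 0) inf_le_right
    {(0 : ι →₀ ℕ)} (coeffH 0) (fun m hm f hf => ?_)
    (fun _ => ⟨1, isHomogeneous_one ι ℝ⟩) (fun m hm => ?_) (fun m hm => ?_)
    fun m hm m' hm' hne => ?_
  · simpa using h
  · rw [Finset.mem_singleton.1 hm, LinearMap.mem_ker, coeffH_apply]
    exact mem_SR.1 hf.1 0 (by simpa using isFace_empty)
  · rw [mem_eig]
    apply Subtype.ext
    rw [twist_coe]
    simp
  · rw [Finset.mem_singleton.1 hm, coeffH_apply]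
    simp
  · rw [Finset.mem_singleton] at hm hm'
    exact absurd (hm.trans hm'.symm) hne

lemma card_faceExp_zero : (A.faceExp 0).card ≤ 1 := by
  rw [Finset.card_le_one]
  intro a ha b hb
  rw [mem_faceExp, Finsupp.degree_eq_zero_iff] at ha hb
  rw [ha.1, hb.1]

/-- The codimension of the ideal in the eigenspaces. -/
noncomputable def quo (A : Sys ι V) (σ : Equiv.Perm ι) (s : ℝ) (i : ℕ) : ℤ :=
  Module.finrank ℝ (eig σ s i) - Module.finrank ℝ (A.eigIdeal σ s i)

lemma codim_SR_le (h1 : ∀ v, A.a (σ v) = -A.a v) (s : ℝ) (i : ℕ) :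
    (Module.finrank ℝ (eig σ s i) : ℤ) - Module.finrank ℝ ↥(A.SR i ⊓ eig σ s i) ≤
      (psum ^ Module.finrank ℝ V) (A.quo σ s) i := by
  refine codim_zero_le (S := eig σ s) (I := fun i => A.SR i ⊓ eig σ s i) (t := A.thetaMul)
    (fun i => inf_le_right) ?_ (thetaMul_eig h1 s) ?_ (Module.finrank ℝ V) i
  · rintro k i _ ⟨f, hf, rfl⟩
    exact ⟨mulH_mem_SR _ hf.1, thetaMul_eig h1 s k i ⟨f, hf.2, rfl⟩⟩
  · intro k l i u
    apply Subtype.ext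
    simp only [thetaMul, mulH_apply]
    ring

lemma quo_eq (h1 : ∀ v, A.a (σ v) = -A.a v) (hσ : ∀ v, σ (σ v) = v) (hη : A.Gen η) (i : ℕ) :
    A.quo σ 1 i + A.quo σ (-1) i = A.idx η ∅ i ∧
    A.quo σ 1 i - A.quo σ (-1) i = (-1) ^ i * ((Module.finrank ℝ V).choose i : ℤ) := by
  refine eq_choose_of_psum (n := fun i => (A.idx η ∅ i : ℤ)) (a := fun i => ((A.faceExp i).card : ℤ))
    (fun i => ?_) (psum_idx hη) (codim_SR_le h1 1) (codim_SR_le h1 (-1)) (fun i hi => ?_)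
    (fun i hi => ?_) (by exact_mod_cast card_faceExp_zero) ?_ ?_ i
  · have h2 := finrank_eig_add_le (σ := σ) i
    have h3 := finrank_le_eigIdeal_add h1 hσ hη i
    unfold quo
    omega
  · have := card_add_finrank_SR_le h1 hσ hi (s := 1) (by norm_num)
    omega
  · have := card_add_finrank_SR_le h1 hσ hi (s := -1) (by norm_num)
    omega
  · have := one_add_finrank_SR_zero_le (A := A) (σ := σ)
    omega
  · have := Submodule.finrank_mono (inf_le_right : A.SR 0 ⊓ eig σ (-1) 0 ≤ eig σ (-1) 0)
    omega

lemma Nul_inf_eig_le (h1 : ∀ v, A.a (σ v) = -A.a v) (hσ : ∀ v, σ (σ v) = v) (hη : A.Gen η)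
    {j k : ℕ} (hd : j + k = Module.finrank ℝ V) {s : ℝ} (hs : s = 1 ∨ s = -1) :
    Nul (A.wsum η ∅ (A.above ∅)) j k ⊓ eig σ s j ≤ A.eigIdeal σ s j := by
  set N := Nul (A.wsum η ∅ (A.above ∅)) j k
  have hle : ∀ s, A.eigIdeal σ s j ≤ N ⊓ eig σ s j := fun s =>
    le_inf (eigIdeal_le_Nul hη hd) (eigIdeal_le h1 s j)
  have h2 := idx_add_finrank_Nul_le (A := A) (G := ∅) hη (j := j) (k := k) (by simpa using hd)
  change _ + Module.finrank ℝ N ≤ _ at h2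
  have h3 := finrank_le_eigIdeal_add h1 hσ hη j
  have h4 := Submodule.finrank_sup_add_finrank_inf_eq (N ⊓ eig σ 1 j) (N ⊓ eig σ (-1) j)
  have h5 : (N ⊓ eig σ 1 j) ⊓ (N ⊓ eig σ (-1) j) = ⊥ := by
    rw [eq_bot_iff, ← eig_inf (σ := σ) j]
    exact inf_le_inf inf_le_right inf_le_right
  rw [h5, finrank_bot] at h4
  have h6 : Module.finrank ℝ ↥((N ⊓ eig σ 1 j) ⊔ (N ⊓ eig σ (-1) j)) ≤ Module.finrank ℝ N :=
    Submodule.finrank_mono (sup_le inf_le_left inf_le_left)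
  have h7 := Submodule.finrank_mono (hle 1)
  have h8 := Submodule.finrank_mono (hle (-1))
  have h9 : Module.finrank ℝ ↥(N ⊓ eig σ s j) ≤ Module.finrank ℝ (A.eigIdeal σ s j) := by
    rcases hs with rfl | rfl
    · omega
    · omega
  exact (Submodule.eq_of_le_of_finrank_le (hle s) h9).ge

lemma quo_le_quo (h1 : ∀ v, A.a (σ v) = -A.a v) (hσ : ∀ v, σ (σ v) = v) (hη : A.Gen η)
    {j : ℕ} (hj : 2 * (j + 1) ≤ Module.finrank ℝ V) {s : ℝ} (hs : s = 1 ∨ s = -1) :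
    A.quo σ s j ≤ A.quo σ (-s) (j + 1) := by
  obtain ⟨m, hm⟩ : ∃ m, Module.finrank ℝ V = 2 * j + (m + 1) :=
    ⟨Module.finrank ℝ V - (2 * j + 1), by omega⟩
  have hω : ∀ f ∈ eig σ s j, mulH (sumX_homogeneous (ι := ι)) j f ∈ eig σ (-s) (j + 1) :=
    fun f hf => by
      have := mulH_mem_eig (sumX_homogeneous (ι := ι)) rename_sumX hf
      rwa [neg_one_mul] at this
  have h := finrank_add_le_of_comap_le (mulH (sumX_homogeneous (ι := ι)) j)
    (K := A.eigIdeal σ s j) (S := eig σ s j) (N := A.eigIdeal σ (-s) (j + 1))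
    (T := eig σ (-s) (j + 1)) (by rintro _ ⟨f, hf, rfl⟩; exact hω f hf) (eigIdeal_le h1 _ _) ?_
  · unfold quo
    omega
  · intro u hu hN
    refine Nul_inf_eig_le h1 hσ hη (k := j + (m + 1)) (by omega) hs ⟨?_, hu⟩
    refine mem_Nul.2 ((HL_face hη _ ∅ j (m + 1) isFace_empty (by simp) hm).1 u u.2 fun y hy => ?_)
    have h2 := mem_Nul.1 (eigIdeal_le_Nul hη (k := m + j) (by omega) hN) (sumX ι ^ m * y)
      (by simpa using (sumX_homogeneous.pow m).mul hy)
    rw [mulH_apply] at h2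
    rw [← h2]
    congr 1
    ring

theorem choose_sub_choose_le (h1 : ∀ v, A.a (σ v) = -A.a v) (hσ : ∀ v, σ (σ v) = v) (hη : A.Gen η)
    {j : ℕ} (hj : 2 * (j + 1) ≤ Module.finrank ℝ V) :
    ((Module.finrank ℝ V).choose (j + 1) : ℤ) - (Module.finrank ℝ V).choose j ≤
      A.idx η ∅ (j + 1) - A.idx η ∅ j := by
  obtain ⟨h2, h3⟩ := quo_eq h1 hσ hη j
  obtain ⟨h4, h5⟩ := quo_eq h1 hσ hη (j + 1)
  have h6 := quo_le_quo h1 hσ hη hj (Or.inl rfl)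
  have h7 := quo_le_quo h1 hσ hη hj (Or.inr rfl)
  rw [neg_neg] at h7
  rcases neg_one_pow_eq_or ℤ j with h | h
  · rw [pow_succ, h] at h5
    rw [h] at h3
    linarith
  · rw [pow_succ, h] at h5
    rw [h] at h3
    linarith

end Sys

lemma sum_neg_one_pow_choose (n : ℕ) :
    ∑ t ∈ Finset.range (n + 1), (-1 : ℤ) ^ (n - t) * (n.choose t : ℤ) = if n = 0 then 1 else 0 := by
  rw [← Int.alternating_sum_range_choose, ← Finset.sum_range_reflect]
  refine Finset.sum_congr rfl fun t ht => ?_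
  have ht' : t ≤ n := Nat.lt_succ_iff.1 (Finset.mem_range.1 ht)
  rw [show n + 1 - 1 - t = n - t by omega, Nat.choose_symm ht', show n - (n - t) = t by omega]

lemma choose_inversion (d : ℕ) (c : ℕ → ℤ) {i : ℕ} (hi : i ≤ d) :
    ∑ j ∈ Finset.range (i + 1), (-1 : ℤ) ^ (i - j) * ((d - j).choose (i - j) : ℤ) *
      ∑ l ∈ Finset.range (j + 1), c l * ((d - l).choose (j - l) : ℤ) = c i := by
  simp_rw [Finset.mul_sum]
  rw [Finset.sum_comm' (t' := Finset.range (i + 1)) (s' := fun l => Finset.Ico l (i + 1))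
    (by intro x y; simp only [Finset.mem_range, Finset.mem_Ico]; omega)]
  have h : ∀ l ∈ Finset.range (i + 1), ∑ j ∈ Finset.Ico l (i + 1),
      (-1 : ℤ) ^ (i - j) * ((d - j).choose (i - j) : ℤ) * (c l * ((d - l).choose (j - l) : ℤ)) =
      if l = i then c i else 0 := by
    intro l hl
    rw [Finset.mem_range] at hl
    rw [Finset.sum_Ico_eq_sum_range, show i + 1 - l = i - l + 1 by omega]
    have h2 : ∀ t ∈ Finset.range (i - l + 1), (-1 : ℤ) ^ (i - (l + t)) *
        ((d - (l + t)).choose (i - (l + t)) : ℤ) * (c l * ((d - l).choose (l + t - l) : ℤ)) =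
        (c l * ((d - l).choose (i - l) : ℤ)) *
          ((-1 : ℤ) ^ (i - l - t) * ((i - l).choose t : ℤ)) := by
      intro t ht
      rw [Finset.mem_range] at ht
      have := Nat.choose_mul (n := d - l) (k := i - l) (s := t) (by omega)
      rw [show l + t - l = t by omega, show d - (l + t) = d - l - t by omega,
        show i - (l + t) = i - l - t by omega]
      have h3 : ((d - l).choose (i - l) : ℤ) * ((i - l).choose t : ℤ) =
        ((d - l).choose t : ℤ) * ((d - l - t).choose (i - l - t) : ℤ) := by exact_mod_cast this
      linear_combination -(c l * (-1) ^ (i - l - t)) * h3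
    rw [Finset.sum_congr rfl h2, ← Finset.mul_sum, sum_neg_one_pow_choose]
    by_cases hli : l = i
    · subst hli
      simp
    · rw [if_neg (by omega), if_neg hli, mul_zero]
  rw [Finset.sum_congr rfl h, Finset.sum_ite_eq' , if_pos (by simp)]

namespace Sys

variable {ι V : Type*} [Fintype ι] [DecidableEq ι] [AddCommGroup V] [Module ℝ V]
  [FiniteDimensional ℝ V] {A : Sys ι V} {η : Module.Dual ℝ V}

/-- The face numbers determine the index numbers. -/
lemma sum_card_faces (hη : A.Gen η) {i : ℕ} (hi : i ≤ Module.finrank ℝ V) :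
    ∑ j ∈ Finset.range (i + 1), (-1 : ℤ) ^ (i - j) *
      ((Module.finrank ℝ V - j).choose (i - j) : ℤ) * ((A.faces ∅ j).card : ℤ) =
    A.idx η ∅ i := by
  rw [← choose_inversion _ (fun i => (A.idx η ∅ i : ℤ)) hi]
  refine Finset.sum_congr rfl fun j _ => ?_
  rw [card_faces hη]
  simp

end Sys

section Geometry

variable {d : ℕ} {P : Set (Fin d → ℝ)}

lemma finite_extremePoints (hpoly : IsPolytope P) : (P.extremePoints ℝ).Finite := by
  obtain ⟨W, rfl⟩ := hpoly
  exact W.finite_toSet.subset extremePoints_convexHull_subset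

lemma isCompact_of_isPolytope (hpoly : IsPolytope P) : IsCompact P := by
  obtain ⟨W, rfl⟩ := hpoly
  exact W.finite_toSet.isCompact_convexHull ℝ

lemma convex_of_isPolytope (hpoly : IsPolytope P) : Convex ℝ P := by
  obtain ⟨W, rfl⟩ := hpoly
  exact convex_convexHull ℝ _

lemma convexHull_extremePoints {F : Set (Fin d → ℝ)} (hc : IsCompact F) (hF : Convex ℝ F)
    (hfin : (F.extremePoints ℝ).Finite) : convexHull ℝ (F.extremePoints ℝ) = F := by
  rw [← (hfin.isClosed_convexHull ℝ).closure_eq, closure_convexHull_extremePoints hc hF]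

lemma le_of_le_extremePoints (hpoly : IsPolytope P) {y : Module.Dual ℝ (Fin d → ℝ)} {c : ℝ}
    (h : ∀ v ∈ P.extremePoints ℝ, y v ≤ c) : ∀ x ∈ P, y x ≤ c := by
  rw [← convexHull_extremePoints (isCompact_of_isPolytope hpoly) (convex_of_isPolytope hpoly)
    (finite_extremePoints hpoly)]
  exact convexHull_min h (convex_halfSpace_le y.isLinear c)

lemma neg_mem_of_eq_neg (hsym : P = -P) {x : Fin d → ℝ} (hx : x ∈ P) : -x ∈ P := by
  rw [hsym]
  exact Set.neg_mem_neg.2 hx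

lemma eq_zero_of_nonpos (hsym : P = -P) {y : Module.Dual ℝ (Fin d → ℝ)} (h : ∀ x ∈ P, y x ≤ 0) :
    ∀ x ∈ P, y x = 0 := fun x hx => by
  have h2 := h _ (neg_mem_of_eq_neg hsym hx)
  rw [map_neg] at h2
  linarith [h x hx]

lemma dual_eq_zero (hfull : affineSpan ℝ P = ⊤) {y : Module.Dual ℝ (Fin d → ℝ)}
    (h : ∀ x ∈ P, y x = 0) : y = 0 := by
  have h2 : affineSpan ℝ P ≤ (LinearMap.ker y).toAffineSubspace := affineSpan_le.2 h
  rw [hfull] at h2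
  exact LinearMap.ext fun x => h2 (AffineSubspace.mem_top ℝ (Fin d → ℝ) x)

lemma nonempty_of_affineSpan_eq_top (hfull : affineSpan ℝ P = ⊤) : P.Nonempty := by
  rw [Set.nonempty_iff_ne_empty]
  rintro rfl
  rw [AffineSubspace.span_empty] at hfull
  exact AffineSubspace.bot_ne_top ℝ (Fin d → ℝ) (Fin d → ℝ) hfull

lemma zero_mem_of_eq_neg (hpoly : IsPolytope P) (hsym : P = -P) (hne : P.Nonempty) :
    (0 : Fin d → ℝ) ∈ P := by
  obtain ⟨x, hx⟩ := hne
  have h := convex_of_isPolytope hpoly hx (neg_mem_of_eq_neg hsym hx)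
    (by norm_num : (0 : ℝ) ≤ 1 / 2) (by norm_num : (0 : ℝ) ≤ 1 / 2) (by norm_num)
  simpa using h

lemma neg_mem_extremePoints (hsym : P = -P) {v : Fin d → ℝ} (hv : v ∈ P.extremePoints ℝ) :
    -v ∈ P.extremePoints ℝ := by
  have h := image_extremePoints (𝕜 := ℝ) (LinearEquiv.neg ℝ (M := Fin d → ℝ)) P
  have h2 : (LinearEquiv.neg ℝ (M := Fin d → ℝ)) '' P = P := by
    conv_rhs => rw [hsym]
    rw [← Set.image_neg_eq_neg]
    rfl
  rw [h2] at h
  rw [← h]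
  exact ⟨v, hv, rfl⟩

/-- The points of a set at level one. -/
def level (P : Set (Fin d → ℝ)) (y : Module.Dual ℝ (Fin d → ℝ)) : Set (Fin d → ℝ) :=
  {x | x ∈ P ∧ y x = 1}

lemma isProperFace_level (h0 : (0 : Fin d → ℝ) ∈ P) {y : Module.Dual ℝ (Fin d → ℝ)}
    (h1 : ∀ x ∈ P, y x ≤ 1) (hne : (level P y).Nonempty) : IsProperFace P (level P y) := by
  refine ⟨hne, fun he => ?_, fun _ => ⟨LinearMap.toContinuousLinearMap y, ?_⟩⟩
  · rw [← he] at h0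
    have := h0.2
    simp at this
  · obtain ⟨x₀, hx₀⟩ := hne
    ext x
    refine ⟨fun hx => ⟨hx.1, fun z hz => ?_⟩, fun hx => ⟨hx.1, le_antisymm (h1 x hx.1) ?_⟩⟩
    · change y z ≤ y x
      rw [hx.2]
      exact h1 z hz
    · have := hx.2 x₀ hx₀.1
      change y x₀ ≤ y x at this
      rwa [hx₀.2] at this

lemma exists_eq_level (hsym : P = -P) {F : Set (Fin d → ℝ)} (hF : IsProperFace P F) :
    ∃ y : Module.Dual ℝ (Fin d → ℝ), (∀ x ∈ P, y x ≤ 1) ∧ F = level P y := by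
  obtain ⟨hne, hP, hexp⟩ := hF
  obtain ⟨l, hl⟩ := hexp hne
  obtain ⟨x₀, hx₀⟩ := hne
  rw [hl] at hx₀
  have hpos : 0 < l x₀ := by
    by_contra hneg
    have h2 := eq_zero_of_nonpos hsym (y := (l : (Fin d → ℝ) →ₗ[ℝ] ℝ)) fun x hx =>
      (hx₀.2 x hx).trans (not_lt.1 hneg)
    refine hP ?_
    rw [hl]
    ext x
    refine ⟨fun hx => hx.1, fun hx => ⟨hx, fun z hz => ?_⟩⟩
    have h3 : l z = 0 := h2 z hz
    have h4 : l x = 0 := h2 x hx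
    rw [h3, h4]
  have happ : ∀ x, ((l x₀)⁻¹ • (l : (Fin d → ℝ) →ₗ[ℝ] ℝ)) x = l x / l x₀ := fun x => by
    rw [LinearMap.smul_apply, smul_eq_mul, div_eq_inv_mul]
    rfl
  refine ⟨(l x₀)⁻¹ • (l : (Fin d → ℝ) →ₗ[ℝ] ℝ), fun x hx => ?_, ?_⟩
  · rw [happ, div_le_one hpos]
    exact hx₀.2 x hx
  · ext x
    rw [hl, level, Set.mem_ofPred_eq, Set.mem_ofPred_eq, happ, div_eq_one_iff_eq hpos.ne']
    refine ⟨fun hx => ⟨hx.1, le_antisymm (hx₀.2 x hx.1) (hx.2 x₀ hx₀.1)⟩,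
      fun hx => ⟨hx.1, fun z hz => ?_⟩⟩
    rw [hx.2]
    exact hx₀.2 z hz

lemma extremePoints_face {F : Set (Fin d → ℝ)} (hF : IsProperFace P F) :
    F.extremePoints ℝ = F ∩ P.extremePoints ℝ :=
  hF.2.2.isExtreme.extremePoints_eq

lemma convexHull_face (hpoly : IsPolytope P) {F : Set (Fin d → ℝ)} (hF : IsProperFace P F) :
    convexHull ℝ (F ∩ P.extremePoints ℝ) = F := by
  have h := extremePoints_face hF
  rw [← h]
  refine convexHull_extremePoints (hF.2.2.isCompact (isCompact_of_isPolytope hpoly))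
    (hF.2.2.convex (convex_of_isPolytope hpoly)) ?_
  rw [h]
  exact (finite_extremePoints hpoly).subset Set.inter_subset_right

lemma linearIndependent_of_affineIndependent {κ E : Type*} [AddCommGroup E] [Module ℝ E]
    {p : κ → E} (h : AffineIndependent ℝ p) {y : Module.Dual ℝ E} (hy : ∀ k, y (p k) = 1) :
    LinearIndependent ℝ p := by
  rw [linearIndependent_iff']
  intro s g hg
  refine affineIndependent_iff.1 h s g ?_ hg
  have h2 := congrArg y hg
  rw [map_sum, map_zero] at h2
  rw [← h2]
  refine Finset.sum_congr rfl fun k _ => ?_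
  rw [map_smul, hy, smul_eq_mul, mul_one]

lemma linearIndependent_tight (hpoly : IsPolytope P) (hsym : P = -P) (hne : P.Nonempty)
    (hsimp : IsSimplicial P) {y : Module.Dual ℝ (Fin d → ℝ)}
    (h1 : ∀ v ∈ P.extremePoints ℝ, y v ≤ 1) : LinearIndependent ℝ
      (fun v : {v : P.extremePoints ℝ // y v = 1} => ((v : P.extremePoints ℝ) : Fin d → ℝ)) := by
  have h2 : ∀ x ∈ P, y x ≤ 1 := le_of_le_extremePoints hpoly h1
  by_cases hE : IsEmpty {v : P.extremePoints ℝ // y v = 1}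
  · exact linearIndependent_empty_type
  · rw [not_isEmpty_iff] at hE
    obtain ⟨v₀, hv₀⟩ := hE
    have hF := isProperFace_level (zero_mem_of_eq_neg hpoly hsym hne) h2 ⟨v₀, v₀.2.1, hv₀⟩
    let e : {v : P.extremePoints ℝ // y v = 1} ↪ (level P y).extremePoints ℝ :=
      ⟨fun v => ⟨v, by rw [extremePoints_face hF]; exact ⟨⟨v.1.2.1, v.2⟩, v.1.2⟩⟩,
        fun v w h => by
          have h2 := congrArg Subtype.val h
          exact Subtype.ext (Subtype.ext h2)⟩
    exact linearIndependent_of_affineIndependent ((hsimp _ hF).comp_embedding e) fun v => v.2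

/-- The system of inequalities of the polar of a centrally symmetric simplicial polytope. -/
noncomputable def polarSys (hpoly : IsPolytope P) (hsym : P = -P) (hfull : affineSpan ℝ P = ⊤)
    (hsimp : IsSimplicial P) : Sys (P.extremePoints ℝ) (Module.Dual ℝ (Fin d → ℝ)) where
  a v := Module.Dual.eval ℝ (Fin d → ℝ) v
  pos y hy := by
    by_contra! h
    exact hy (dual_eq_zero hfull (eq_zero_of_nonpos hsym
      (le_of_le_extremePoints hpoly fun v hv => h ⟨v, hv⟩)))
  simple y hy := (linearIndependent_tight hpoly hsym (nonempty_of_affineSpan_eq_top hfull) hsimp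
    fun v hv => hy ⟨v, hv⟩).map' _ (Module.eval_ker ℝ (Fin d → ℝ))

variable (hpoly : IsPolytope P) (hsym : P = -P) (hfull : affineSpan ℝ P = ⊤)
  (hsimp : IsSimplicial P)

/-- The antipodal map on vertices. -/
def antipode (hsym : P = -P) : Equiv.Perm (P.extremePoints ℝ) :=
  Function.Involutive.toPerm (fun v => ⟨-v, neg_mem_extremePoints hsym v.2⟩)
    fun _ => Subtype.ext (neg_neg _)

lemma antipode_antipode (v : P.extremePoints ℝ) : antipode hsym (antipode hsym v) = v :=
  Subtype.ext (neg_neg _)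

lemma polarSys_antipode (v : P.extremePoints ℝ) :
    (polarSys hpoly hsym hfull hsimp).a (antipode hsym v) =
      -(polarSys hpoly hsym hfull hsimp).a v :=
  map_neg (Module.Dual.eval ℝ (Fin d → ℝ)) _

lemma finrank_direction_face (hpoly : IsPolytope P) (hsimp : IsSimplicial P)
    {F : Set (Fin d → ℝ)} (hF : IsProperFace P F) :
    Module.finrank ℝ (affineSpan ℝ F).direction + 1 = (F ∩ P.extremePoints ℝ).ncard := by
  have hfin : (F.extremePoints ℝ).Finite := by
    rw [extremePoints_face hF]
    exact (finite_extremePoints hpoly).subset Set.inter_subset_right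
  have hch := convexHull_face hpoly hF
  rw [← extremePoints_face hF] at hch ⊢
  have hne : (F.extremePoints ℝ).Nonempty := by
    rw [← convexHull_nonempty_iff (𝕜 := ℝ), hch]
    exact hF.1
  have := hfin.fintype
  have hpos : 0 < (F.extremePoints ℝ).ncard := (Set.ncard_pos hfin).2 hne
  have h := (hsimp F hF).finrank_vectorSpan (n := (F.extremePoints ℝ).ncard - 1) (by
    rw [← Nat.card_eq_fintype_card, Nat.card_coe_set_eq]
    omega)
  rw [Subtype.range_coe] at h
  conv_lhs => rw [← hch, affineSpan_convexHull, direction_affineSpan, h]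
  omega

lemma faceCount_eq [Fintype (P.extremePoints ℝ)] [DecidableEq (P.extremePoints ℝ)] (j : ℕ) :
    faceCount P j = ((polarSys hpoly hsym hfull hsimp).faces ∅ (j + 1)).card := by
  classical
  set A := polarSys hpoly hsym hfull hsimp with hA
  have h0 := zero_mem_of_eq_neg hpoly hsym (nonempty_of_affineSpan_eq_top hfull)
  let Φ : Set (Fin d → ℝ) → Finset (P.extremePoints ℝ) := fun F =>
    Finset.univ.filter fun v => (v : Fin d → ℝ) ∈ F
  have hΦ : ∀ F, Subtype.val '' (Φ F : Set (P.extremePoints ℝ)) = F ∩ P.extremePoints ℝ := by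
    intro F
    ext x
    simp only [Φ, Finset.coe_filter, Finset.mem_univ, true_and, Set.mem_image, Set.mem_ofPred_eq]
    exact ⟨by rintro ⟨v, hv, rfl⟩; exact ⟨hv, v.2⟩, fun hx => ⟨⟨x, hx.2⟩, hx.1, rfl⟩⟩
  have hcard : ∀ F, (F ∩ P.extremePoints ℝ).ncard = (Φ F).card := by
    intro F
    rw [← hΦ, Set.ncard_image_of_injective _ Subtype.val_injective, Set.ncard_coe_finset]
  have hlevel : ∀ y, Φ (level P y) = A.tight y := by
    intro y
    ext v
    rw [Sys.mem_tight A]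
    simp only [Φ, Finset.mem_filter, Finset.mem_univ, true_and, level, Set.mem_ofPred_eq]
    exact ⟨fun h => h.2, fun h => ⟨v.2.1, h⟩⟩
  have hinj : Set.InjOn Φ {F | IsProperFace P F ∧
      Module.finrank ℝ (affineSpan ℝ F).direction = j} := by
    intro F hF F' hF' he
    rw [← convexHull_face hpoly hF.1, ← convexHull_face hpoly hF'.1, ← hΦ, ← hΦ, he]
  rw [faceCount, ← hinj.ncard_image, ← Set.ncard_coe_finset]
  congr 1
  ext T
  rw [Finset.mem_coe, Sys.mem_faces, Finset.card_empty, zero_add]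
  constructor
  · rintro ⟨F, ⟨hF, hj⟩, rfl⟩
    have h2 := finrank_direction_face hpoly hsimp hF
    rw [hcard, hj] at h2
    obtain ⟨y, hy, rfl⟩ := exists_eq_level hsym hF
    exact ⟨⟨y, fun v => hy v v.2.1, (hlevel y).symm⟩, Finset.empty_subset _, h2.symm⟩
  · rintro ⟨⟨y, hy, rfl⟩, -, hc⟩
    have hy' : ∀ x ∈ P, y x ≤ 1 := le_of_le_extremePoints hpoly fun v hv => hy ⟨v, hv⟩
    obtain ⟨v, hv⟩ : (A.tight y).Nonempty := by
      rw [← Finset.card_pos]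
      omega
    have hF := isProperFace_level h0 hy' ⟨v, v.2.1, (Sys.mem_tight A).1 hv⟩
    have h2 := finrank_direction_face hpoly hsimp hF
    rw [hcard, hlevel, hc] at h2
    exact ⟨level P y, ⟨hF, by omega⟩, hlevel y⟩

lemma fm_eq [Fintype (P.extremePoints ℝ)] [DecidableEq (P.extremePoints ℝ)] (j : ℕ) :
    fm P j = ((polarSys hpoly hsym hfull hsimp).faces ∅ j).card := by
  rcases j with - | j
  · have : (polarSys hpoly hsym hfull hsimp).faces ∅ 0 = {∅} := by
      ext F
      rw [Sys.mem_faces, Finset.mem_singleton, Finset.card_empty, Finset.card_eq_zero]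
      refine ⟨fun h => h.2.2, ?_⟩
      rintro rfl
      exact ⟨Sys.isFace_empty, Finset.empty_subset _, rfl⟩
    rw [fm, if_pos rfl, this, Finset.card_singleton, Nat.cast_one]
  · rw [fm, if_neg (Nat.succ_ne_zero j), Nat.add_sub_cancel, faceCount_eq hpoly hsym hfull hsimp]

lemma hP_eq [Fintype (P.extremePoints ℝ)] [DecidableEq (P.extremePoints ℝ)]
    {η : Module.Dual ℝ (Module.Dual ℝ (Fin d → ℝ))}
    (hη : (polarSys hpoly hsym hfull hsimp).Gen η) {i : ℕ} (hi : i ≤ d) :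
    hP P i = (polarSys hpoly hsym hfull hsimp).idx η ∅ i := by
  have hd : Module.finrank ℝ (Module.Dual ℝ (Fin d → ℝ)) = d := by
    rw [Subspace.dual_finrank_eq, Module.finrank_fin_fun]
  rw [← Sys.sum_card_faces hη (by rwa [hd]), hd, hP]
  exact Finset.sum_congr rfl fun j _ => by rw [fm_eq hpoly hsym hfull hsimp]

end Geometry

end CSPoly

/-- Stanley's theorem: the `g`-numbers of a centrally symmetric simplicial `d`-polytope
satisfy `g_r(P) ≥ C(d,r) - C(d,r-1)` for `1 ≤ r ≤ ⌊d/2⌋`. -/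
theorem stmt17 {d : ℕ} (P : Set (Fin d → ℝ))
    (hpoly : IsPolytope P) (hsym : P = -P) (hfull : affineSpan ℝ P = ⊤)
    (hsimp : IsSimplicial P) :
    ∀ r : ℕ, 1 ≤ r → r ≤ d / 2 →
      (d.choose r : ℤ) - (d.choose (r - 1) : ℤ) ≤ hP P r - hP P (r - 1) := by
  classical
  rintro (- | j) h1 hr
  · omega
  have := (CSPoly.finite_extremePoints hpoly).fintype
  obtain ⟨η, hη⟩ := (CSPoly.polarSys hpoly hsym hfull hsimp).exists_gen
  have hd : Module.finrank ℝ (Module.Dual ℝ (Fin d → ℝ)) = d := by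
    rw [Subspace.dual_finrank_eq, Module.finrank_fin_fun]
  have h := CSPoly.Sys.choose_sub_choose_le (CSPoly.polarSys_antipode hpoly hsym hfull hsimp)
    (CSPoly.antipode_antipode hsym) hη (j := j) (by omega)
  rw [hd] at h
  rw [Nat.add_sub_cancel, CSPoly.hP_eq hpoly hsym hfull hsimp hη (by omega),
    CSPoly.hP_eq hpoly hsym hfull hsimp hη (by omega)]
  exact h
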